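/- Let X be a compact Hausdorff topological space and let f : S² → X be a continuous map from the unit 2-sphere such that for every x ∈ X the fiber f⁻¹(x) is nonempty and connected, and its complement S² \ f⁻¹(x) is nonempty and connected. Then X is homeomorphic to S². -/

import Mathlib

open Metric
open Set Topology Filter


def HasLog (K : Set ℂ) (g : ℂ → ℂ) : Prop :=
  ∃ h : ℂ → ℂ, ContinuousOn h K ∧ ∀ z ∈ K, Complex.exp (h z) = g z

def Unb (K : Set ℂ) (p : ℂ) : Prop := ∀ R : ℝ, ∃ q, R < ‖q‖ ∧ JoinedIn Kᶜ p q

lemma HasLog.move {K : Set ℂ} {a a' : ℂ} {d : ℝ} (hd : ∀ z ∈ K, d ≤ ‖z - a‖)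
    (ha : ‖a' - a‖ < d) (h : HasLog K (fun z => z - a)) : HasLog K (fun z => z - a') := by
  obtain ⟨g, hg, hg'⟩ := h
  have hd0 : 0 < d := lt_of_le_of_lt (norm_nonneg _) ha
  have hne : ∀ z ∈ K, z - a ≠ 0 := fun z hz h0 => by
    have := hd z hz; rw [h0, norm_zero] at this; linarith
  have hsl : ∀ z ∈ K, 1 + (-(a' - a) / (z - a)) ∈ Complex.slitPlane := by
    intro z hz
    apply Complex.mem_slitPlane_of_norm_lt_one
    rw [norm_div, norm_neg, div_lt_one (norm_pos_iff.2 (hne z hz))]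
    exact lt_of_lt_of_le ha (hd z hz)
  refine ⟨fun z => g z + Complex.log (1 + (-(a' - a) / (z - a))), ?_, ?_⟩
  · refine hg.add (ContinuousOn.clog ?_ hsl)
    refine continuousOn_const.add (continuousOn_const.div (by fun_prop) hne)
  · intro z hz
    rw [Complex.exp_add, hg' z hz, Complex.exp_log (Complex.slitPlane_ne_zero (hsl z hz))]
    have := hne z hz
    field_simp
    ring

lemma HasLog.of_unb {K : Set ℂ} (hK : IsCompact K) {p : ℂ} (h : Unb K p) :
    HasLog K (fun z => z - p) := by
  obtain ⟨R, hR⟩ := hK.isBounded.exists_norm_le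
  obtain ⟨q, hq, hj⟩ := h (max R 0)
  have hq0 : q ≠ 0 := by
    rintro rfl; simp at hq
  have hRq : ∀ z ∈ K, ‖z‖ < ‖q‖ := fun z hz => (hR z hz).trans_lt ((le_max_left _ _).trans_lt hq)
  have hbase : HasLog K (fun z => z - q) := by
    have hsl : ∀ z ∈ K, 1 + (-z / q) ∈ Complex.slitPlane := by
      intro z hz
      apply Complex.mem_slitPlane_of_norm_lt_one
      rw [norm_div, norm_neg, div_lt_one (norm_pos_iff.2 hq0)]
      exact hRq z hz
    refine ⟨fun z => Complex.log (-q) + Complex.log (1 + (-z / q)), ?_, ?_⟩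
    · refine continuousOn_const.add (ContinuousOn.clog (by fun_prop) hsl)
    · intro z hz
      rw [Complex.exp_add, Complex.exp_log (by simpa using hq0),
        Complex.exp_log (Complex.slitPlane_ne_zero (hsl z hz))]
      field_simp
      ring
  obtain ⟨γ, hγ⟩ := hj
  have hlc : IsLocallyConstant (fun t : unitInterval => HasLog K (fun z => z - γ t)) := by
    rw [IsLocallyConstant.iff_eventually_eq]
    intro t
    obtain ⟨d, hd, hdK⟩ := Metric.mem_nhds_iff.1 (hK.isClosed.isOpen_compl.mem_nhds (hγ t))
    have hev : ∀ᶠ s in 𝓝 t, dist (γ s) (γ t) < d / 2 :=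
      (γ.continuous.tendsto t).eventually (Metric.ball_mem_nhds _ (by positivity))
    have hd' : ∀ z ∈ K, d ≤ ‖z - γ t‖ := by
      intro z hz
      by_contra hlt
      push Not at hlt
      exact hdK (by rwa [Metric.mem_ball, dist_eq_norm]) hz
    filter_upwards [hev] with s hs
    rw [dist_eq_norm] at hs
    apply propext
    constructor
    · refine HasLog.move (d := d / 2) ?_ (by rw [norm_sub_rev]; exact hs)
      intro z hz
      have h1 := hd' z hz
      have h2 : ‖z - γ t‖ ≤ ‖z - γ s‖ + ‖γ s - γ t‖ := by
        simpa using norm_add_le (z - γ s) (γ s - γ t)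
      linarith
    · exact HasLog.move hd' (by linarith)
  have := hlc.apply_eq_of_preconnectedSpace 0 1
  simp only [γ.source, γ.target] at this
  rw [this]; exact hbase

lemma isOpen_joinedIn {X : Type*} [TopologicalSpace X] [LocallyPathConnectedSpace X]
    {U : Set X} (hU : IsOpen U) (p : X) : IsOpen {q | JoinedIn U p q} := by
  rw [isOpen_iff_mem_nhds]
  intro q hq
  have := hU.pathComponentIn p
  exact this.mem_nhds hq

lemma joinedIn_of_closure {X : Type*} [TopologicalSpace X] [LocallyPathConnectedSpace X]
    {U : Set X} (hU : IsOpen U) {p q : X} (hq : q ∈ closure {q | JoinedIn U p q}) (hqU : q ∈ U) :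
    JoinedIn U p q := by
  obtain ⟨r, hr1, hr2⟩ := mem_closure_iff.1 hq _ (isOpen_joinedIn hU q) (JoinedIn.refl hqU)
  exact hr2.trans hr1.symm

lemma no_log_circle (L : ℂ → ℂ) (hL : Continuous L) (p : ℂ) (R : ℝ)
    (h : ∀ z, R < ‖z‖ → Complex.exp (L z) = z - p) : False := by
  set ρ : ℝ := |R| + ‖p‖ + 1
  have hρ : 0 < ρ := by positivity
  set c : ℝ → ℂ := fun θ => p + ρ * Complex.exp (θ * Complex.I)
  have hc : Continuous c := by fun_prop
  have hcn : ∀ θ, R < ‖c θ‖ := by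
    intro θ
    have h1 : ‖(ρ : ℂ) * Complex.exp (θ * Complex.I)‖ = ρ := by
      rw [norm_mul, Complex.norm_exp_ofReal_mul_I, mul_one, Complex.norm_real]
      exact abs_of_pos hρ
    have h2 : ‖(ρ : ℂ) * Complex.exp (θ * Complex.I)‖ ≤ ‖c θ‖ + ‖p‖ := by
      have := norm_sub_le (c θ) p
      simpa [c] using this
    rw [h1] at h2
    have := le_abs_self R
    simp only [ρ] at h2
    linarith
  set g : ℝ → ℂ := fun θ => L (c θ) - θ * Complex.I
  have hg : Continuous g := by fun_prop
  have hexp : ∀ θ, Complex.exp (g θ) = ρ := by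
    intro θ
    simp only [g, Complex.exp_sub, h _ (hcn θ), c]
    have := Complex.exp_ne_zero (θ * Complex.I)
    field_simp
    ring
  have hk : ∀ θ, ∃ k : ℤ, g θ = g 0 + k * (2 * Real.pi * Complex.I) := fun θ =>
    Complex.exp_eq_exp_iff_exists_int.1 ((hexp θ).trans (hexp 0).symm)
  have hpi := Real.pi_pos
  have hconst : g (2 * Real.pi) = g 0 := by
    have hlc : IsLocallyConstant g := by
      rw [IsLocallyConstant.iff_eventually_eq]
      intro t
      have hev : ∀ᶠ s in 𝓝 t, dist (g s) (g t) < 1 :=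
        (hg.tendsto t).eventually (Metric.ball_mem_nhds _ one_pos)
      filter_upwards [hev] with s hs
      obtain ⟨k, hk⟩ := Complex.exp_eq_exp_iff_exists_int.1 ((hexp s).trans (hexp t).symm)
      rw [dist_eq_norm, hk, add_sub_cancel_left] at hs
      simp only [norm_mul, Complex.norm_intCast, Complex.norm_ofNat, Complex.norm_real,
        Complex.norm_I, mul_one, Real.norm_eq_abs, abs_of_pos hpi] at hs
      have : k = 0 := by
        by_contra hk0
        have h1 : (1 : ℝ) ≤ |(k : ℝ)| := by exact_mod_cast Int.one_le_abs hk0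
        have := Real.pi_gt_three
        nlinarith
      rw [hk, this]; simp
    exact hlc.apply_eq_of_preconnectedSpace _ _
  have hcc : c (2 * Real.pi) = c 0 := by simp [c, Complex.exp_two_pi_mul_I]
  have : ((2 * Real.pi : ℝ) : ℂ) * Complex.I = 0 := by
    have h2 := hconst
    simp only [g, hcc] at h2
    simp at h2
  simp [hpi.ne'] at this

lemma HasLog.unb {K : Set ℂ} (hK : IsCompact K) {p : ℂ} (hp : p ∉ K)
    (h : HasLog K (fun z => z - p)) : Unb K p := by
  by_contra hunb
  unfold Unb at hunb
  push Not at hunb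
  obtain ⟨R, hR⟩ := hunb
  set U : Set ℂ := {q | JoinedIn Kᶜ p q} with hU
  have hUo : IsOpen U := isOpen_joinedIn hK.isClosed.isOpen_compl p
  have hpU : p ∈ U := JoinedIn.refl hp
  have hfr : ∀ z ∈ frontier U, z ∈ K := by
    intro z hz
    by_contra hzK
    have h1 := joinedIn_of_closure hK.isClosed.isOpen_compl (frontier_subset_closure hz) hzK
    rw [hUo.frontier_eq] at hz
    exact hz.2 h1
  obtain ⟨g, hg, hgK⟩ := h
  obtain ⟨G, hG⟩ := ContinuousMap.exists_restrict_eq hK.isClosed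
    (⟨K.domRestrict g, continuousOn_iff_continuous_domRestrict.1 hg⟩ : C(K, ℂ))
  have hGK : ∀ z ∈ K, G z = g z := fun z hz => congrArg (fun φ : C(K, ℂ) => φ ⟨z, hz⟩) hG
  classical
  set F : ℂ → ℂ := U.piecewise (fun z => Complex.exp (G z)) (fun z => z - p)
  have hF : Continuous F := by
    apply Continuous.piecewise _ (by fun_prop) (by fun_prop)
    intro a ha
    rw [hGK a (hfr a ha), hgK a (hfr a ha)]
  have hF0 : (0 : ℂ) ∉ F '' univ := by
    rintro ⟨z, -, hz⟩
    by_cases hzU : z ∈ U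
    · simp [F, hzU] at hz
    · simp only [F, hzU, not_false_eq_true, piecewise_eq_of_notMem, sub_eq_zero] at hz
      exact hzU (hz ▸ hpU)
  have hsc : IsSimplyConnected (univ : Set ℂ) := by
    have := (convex_univ : Convex ℝ (univ : Set ℂ)).contractibleSpace ⟨0, trivial⟩
    unfold IsSimplyConnected
    infer_instance
  obtain ⟨L, hL, hLF⟩ := Complex.exists_continuousOn_eqOn_exp_comp hsc isOpen_univ
    hF.continuousOn hF0
  refine no_log_circle L (continuousOn_univ.1 hL) p R ?_
  intro z hz
  have h1 := hLF (mem_univ z)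
  have h2 : z ∉ U := fun h => hR z hz h
  simpa [F, h2] using h1

lemma HasLog.union {A B : Set ℂ} (hA : IsClosed A) (hB : IsClosed B)
    (hAB : IsPreconnected (A ∩ B)) {g : ℂ → ℂ} (h1 : HasLog A g) (h2 : HasLog B g) :
    HasLog (A ∪ B) g := by
  obtain ⟨a, ha, hag⟩ := h1
  obtain ⟨b, hb, hbg⟩ := h2
  have hex : ∃ c : ℂ, Complex.exp c = 1 ∧ ∀ z ∈ A ∩ B, a z = b z + c := by
    rcases (A ∩ B).eq_empty_or_nonempty with he | ⟨w, hw⟩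
    · exact ⟨0, by simp, by simp [he]⟩
    · refine ⟨a w - b w, ?_, ?_⟩
      · have h0 : g w ≠ 0 := by rw [← hag w hw.1]; exact Complex.exp_ne_zero _
        rw [Complex.exp_sub, hag w hw.1, hbg w hw.2, div_self h0]
      · intro z hz
        have hcont : ContinuousOn (fun z => a z - b z) (A ∩ B) :=
          (ha.mono inter_subset_left).sub (hb.mono inter_subset_right)
        have hpre : IsPreconnected ((fun z => a z - b z) '' (A ∩ B)) := hAB.image _ hcont
        have hsub : (fun z => a z - b z) '' (A ∩ B) ⊆
            range (fun k : ℤ => (k : ℂ) * (2 * Real.pi * Complex.I)) := by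
          rintro _ ⟨y, hy, rfl⟩
          obtain ⟨k, hk⟩ := Complex.exp_eq_exp_iff_exists_int.1
            ((hag y hy.1).trans (hbg y hy.2).symm)
          exact ⟨k, by simp [hk]⟩
        have hss : ((fun z => a z - b z) '' (A ∩ B)).Subsingleton :=
          (((countable_range _).mono hsub).isTotallyDisconnected) _ Subset.rfl hpre
        have := hss ⟨z, hz, rfl⟩ ⟨w, hw, rfl⟩
        simp only at this
        linear_combination this
  obtain ⟨c, hc1, hc⟩ := hex
  classical
  refine ⟨A.piecewise a (fun z => b z + c), ?_, ?_⟩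
  · have e1 : ContinuousOn (A.piecewise a (fun z => b z + c)) A :=
      ha.congr (fun z hz => by simp [hz])
    have e2 : ContinuousOn (A.piecewise a (fun z => b z + c)) B := by
      have e3 : ContinuousOn (fun z => b z + c) B := hb.add continuousOn_const
      refine e3.congr (fun z hz => ?_)
      by_cases hzA : z ∈ A
      · simp only [hzA, piecewise_eq_of_mem]; exact hc z ⟨hzA, hz⟩
      · simp [hzA]
    exact e1.union_of_isClosed e2 hA hB
  · intro z hz
    by_cases hzA : z ∈ A
    · simp [hzA, hag z hzA]
    · simp only [hzA, not_false_eq_true, piecewise_eq_of_notMem]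
      rw [Complex.exp_add, hc1, mul_one, hbg z (hz.resolve_left hzA)]

def J1 (X : Type*) [TopologicalSpace X] : Prop :=
  ∀ A B : Set X, IsClosed A → IsClosed B → IsPreconnected (A ∩ B) →
    ∀ p q, JoinedIn Aᶜ p q → JoinedIn Bᶜ p q → JoinedIn (A ∪ B)ᶜ p q

lemma joined_iff_unb {S : Type*} [TopologicalSpace S] [CompactSpace S] [T2Space S]
    [LocallyPathConnectedSpace S] {q : S} {ψ : ℂ → S} (hψ : IsOpenEmbedding ψ)
    (hr : range ψ = {q}ᶜ) {A : Set S} (hA : IsClosed A) (hq : q ∉ A) (p : ℂ) :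
    JoinedIn Aᶜ (ψ p) q ↔ Unb (ψ ⁻¹' A) p := by
  have hKc : IsClosed (ψ ⁻¹' A) := hA.preimage hψ.continuous
  constructor
  · intro hj
    by_contra hunb
    unfold Unb at hunb
    push Not at hunb
    obtain ⟨R, hR⟩ := hunb
    set U : Set ℂ := {w | JoinedIn (ψ ⁻¹' A)ᶜ p w}
    have hUo : IsOpen U := isOpen_joinedIn hKc.isOpen_compl p
    have hpU : p ∈ U := JoinedIn.refl hj.mem.1
    have hUb : U ⊆ closedBall 0 R := by
      intro w hw
      rw [mem_closedBall_zero_iff]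
      by_contra hlt
      exact hR w (not_le.1 hlt) hw
    have hcl : closure U ⊆ closedBall 0 R := closure_minimal hUb isClosed_closedBall
    have hcomp : IsCompact (closure U) := (isCompact_closedBall _ _).of_isClosed_subset
      isClosed_closure hcl
    have hcl2 : IsClosed (ψ '' closure U) := (hcomp.image hψ.continuous).isClosed
    obtain ⟨γ, hγ⟩ := hj
    have hclopen : IsClopen (γ ⁻¹' (ψ '' U)) := by
      refine ⟨?_, (hψ.isOpenMap _ hUo).preimage γ.continuous⟩
      have : γ ⁻¹' (ψ '' U) = γ ⁻¹' (ψ '' closure U) := by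
        apply Subset.antisymm (preimage_mono (image_mono subset_closure))
        rintro t ⟨w, hw, hwt⟩
        refine ⟨w, joinedIn_of_closure hKc.isOpen_compl hw ?_, hwt⟩
        intro hwA
        exact hγ t (hwt ▸ hwA)
      rw [this]
      exact hcl2.preimage γ.continuous
    have huniv := hclopen.eq_univ ⟨0, by rw [mem_preimage, γ.source]; exact mem_image_of_mem _ hpU⟩
    have h1 : (1 : unitInterval) ∈ γ ⁻¹' (ψ '' U) := huniv ▸ mem_univ _
    rw [mem_preimage, γ.target] at h1
    have : q ∈ range ψ := image_subset_range _ _ h1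
    rw [hr] at this
    exact this rfl
  · intro h
    have hnb := isOpen_joinedIn hA.isOpen_compl q
    set V := {w | JoinedIn Aᶜ q w}
    have hVq : q ∈ V := JoinedIn.refl hq
    have hcomp : IsCompact (ψ ⁻¹' Vᶜ) := by
      refine (hψ.isInducing.isCompact_preimage_iff ?_).2 hnb.isClosed_compl.isCompact
      rw [hr]
      intro x hx hxq
      exact hx (hxq ▸ hVq)
    obtain ⟨R, hR⟩ := hcomp.isBounded.exists_norm_le
    obtain ⟨w, hw, hj⟩ := h R
    have hwV : ψ w ∈ V := by
      by_contra hwV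
      exact absurd (hR w hwV) (not_le.2 hw)
    have hj2 : JoinedIn Aᶜ (ψ p) (ψ w) := by
      obtain ⟨γ, hγ⟩ := hj
      exact ⟨γ.map hψ.continuous, fun t => hγ t⟩
    exact hj2.trans hwV.symm

lemma j1_of_charts {S : Type*} [TopologicalSpace S] [CompactSpace S] [T2Space S]
    [LocallyPathConnectedSpace S]
    (h : ∀ q : S, ∃ ψ : ℂ → S, IsOpenEmbedding ψ ∧ range ψ = {q}ᶜ) : J1 S := by
  intro A B hA hB hAB p q hpA hpB
  rcases eq_or_ne p q with rfl | hne
  · refine JoinedIn.refl ?_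
    rintro (h | h)
    exacts [hpA.mem.1 h, hpB.mem.1 h]
  obtain ⟨ψ, hψ, hr⟩ := h q
  obtain ⟨p, rfl⟩ : p ∈ range ψ := by rw [hr]; exact hne
  have hK : ∀ A : Set S, IsClosed A → q ∉ A → IsCompact (ψ ⁻¹' A) := by
    intro A hA hqA
    refine (hψ.isInducing.isCompact_preimage_iff ?_).2 hA.isCompact
    rw [hr]
    intro x hx hxq
    exact hqA (hxq ▸ hx)
  have hqA : q ∉ A := hpA.mem.2
  have hqB : q ∉ B := hpB.mem.2
  have hqAB : q ∉ A ∪ B := fun h => h.elim hqA hqB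
  rw [joined_iff_unb hψ hr hA hqA] at hpA
  rw [joined_iff_unb hψ hr hB hqB] at hpB
  rw [joined_iff_unb hψ hr (hA.union hB) hqAB]
  have l1 := HasLog.of_unb (hK A hA hqA) hpA
  have l2 := HasLog.of_unb (hK B hB hqB) hpB
  have hpre : IsPreconnected (ψ ⁻¹' A ∩ ψ ⁻¹' B) := by
    rw [← preimage_inter]
    refine hAB.preimage_of_isOpenMap hψ.injective hψ.isOpenMap ?_
    rw [hr]
    intro x hx hxq
    exact hqA (hxq ▸ hx.1)
  have l3 := l1.union (hA.preimage hψ.continuous) (hB.preimage hψ.continuous) hpre l2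
  refine HasLog.unb (hK _ (hA.union hB) hqAB) ?_ l3
  rintro (h | h)
  · obtain ⟨_, _, hj⟩ := hpA 0
    exact hj.mem.1 h
  · obtain ⟨_, _, hj⟩ := hpB 0
    exact hj.mem.1 h


class MS (X : Type) [MetricSpace X] : Prop where
  compact : CompactSpace X
  conn : ConnectedSpace X
  lpc : LocallyPathConnectedSpace X
  nontriv : Nontrivial X
  nocut : ∀ x : X, IsPreconnected ({x}ᶜ : Set X)
  j1 : J1 X

attribute [instance] MS.compact MS.conn MS.lpc MS.nontriv

abbrev Sph := ↥(sphere (0 : EuclideanSpace ℝ (Fin 3)) 1)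

instance factSph : Fact (Module.finrank ℝ (EuclideanSpace ℝ (Fin 3)) = 2 + 1) := ⟨by simp⟩

lemma sph_lpc : LocallyPathConnectedSpace Sph :=
  ChartedSpace.locallyPathConnectedSpace (EuclideanSpace ℝ (Fin 2)) Sph

lemma sph_j1 : J1 Sph := by
  have := sph_lpc
  apply j1_of_charts
  intro q
  set e := stereographic' 2 q
  set h : ℂ ≃ₜ EuclideanSpace ℝ (Fin 2) :=
    Complex.orthonormalBasisOneI.repr.toHomeomorph
  have ht : e.target = univ := stereographic'_target q
  have hs : e.source = {q}ᶜ := stereographic'_source q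
  have he : IsOpenEmbedding e.symm := e.symm.isOpenEmbedding ht
  refine ⟨e.symm ∘ h, he.comp h.isOpenEmbedding, ?_⟩
  rw [range_comp, h.surjective.range_eq, image_univ, ← hs]
  have := e.symm_image_target_eq_source
  rwa [ht, image_univ] at this

lemma sph_conn : ConnectedSpace Sph := by
  apply isConnected_iff_connectedSpace.1
  apply isConnected_sphere _ _ zero_le_one
  rw [← Module.finrank_eq_rank]
  simp

lemma metrizable_of_image {S X : Type*} [MetricSpace S] [CompactSpace S] [TopologicalSpace X]
    [CompactSpace X] [T2Space X] {f : S → X} (hf : Continuous f)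
    (hsurj : Function.Surjective f) : TopologicalSpace.MetrizableSpace X := by
  have hsc : SecondCountableTopology X := by
    set 𝓑 := TopologicalSpace.countableBasis S
    have h𝓑 := TopologicalSpace.isBasis_countableBasis S
    set T : Set (Set X) := (fun F : Set (Set S) => (f '' (⋃₀ F)ᶜ)ᶜ) '' {F | F.Finite ∧ F ⊆ 𝓑}
    have hT : T.Countable :=
      (Set.countable_ofPred_finite_subset (TopologicalSpace.countable_countableBasis S)).image _
    refine (TopologicalSpace.isTopologicalBasis_of_isOpen_of_nhds (s := T) ?_ ?_).secondCountableTopology hT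
    · rintro _ ⟨F, hF, rfl⟩
      have : IsOpen (⋃₀ F) := isOpen_sUnion fun V hV => h𝓑.isOpen (hF.2 hV)
      exact (this.isClosed_compl.isCompact.image hf).isClosed.isOpen_compl
    · intro x U hx hU
      have hK : IsCompact (f ⁻¹' {x}) := (isClosed_singleton.preimage hf).isCompact
      obtain ⟨F, hF1, hF2, hF3⟩ := hK.elim_finite_subcover_image (b := {V ∈ 𝓑 | V ⊆ f ⁻¹' U})
        (c := id) (fun V hV => h𝓑.isOpen hV.1) (by
          intro s hs
          have hsU : s ∈ f ⁻¹' U := by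
            rw [mem_preimage, (show f s = x from hs)]; exact hx
          obtain ⟨V, hV, hsV, hVU⟩ := h𝓑.exists_subset_of_mem_open hsU (hU.preimage hf)
          exact mem_biUnion (show V ∈ {V ∈ 𝓑 | V ⊆ f ⁻¹' U} from ⟨hV, hVU⟩) hsV)
      refine ⟨_, ⟨F, ⟨hF2, fun V hV => (hF1 hV).1⟩, rfl⟩, ?_, ?_⟩
      · rintro ⟨s, hs, hsx⟩
        apply hs
        rw [sUnion_eq_biUnion]
        exact hF3 hsx
      · intro y hy
        by_contra hyU
        apply hy
        obtain ⟨s, rfl⟩ := hsurj y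
        refine ⟨s, ?_, rfl⟩
        rintro ⟨V, hV, hsV⟩
        exact hyU ((hF1 hV).2 hsV)
  infer_instance

lemma ms_of_map {S X : Type} [MetricSpace S] [CompactSpace S] [ConnectedSpace S]
    [LocallyPathConnectedSpace S] [MetricSpace X] [CompactSpace X]
    (hS : J1 S) {f : S → X} (hf : Continuous f)
    (hfib : ∀ x : X, IsConnected (f ⁻¹' {x}) ∧ IsConnected ((f ⁻¹' {x})ᶜ)) : MS X := by
  have hsurj : Function.Surjective f := fun x => (hfib x).1.nonempty
  have hq : IsQuotientMap f := hf.isClosedMap.isQuotientMap hf hsurj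
  have := hq.locallyPathConnectedSpace
  have key : ∀ (T : Set X), IsClosed T → IsPreconnected T → IsPreconnected (f ⁻¹' T) := by
    intro T hT hTp
    rcases T.eq_empty_or_nonempty with rfl | hne
    · simp [isPreconnected_empty]
    · exact (hq.isCoinducing.isConnected_preimage_of_isClosed (fun x => (hfib x).1) hT
        ⟨hne, hTp⟩).isPreconnected
  have hjoin : ∀ (A : Set X), IsClosed A → ∀ p q : S, JoinedIn Aᶜ (f p) (f q) →
      JoinedIn (f ⁻¹' A)ᶜ p q := by
    intro A hA p q ⟨γ, hγ⟩
    have hr : IsPreconnected (f ⁻¹' range γ) := key _ (isCompact_range γ.continuous).isClosed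
      (isPreconnected_range γ.continuous)
    have hsub : f ⁻¹' range γ ⊆ (f ⁻¹' A)ᶜ := by
      rintro s ⟨t, ht⟩ hs
      exact hγ t (ht ▸ hs)
    have hp : p ∈ f ⁻¹' range γ := ⟨0, γ.source⟩
    have hq : q ∈ f ⁻¹' range γ := ⟨1, γ.target⟩
    have hO : IsOpen (f ⁻¹' A)ᶜ := (hA.preimage hf).isOpen_compl
    have h2 := hr.subset_connectedComponentIn hp hsub hq
    have h3 : IsConnected (connectedComponentIn (f ⁻¹' A)ᶜ p) :=
      isConnected_connectedComponentIn_iff.2 (hsub hp)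
    have h4 := (hO.connectedComponentIn.isConnected_iff_isPathConnected).1 h3
    exact (h4.joinedIn p (mem_connectedComponentIn (hsub hp)) q h2).mono
      (connectedComponentIn_subset _ _)
  refine ⟨inferInstance, hsurj.connectedSpace hf, inferInstance, ?_, ?_, ?_⟩
  · obtain ⟨s⟩ := (inferInstance : Nonempty S)
    obtain ⟨t, ht⟩ := (hfib (f s)).2.nonempty
    exact ⟨⟨f s, f t, fun h => ht h.symm⟩⟩
  · intro x
    have := (hfib x).2.isPreconnected.image f hf.continuousOn
    rwa [← preimage_compl, image_preimage_eq _ hsurj] at this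
  · intro A B hA hB hAB p q h1 h2
    obtain ⟨p, rfl⟩ := hsurj p
    obtain ⟨q, rfl⟩ := hsurj q
    have := hS (f ⁻¹' A) (f ⁻¹' B) (hA.preimage hf) (hB.preimage hf)
      (by rw [← preimage_inter]; exact key _ (hA.inter hB) hAB) p q
      (hjoin A hA p q h1) (hjoin B hB p q h2)
    obtain ⟨γ, hγ⟩ := this
    exact ⟨γ.map hf, fun t => hγ t⟩

lemma sph_ms : MS Sph := by
  have := sph_lpc
  have := sph_conn
  refine ms_of_map (f := id) sph_j1 continuous_id fun x => ⟨by simpa using isConnected_singleton, ?_⟩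
  rw [preimage_id]
  set e := stereographic' 2 x
  have ht : e.target = univ := stereographic'_target x
  have hs : e.source = {x}ᶜ := stereographic'_source x
  rw [← hs, ← e.symm_image_target_eq_source]
  have hc := e.symm.continuousOn
  rw [e.symm_source] at hc
  refine IsConnected.image ?_ _ hc
  rw [ht]
  exact isConnected_univ


def IsArc {X : Type*} [TopologicalSpace X] (P : Set X) (a b : X) : Prop :=
  ∃ γ : ℝ → X, ContinuousOn γ (Icc 0 1) ∧ InjOn γ (Icc 0 1) ∧ γ 0 = a ∧ γ 1 = b ∧
    γ '' Icc 0 1 = P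

lemma IsArc.of_interval {X : Type*} [TopologicalSpace X] {γ : ℝ → X} {s t : ℝ} (hst : s < t)
    (hc : ContinuousOn γ (Icc s t)) (hi : InjOn γ (Icc s t)) :
    IsArc (γ '' Icc s t) (γ s) (γ t) := by
  have him : (fun r : ℝ => s + r * (t - s)) '' Icc 0 1 = Icc s t := by
    ext y
    constructor
    · rintro ⟨r, ⟨h0, h1⟩, rfl⟩
      constructor <;> dsimp only <;> nlinarith
    · rintro ⟨h0, h1⟩
      refine ⟨(y - s) / (t - s), ⟨?_, ?_⟩, ?_⟩
      · exact div_nonneg (by linarith) (by linarith)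
      · rw [div_le_one (by linarith)]; linarith
      · have : t - s ≠ 0 := by linarith
        field_simp
        ring
  have hm : MapsTo (fun r : ℝ => s + r * (t - s)) (Icc 0 1) (Icc s t) := by
    rw [← him]; exact mapsTo_image _ _
  refine ⟨fun r => γ (s + r * (t - s)), ?_, ?_, by simp, by simp, ?_⟩
  · exact hc.comp (by fun_prop) hm
  · intro x hx y hy hxy
    have := hi (hm hx) (hm hy) hxy
    have h2 : t - s ≠ 0 := by linarith
    have h3 : x * (t - s) = y * (t - s) := by linarith
    exact mul_right_cancel₀ h2 h3
  · rw [← him, image_image]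

lemma arc_of_monotone_fibres {X : Type*} [MetricSpace X] {g : ℝ → X} (hg : Continuous g)
    (hb : ∀ r1 r2, 0 ≤ r1 → r1 < r2 → r2 ≤ 1 → g r1 = g r2 → ∀ s ∈ Icc r1 r2, g s = g r1)
    (hne : g 0 ≠ g 1) : IsArc (g '' Icc 0 1) (g 0) (g 1) := by
  set h : ℝ → ℝ → ℝ := fun u r =>
    sSup ((fun τ => dist (g u) (g (u + τ * (max u r - u)))) '' Icc (0 : ℝ) 1)
  have hcont : ∀ u, Continuous (h u) := by
    intro u
    apply isCompact_Icc.continuous_sSup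
    fun_prop
  have himg : ∀ u r, (fun τ => dist (g u) (g (u + τ * (max u r - u)))) '' Icc (0 : ℝ) 1 =
      (fun s => dist (g u) (g s)) '' Icc u (max u r) := by
    intro u r
    have hle : u ≤ max u r := le_max_left _ _
    ext y
    constructor
    · rintro ⟨τ, ⟨h0, h1⟩, rfl⟩
      refine ⟨_, ⟨?_, ?_⟩, rfl⟩ <;> nlinarith
    · rintro ⟨s, ⟨h0, h1⟩, rfl⟩
      rcases hle.eq_or_lt with he | hlt
      · refine ⟨0, by simp, ?_⟩
        have : s = u := le_antisymm (h1.trans he.ge) h0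
        simp [this]
      · refine ⟨(s - u) / (max u r - u), ⟨?_, ?_⟩, ?_⟩
        · exact div_nonneg (by linarith) (by linarith)
        · rw [div_le_one (by linarith)]; linarith
        · have : max u r - u ≠ 0 := by linarith
          simp only
          congr 2
          field_simp
          ring
  have hh : ∀ u r, h u r = sSup ((fun s => dist (g u) (g s)) '' Icc u (max u r)) := by
    intro u r
    simp only [h, himg]
  have hcomp : ∀ u r, IsCompact ((fun s => dist (g u) (g s)) '' Icc u (max u r)) := by
    intro u r
    exact isCompact_Icc.image (by fun_prop)
  have hnonneg : ∀ u r, 0 ≤ h u r := by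
    intro u r
    rw [hh]
    exact Real.sSup_nonneg (by rintro _ ⟨s, -, rfl⟩; exact dist_nonneg)
  have hmono : ∀ u, Monotone (h u) := by
    intro u r r' hrr
    rw [hh, hh]
    apply csSup_le_csSup (hcomp u r').bddAbove
    · exact ⟨_, ⟨u, ⟨le_rfl, le_max_left _ _⟩, rfl⟩⟩
    · apply image_mono
      apply Icc_subset_Icc_right
      exact max_le_max_left _ hrr
  have hle : ∀ u r s, u ≤ s → s ≤ r → dist (g u) (g s) ≤ h u r := by
    intro u r s h1 h2
    rw [hh]
    exact le_csSup (hcomp u r).bddAbove ⟨s, ⟨h1, h2.trans (le_max_right _ _)⟩, rfl⟩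
  have hzero : ∀ u r, r ≤ u → h u r = 0 := by
    intro u r hr
    rw [hh, max_eq_left hr]
    simp
  obtain ⟨D, hD⟩ : ∃ D, ∀ x ∈ Icc (0:ℝ) 1, ∀ y ∈ Icc (0:ℝ) 1, dist (g x) (g y) ≤ D := by
    have := ((isCompact_Icc (a := (0:ℝ)) (b := 1)).image hg).isBounded
    obtain ⟨D, hD⟩ := Metric.isBounded_iff.1 this
    exact ⟨D, fun x hx y hy => hD (mem_image_of_mem _ hx) (mem_image_of_mem _ hy)⟩
  have hD0 : 0 ≤ D := dist_nonneg.trans (hD 0 (by simp) 1 (by simp))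
  have hbd : ∀ u ∈ Icc (0:ℝ) 1, ∀ r ∈ Icc (0:ℝ) 1, h u r ≤ D := by
    intro u hu r hr
    rw [hh]
    apply Real.sSup_le _ hD0
    rintro _ ⟨s, hs, rfl⟩
    exact hD u hu s ⟨hu.1.trans hs.1, hs.2.trans (max_le hu.2 hr.2)⟩
  obtain ⟨q, hq⟩ : ∃ q : ℕ → ℝ, (∀ n, q n ∈ Icc (0:ℝ) 1) ∧
      ∀ x y, 0 ≤ x → x < y → y ≤ 1 → ∃ n, x < q n ∧ q n < y := by
    obtain ⟨q, hq⟩ := TopologicalSpace.exists_dense_seq ℝ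
    refine ⟨fun n => max 0 (min 1 (q n)), fun n => ⟨le_max_left _ _, ?_⟩, ?_⟩
    · exact max_le zero_le_one (min_le_left _ _)
    · intro x y h0 hxy h1
      obtain ⟨n, hn⟩ := hq.exists_mem_open isOpen_Ioo (nonempty_Ioo.2 hxy)
      refine ⟨n, ?_⟩
      have e1 : min 1 (q n) = q n := min_eq_right (by linarith [hn.2])
      have e2 : max 0 (q n) = q n := max_eq_right (by linarith [hn.1])
      simp only [e1, e2]
      exact hn
  have hsum : ∀ r ∈ Icc (0:ℝ) 1, Summable fun n : ℕ => (1/2:ℝ)^n * h (q n) r := by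
    intro r hr
    refine Summable.of_nonneg_of_le (fun n => mul_nonneg (by positivity) (hnonneg _ _)) (fun n => ?_)
      (summable_geometric_two.mul_right D)
    exact mul_le_mul_of_nonneg_left (hbd _ (hq.1 n) r hr) (by positivity)
  set c : ℝ → ℝ := fun r => ∑' n : ℕ, (1/2:ℝ)^n * h (q n) r
  have hcc : ContinuousOn c (Icc 0 1) := by
    refine continuousOn_tsum (u := fun n : ℕ => (1/2:ℝ)^n * D) (fun n => ?_)
      (summable_geometric_two.mul_right D) (fun n r hr => ?_)
    · exact (continuous_const.mul (hcont _)).continuousOn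
    · rw [Real.norm_of_nonneg (mul_nonneg (by positivity) (hnonneg _ _))]
      exact mul_le_mul_of_nonneg_left (hbd _ (hq.1 n) r hr) (by positivity)
  have hcm : MonotoneOn c (Icc 0 1) := by
    intro r hr s hs hrs
    refine (hsum r hr).tsum_le_tsum (fun n => ?_) (hsum s hs)
    exact mul_le_mul_of_nonneg_left (hmono _ hrs) (by positivity)
  have hlt : ∀ r1 r2, 0 ≤ r1 → r1 < r2 → r2 ≤ 1 → g r1 ≠ g r2 → c r1 < c r2 := by
    intro r1 r2 h0 h12 h1 hne
    have hr1 : r1 ∈ Icc (0:ℝ) 1 := ⟨h0, by linarith⟩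
    have hr2 : r2 ∈ Icc (0:ℝ) 1 := ⟨by linarith, h1⟩
    have hev : ∀ᶠ u in 𝓝 r1, g u ≠ g r2 := (hg.tendsto r1).eventually_ne hne
    obtain ⟨ε, hε, hε2⟩ := Metric.eventually_nhds_iff.1 hev
    obtain ⟨n, hn1, hn2⟩ := hq.2 r1 (min r2 (r1 + ε)) h0 (lt_min h12 (by linarith))
      ((min_le_left _ _).trans h1)
    refine (hsum r1 hr1).tsum_lt_tsum (i := n) (fun n => ?_) ?_ (hsum r2 hr2)
    · exact mul_le_mul_of_nonneg_left (hmono _ h12.le) (by positivity)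
    · apply mul_lt_mul_of_pos_left _ (by positivity)
      rw [hzero _ _ hn1.le]
      refine lt_of_lt_of_le ?_ (hle (q n) r2 r2 (hn2.le.trans (min_le_left _ _)) le_rfl)
      apply dist_pos.2
      apply hε2
      rw [Real.dist_eq, abs_of_pos (by linarith)]
      linarith [min_le_right r2 (r1 + ε)]
  have heq : ∀ r1 r2, 0 ≤ r1 → r1 < r2 → r2 ≤ 1 → g r1 = g r2 → c r1 = c r2 := by
    intro r1 r2 h0 h12 h1 he
    have hk := hb r1 r2 h0 h12 h1 he
    refine tsum_congr fun n => ?_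
    congr 1
    apply le_antisymm (hmono _ h12.le)
    rw [hh (q n) r2]
    apply Real.sSup_le _ (hnonneg _ _)
    rintro _ ⟨s, hs, rfl⟩
    by_cases hs1 : s ≤ r1
    · exact hle _ _ _ hs.1 hs1
    · push Not at hs1
      by_cases hqr : q n ≤ r1
      · have hs2 : s ≤ r2 := by
          have := hs.2; rw [max_eq_right (by linarith)] at this; exact this
        have : g s = g r1 := hk s ⟨hs1.le, hs2⟩
        simp only [this]
        exact hle _ _ _ hqr le_rfl
      · push Not at hqr
        by_cases hq2 : q n ≤ r2
        · have hs2 : s ≤ r2 := by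
            have := hs.2; rw [max_eq_right hq2] at this; exact this
          simp only [hk s ⟨hs1.le, hs2⟩, hk (q n) ⟨hqr.le, hq2⟩, dist_self]
          exact hnonneg _ _
        · push Not at hq2
          have hs2 : s ≤ q n := by
            have := hs.2; rw [max_eq_left hq2.le] at this; exact this
          have : s = q n := le_antisymm hs2 hs.1
          simp only [this, dist_self]
          exact hnonneg _ _
  have hiff : ∀ x ∈ Icc (0:ℝ) 1, ∀ y ∈ Icc (0:ℝ) 1, (c x = c y ↔ g x = g y) := by
    have key : ∀ x ∈ Icc (0:ℝ) 1, ∀ y ∈ Icc (0:ℝ) 1, x < y → (c x = c y ↔ g x = g y) := by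
      intro x hx y hy hxy
      constructor
      · intro h1
        by_contra h2
        exact (hlt x y hx.1 hxy hy.2 h2).ne h1
      · exact heq x y hx.1 hxy hy.2
    intro x hx y hy
    rcases lt_trichotomy x y with h1 | h1 | h1
    · exact key x hx y hy h1
    · simp [h1]
    · rw [eq_comm, key y hy x hx h1, eq_comm]
  have h01 : c 0 < c 1 := hlt 0 1 le_rfl one_pos le_rfl hne
  have hsurj : c '' Icc 0 1 = Icc (c 0) (c 1) := by
    apply Subset.antisymm
    · rintro _ ⟨r, hr, rfl⟩
      exact ⟨hcm (by simp) hr hr.1, hcm hr (by simp) hr.2⟩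
    · exact intermediate_value_Icc zero_le_one hcc
  have hex : ∀ y, ∃ r, y ∈ Icc (c 0) (c 1) → r ∈ Icc (0:ℝ) 1 ∧ c r = y := by
    intro y
    by_cases hy : y ∈ Icc (c 0) (c 1)
    · rw [← hsurj] at hy
      obtain ⟨r, hr, h⟩ := hy
      exact ⟨r, fun _ => ⟨hr, h⟩⟩
    · exact ⟨0, fun h => absurd h hy⟩
  choose ρ hρ using hex
  set η : ℝ → X := fun y => g (ρ y)
  have hηc : ∀ r ∈ Icc (0:ℝ) 1, η (c r) = g r := by
    intro r hr
    have := hρ (c r) (hsurj ▸ mem_image_of_mem _ hr)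
    exact (hiff _ this.1 _ hr).1 this.2
  have hηi : InjOn η (Icc (c 0) (c 1)) := by
    intro x hx y hy hxy
    have h1 := hρ x hx
    have h2 := hρ y hy
    rw [← h1.2, ← h2.2]
    exact (hiff _ h1.1 _ h2.1).2 hxy
  have hηcont : ContinuousOn η (Icc (c 0) (c 1)) := by
    rw [continuousOn_iff_isClosed]
    intro T hT
    refine ⟨c '' (Icc 0 1 ∩ g ⁻¹' T), ?_, ?_⟩
    · refine IsCompact.isClosed ?_
      exact (isCompact_Icc.inter_right (hT.preimage hg)).image_of_continuousOn
        (hcc.mono inter_subset_left)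
    · ext y
      constructor
      · rintro ⟨h1, h2⟩
        have := hρ y h2
        exact ⟨⟨ρ y, ⟨this.1, h1⟩, this.2⟩, h2⟩
      · rintro ⟨⟨r, ⟨hr, hrT⟩, rfl⟩, h2⟩
        refine ⟨?_, h2⟩
        rw [mem_preimage, hηc r hr]
        exact hrT
  have := IsArc.of_interval h01 hηcont hηi
  rw [hηc 0 (by simp), hηc 1 (by simp), ← hsurj, image_image] at this
  convert this using 1
  exact image_congr fun r hr => (hηc r hr).symm


def GapSet {X : Type*} (γ : ℝ → X) : Set (Set ℝ) :=
  {F | IsClosed F ∧ F ⊆ Icc 0 1 ∧ (0:ℝ) ∈ F ∧ (1:ℝ) ∈ F ∧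
    ∀ s ∈ F, ∀ t ∈ F, s < t → (∀ r ∈ F, ¬ (s < r ∧ r < t)) → γ s = γ t}

lemma exists_min_gapSet {X : Type*} [MetricSpace X] {γ : ℝ → X} (hγ : Continuous γ) :
    ∃ F, Minimal (· ∈ GapSet γ) F := by
  apply zorn_superset
  intro c hc hch
  rcases c.eq_empty_or_nonempty with rfl | hne
  · refine ⟨Icc 0 1, ⟨isClosed_Icc, Subset.rfl, by simp, by simp, ?_⟩, by simp⟩
    intro s hs t ht hst h
    exact absurd ⟨by linarith, by linarith⟩
      (h ((s + t) / 2) ⟨by linarith [hs.1, ht.1], by linarith [hs.2, ht.2]⟩)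
  refine ⟨⋂₀ c, ⟨isClosed_sInter fun F hF => (hc hF).1, ?_, fun F hF => (hc hF).2.2.1,
    fun F hF => (hc hF).2.2.2.1, ?_⟩, fun F hF => sInter_subset_of_mem hF⟩
  · obtain ⟨F, hF⟩ := hne
    exact (sInter_subset_of_mem hF).trans (hc hF).2.1
  · intro s hs t ht hst hgap
    by_contra hne'
    have hd : 0 < dist (γ s) (γ t) := dist_pos.2 hne'
    obtain ⟨δ1, hδ1, h1⟩ := Metric.continuous_iff.1 hγ s (dist (γ s) (γ t) / 2) (by linarith)
    obtain ⟨δ2, hδ2, h2⟩ := Metric.continuous_iff.1 hγ t (dist (γ s) (γ t) / 2) (by linarith)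
    set ε := min (min δ1 δ2 / 2) ((t - s) / 3)
    have hε : 0 < ε := lt_min (by have := lt_min hδ1 hδ2; linarith) (by linarith)
    have hε1 : ε < δ1 := by
      have e1 : ε ≤ min δ1 δ2 / 2 := min_le_left _ _
      have e2 := min_le_left δ1 δ2
      linarith
    have hε2 : ε < δ2 := by
      have e1 : ε ≤ min δ1 δ2 / 2 := min_le_left _ _
      have e2 := min_le_right δ1 δ2
      linarith
    have hε3 : ε ≤ (t - s) / 3 := min_le_right _ _
    obtain ⟨F, hF, hFd⟩ : ∃ F ∈ c, Icc (s + ε) (t - ε) ∩ F = ∅ := by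
      by_contra hcon
      push Not at hcon
      have hdir : DirectedOn (fun x1 x2 => x1 ⊇ x2) c := by
        intro F hF G hG
        rcases hch.total hF hG with h | h
        · exact ⟨F, hF, Subset.rfl, h⟩
        · exact ⟨G, hG, h, Subset.rfl⟩
      have : Nonempty c := hne.to_subtype
      have hn := IsCompact.nonempty_iInter_of_directed_nonempty_isCompact_isClosed
        (fun F : c => Icc (s + ε) (t - ε) ∩ F.1) (by
          intro F G
          obtain ⟨H, hH, h1, h2⟩ := hdir F F.2 G G.2
          exact ⟨⟨H, hH⟩, inter_subset_inter_right _ h1, inter_subset_inter_right _ h2⟩)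
        (fun F => hcon F F.2)
        (fun F => isCompact_Icc.inter_right (hc F.2).1)
        (fun F => isClosed_Icc.inter (hc F.2).1)
      obtain ⟨r, hr⟩ := hn
      rw [mem_iInter] at hr
      refine hgap r (fun F hF => (hr ⟨F, hF⟩).2) ?_
      obtain ⟨F0, hF0⟩ := hne
      have := (hr ⟨F0, hF0⟩).1
      constructor <;> linarith [this.1, this.2]
    have hFc := (hc hF).1
    obtain ⟨s', ⟨hs'F, hs'⟩, hs'm⟩ := (isCompact_Icc.inter_left hFc :
      IsCompact (F ∩ Icc s (s + ε))).exists_isGreatest ⟨s, hs F hF, le_rfl, by linarith⟩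
    obtain ⟨t', ⟨ht'F, ht'⟩, ht'm⟩ := (isCompact_Icc.inter_left hFc :
      IsCompact (F ∩ Icc (t - ε) t)).exists_isLeast ⟨t, ht F hF, by linarith, le_rfl⟩
    have heq : γ s' = γ t' := by
      refine (hc hF).2.2.2.2 s' hs'F t' ht'F (by linarith [hs'.2, ht'.1]) ?_
      rintro r hr ⟨hr1, hr2⟩
      by_cases c1 : r ≤ s + ε
      · exact absurd (hs'm ⟨hr, by linarith [hs'.1], c1⟩) (not_le.2 hr1)
      · by_cases c2 : t - ε ≤ r
        · exact absurd (ht'm ⟨hr, c2, by linarith [ht'.2]⟩) (not_le.2 hr2)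
        · have : r ∈ Icc (s + ε) (t - ε) ∩ F := ⟨⟨by linarith, by linarith⟩, hr⟩
          rw [hFd] at this
          exact this
    have d1 := h1 s' (by rw [Real.dist_eq, abs_of_nonneg (by linarith [hs'.1])]; linarith [hs'.2])
    have d2 := h2 t' (by rw [Real.dist_eq, abs_of_nonpos (by linarith [ht'.2])]; linarith [ht'.1])
    have := dist_triangle (γ s) (γ s') (γ t)
    rw [heq] at this
    rw [heq] at d1
    linarith [dist_comm (γ s) (γ t')]

lemma JoinedIn.exists_arc {X : Type*} [MetricSpace X] {S : Set X} {a b : X} (hj : JoinedIn S a b)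
    (hab : a ≠ b) : ∃ P ⊆ S, IsArc P a b := by
  obtain ⟨p, hp⟩ := hj
  set γ : ℝ → X := fun t => p.extend t
  have hγ : Continuous γ := p.continuous_extend
  have hγ0 : γ 0 = a := p.extend_zero
  have hγ1 : γ 1 = b := p.extend_one
  have hγS : ∀ t, γ t ∈ S := fun t => by
    have : γ t ∈ range p := by
      rw [← p.extend_range]; exact mem_range_self t
    obtain ⟨u, hu⟩ := this
    rw [← hu]; exact hp u
  obtain ⟨F, hF, hmin⟩ := exists_min_gapSet hγ
  have hFc := hF.1
  have hF01 := hF.2.1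
  have hgap := hF.2.2.2.2
  have hkey : ∀ s ∈ F, ∀ t ∈ F, s < t → γ s = γ t → ∀ r ∈ F, ¬ (s < r ∧ r < t) := by
    intro s hs t ht hst he r hr hrst
    have hmem : F \ Ioo s t ∈ GapSet γ := by
      refine ⟨hFc.sdiff isOpen_Ioo, sdiff_subset.trans hF01, ⟨hF.2.2.1, ?_⟩, ⟨hF.2.2.2.1, ?_⟩, ?_⟩
      · exact fun h => absurd (hF01 hs).1 (not_le.2 h.1)
      · exact fun h => absurd (hF01 ht).2 (not_le.2 h.2)
      · intro s' hs' t' ht' hst' hg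
        by_cases hg2 : ∀ r ∈ F, ¬ (s' < r ∧ r < t')
        · exact hgap s' hs'.1 t' ht'.1 hst' hg2
        · push Not at hg2
          obtain ⟨r', hr', h1, h2⟩ := hg2
          have hr'm : r' ∈ Ioo s t := by
            by_contra hcon
            exact hg r' ⟨hr', hcon⟩ ⟨h1, h2⟩
          have a1 : s' ≤ s := by
            by_contra hcon
            exact hs'.2 ⟨by linarith, by linarith [hr'm.2]⟩
          have a2 : t ≤ t' := by
            by_contra hcon
            exact ht'.2 ⟨by linarith [hr'm.1], by linarith⟩
          have a3 : s' = s := by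
            by_contra hcon
            exact hg s ⟨hs, fun h => lt_irrefl _ h.1⟩ ⟨lt_of_le_of_ne a1 hcon, by linarith⟩
          have a4 : t = t' := by
            by_contra hcon
            exact hg t ⟨ht, fun h => lt_irrefl _ h.2⟩ ⟨by linarith, lt_of_le_of_ne a2 hcon⟩
          rw [a3, ← a4, he]
    have := hmin hmem sdiff_subset hr
    exact this.2 hrst
  set cl : ℝ → ℝ := fun r => max 0 (min 1 r)
  have hcl0 : ∀ r, 0 ≤ cl r := fun r => le_max_left _ _
  have hcl1 : ∀ r, cl r ≤ 1 := fun r => max_le zero_le_one (min_le_left _ _)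
  have hcont : Continuous cl := by fun_prop
  have hex1 : ∀ r, ∃ s, IsGreatest (F ∩ Icc 0 (cl r)) s := fun r =>
    (isCompact_Icc.inter_left hFc).exists_isGreatest ⟨0, hF.2.2.1, le_rfl, hcl0 r⟩
  have hex2 : ∀ r, ∃ s, IsLeast (F ∩ Icc (cl r) 1) s := fun r =>
    (isCompact_Icc.inter_left hFc).exists_isLeast ⟨1, hF.2.2.2.1, hcl1 r, le_rfl⟩
  choose lo hlo using hex1
  choose hi hhi using hex2
  have hlh : ∀ r, γ (lo r) = γ (hi r) := by
    intro r
    have h1 := (hlo r).1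
    have h2 := (hhi r).1
    rcases (h1.2.2.trans h2.2.1).eq_or_lt with h | h
    · rw [h]
    · refine hgap _ h1.1 _ h2.1 h ?_
      rintro u hu ⟨hu1, hu2⟩
      rcases le_total u (cl r) with hc | hc
      · exact absurd ((hlo r).2 ⟨hu, (hF01 hu).1, hc⟩) (not_le.2 hu1)
      · exact absurd ((hhi r).2 ⟨hu, hc, (hF01 hu).2⟩) (not_le.2 hu2)
  have hcases : ∀ r r', cl r ≤ cl r' → lo r = lo r' ∨ (cl r ≤ hi r ∧ hi r ≤ lo r' ∧ lo r' ≤ cl r') := by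
    intro r r' hrr
    by_cases h : hi r ≤ cl r'
    · right
      exact ⟨(hhi r).1.2.1, (hlo r').2 ⟨(hhi r).1.1, (hF01 (hhi r).1.1).1, h⟩, (hlo r').1.2.2⟩
    · left
      push Not at h
      have e1 : lo r ≤ lo r' := (hlo r').2 ⟨(hlo r).1.1, (hlo r).1.2.1, (hlo r).1.2.2.trans hrr⟩
      refine le_antisymm e1 ((hlo r).2 ⟨(hlo r').1.1, (hlo r').1.2.1, ?_⟩)
      by_contra hcon
      push Not at hcon
      have := (hhi r).2 ⟨(hlo r').1.1, hcon.le, (hF01 (hlo r').1.1).2⟩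
      have := (hlo r').1.2.2
      linarith
  set g : ℝ → X := fun r => γ (lo r)
  have hgc : Continuous g := by
    have huc : UniformContinuousOn γ (Icc 0 1) :=
      isCompact_Icc.uniformContinuousOn_of_continuous hγ.continuousOn
    rw [Metric.uniformContinuousOn_iff] at huc
    rw [Metric.continuous_iff]
    intro r ε hε
    obtain ⟨δ, hδ, hδ2⟩ := huc ε hε
    obtain ⟨δ', hδ', hδ2'⟩ := Metric.continuous_iff.1 hcont r δ hδ
    refine ⟨δ', hδ', fun r' hr' => ?_⟩
    have hcd := hδ2' r' hr'
    have main : ∀ x y, cl x ≤ cl y → dist (cl x) (cl y) < δ → dist (g x) (g y) < ε := by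
      intro x y hxy hd
      rcases hcases x y hxy with h | ⟨h1, h2, h3⟩
      · simp only [g, h, dist_self]; exact hε
      · simp only [g]
        rw [hlh x]
        refine hδ2 _ (hF01 (hhi x).1.1) _ (hF01 (hlo y).1.1) ?_
        rw [Real.dist_eq, abs_of_nonpos (by linarith)] at hd ⊢
        linarith
    rcases le_total (cl r') (cl r) with h | h
    · exact main _ _ h hcd
    · rw [dist_comm]; rw [dist_comm] at hcd; exact main _ _ h hcd
  have hclid : ∀ r ∈ Icc (0:ℝ) 1, cl r = r := by
    intro r hr
    simp only [cl]
    rw [min_eq_right hr.2, max_eq_right hr.1]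
  have hFlo : ∀ r ∈ F, lo r = r := by
    intro r hr
    have h1 := (hlo r).1.2.2
    have h2 := (hlo r).2 ⟨hr, (hF01 hr).1, (hclid r (hF01 hr)).ge⟩
    rw [hclid r (hF01 hr)] at h1
    exact le_antisymm h1 h2
  have hg0 : g 0 = a := by simp only [g]; rw [hFlo 0 hF.2.2.1, hγ0]
  have hg1 : g 1 = b := by simp only [g]; rw [hFlo 1 hF.2.2.2.1, hγ1]
  have harc := arc_of_monotone_fibres hgc (by
    intro r1 r2 h0 h12 h1 he s hs
    have hr1 : cl r1 = r1 := hclid r1 ⟨h0, by linarith⟩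
    have hr2 : cl r2 = r2 := hclid r2 ⟨by linarith, h1⟩
    have hss : cl s = s := hclid s ⟨by linarith [hs.1], by linarith [hs.2]⟩
    have m1 : ∀ x y, cl x ≤ cl y → lo x ≤ lo y := fun x y hxy =>
      (hlo y).2 ⟨(hlo x).1.1, (hlo x).1.2.1, (hlo x).1.2.2.trans hxy⟩
    have l1 := m1 r1 s (by rw [hr1, hss]; exact hs.1)
    have l2 := m1 s r2 (by rw [hr2, hss]; exact hs.2)
    rcases l1.eq_or_lt with e | e
    · simp only [g, e]
    rcases l2.eq_or_lt with e' | e'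
    · simp only [g, e'] at he ⊢; exact he.symm
    · exact absurd ⟨e, e'⟩ (hkey (lo r1) (hlo r1).1.1 (lo r2) (hlo r2).1.1 (e.trans e') he
        (lo s) (hlo s).1.1)) (by rw [hg0, hg1]; exact hab)
  rw [hg0, hg1] at harc
  refine ⟨_, ?_, harc⟩
  rintro _ ⟨r, -, rfl⟩
  exact hγS _


section arcs
variable {X : Type*} [TopologicalSpace X] {P Q : Set X} {a b c : X}

lemma IsArc.left_mem (h : IsArc P a b) : a ∈ P := by
  obtain ⟨γ, -, -, rfl, -, rfl⟩ := h
  exact mem_image_of_mem _ (by simp)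

lemma IsArc.right_mem (h : IsArc P a b) : b ∈ P := by
  obtain ⟨γ, -, -, -, rfl, rfl⟩ := h
  exact mem_image_of_mem _ (by simp)

lemma IsArc.ne (h : IsArc P a b) : a ≠ b := by
  obtain ⟨γ, -, hi, rfl, rfl, rfl⟩ := h
  intro he
  have := hi (by simp) (by simp) he
  norm_num at this

lemma IsArc.isCompact (h : IsArc P a b) : IsCompact P := by
  obtain ⟨γ, hc, -, -, -, rfl⟩ := h
  exact isCompact_Icc.image_of_continuousOn hc

lemma IsArc.isClosed [T2Space X] (h : IsArc P a b) : IsClosed P := h.isCompact.isClosed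

lemma IsArc.isPathConnected (h : IsArc P a b) : IsPathConnected P := by
  obtain ⟨γ, hc, -, -, -, rfl⟩ := h
  exact ((convex_Icc (0:ℝ) 1).isPathConnected ⟨0, by simp⟩).image' hc

lemma IsArc.isPreconnected (h : IsArc P a b) : IsPreconnected P :=
  h.isPathConnected.isConnected.isPreconnected

lemma IsArc.symm (h : IsArc P a b) : IsArc P b a := by
  obtain ⟨γ, hc, hi, h0, h1, rfl⟩ := h
  have him : (fun r : ℝ => 1 - r) '' Icc 0 1 = Icc 0 1 := by
    simp
  have hm : MapsTo (fun r : ℝ => 1 - r) (Icc 0 1) (Icc 0 1) := by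
    intro r hr
    exact ⟨by linarith [hr.2], by linarith [hr.1]⟩
  refine ⟨fun r => γ (1 - r), hc.comp (by fun_prop) hm, ?_, by simpa, by simpa, ?_⟩
  · intro x hx y hy hxy
    have := hi (hm hx) (hm hy) hxy
    linarith
  · conv_rhs => rw [← him, image_image]

lemma IsArc.exists_interior (h : IsArc P a b) : ∃ c ∈ P, c ≠ a ∧ c ≠ b := by
  obtain ⟨γ, hc, hi, rfl, rfl, rfl⟩ := h
  refine ⟨γ (1/2), mem_image_of_mem _ (by norm_num), fun he => ?_, fun he => ?_⟩
  · have := hi (by norm_num) (by norm_num) he; norm_num at this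
  · have := hi (by norm_num) (by norm_num) he; norm_num at this

lemma IsArc.split (h : IsArc P a b) (hc : c ∈ P) (hca : c ≠ a) (hcb : c ≠ b) :
    ∃ P1 P2, IsArc P1 a c ∧ IsArc P2 c b ∧ P1 ∪ P2 = P ∧ P1 ∩ P2 = {c} := by
  obtain ⟨γ, hcont, hi, rfl, rfl, rfl⟩ := h
  obtain ⟨s, hs, rfl⟩ := hc
  have hs0 : 0 < s := lt_of_le_of_ne hs.1 (fun h => hca (by rw [h]))
  have hs1 : s < 1 := lt_of_le_of_ne hs.2 (fun h => hcb (by rw [h]))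
  have i1 : Icc 0 s ⊆ Icc (0:ℝ) 1 := Icc_subset_Icc_right hs.2
  have i2 : Icc s 1 ⊆ Icc (0:ℝ) 1 := Icc_subset_Icc_left hs.1
  refine ⟨γ '' Icc 0 s, γ '' Icc s 1, IsArc.of_interval hs0 (hcont.mono i1) (hi.mono i1),
    IsArc.of_interval hs1 (hcont.mono i2) (hi.mono i2), ?_, ?_⟩
  · rw [← image_union, Icc_union_Icc_eq_Icc hs.1 hs.2]
  · rw [← hi.image_inter i1 i2, Icc_inter_Icc_eq_singleton hs.1 hs.2, image_singleton]

lemma IsArc.small_end (h : IsArc P a b) {O : Set X} (hO : O ∈ 𝓝 a) :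
    ∃ c P1 P2, IsArc P1 a c ∧ IsArc P2 c b ∧ P1 ∪ P2 = P ∧ P1 ∩ P2 = {c} ∧ P1 ⊆ O := by
  obtain ⟨γ, hcont, hi, rfl, rfl, rfl⟩ := h
  have h1 : γ ⁻¹' O ∈ 𝓝[Icc 0 1] (0:ℝ) := (hcont 0 (by simp)) hO
  rw [Metric.mem_nhdsWithin_iff] at h1
  obtain ⟨ε, hε, h1⟩ := h1
  set s := min (ε / 2) (1 / 2)
  have hs0 : 0 < s := lt_min (by linarith) (by norm_num)
  have hs1 : s < 1 := lt_of_le_of_lt (min_le_right _ _) (by norm_num)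
  have hsε : s < ε := lt_of_le_of_lt (min_le_left _ _) (by linarith)
  have i1 : Icc 0 s ⊆ Icc (0:ℝ) 1 := Icc_subset_Icc_right hs1.le
  have i2 : Icc s 1 ⊆ Icc (0:ℝ) 1 := Icc_subset_Icc_left hs0.le
  refine ⟨γ s, γ '' Icc 0 s, γ '' Icc s 1, IsArc.of_interval hs0 (hcont.mono i1) (hi.mono i1),
    IsArc.of_interval hs1 (hcont.mono i2) (hi.mono i2), ?_, ?_, ?_⟩
  · rw [← image_union, Icc_union_Icc_eq_Icc hs0.le hs1.le]
  · rw [← hi.image_inter i1 i2, Icc_inter_Icc_eq_singleton hs0.le hs1.le, image_singleton]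
  · rintro _ ⟨r, hr, rfl⟩
    apply h1
    refine ⟨?_, i1 hr⟩
    rw [mem_ball, Real.dist_eq, sub_zero, abs_of_nonneg hr.1]
    linarith [hr.2]

lemma IsArc.trans (h1 : IsArc P a b) (h2 : IsArc Q b c) (h : P ∩ Q ⊆ {b}) :
    IsArc (P ∪ Q) a c := by
  obtain ⟨γ, hc, hi, rfl, rfl, rfl⟩ := h1
  obtain ⟨δ, hc', hi', h0, rfl, rfl⟩ := h2
  set ρ : ℝ → X := fun t => if t ≤ 1 then γ t else δ (t - 1)
  have e1 : EqOn ρ γ (Icc 0 1) := fun t ht => by simp only [ρ, if_pos ht.2]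
  have e2 : EqOn ρ (fun t => δ (t - 1)) (Icc 1 2) := fun t ht => by
    by_cases h : t ≤ 1
    · have : t = 1 := le_antisymm h ht.1
      simp only [ρ, this]; simp [h0]
    · simp only [ρ, if_neg h]
  have hm : MapsTo (fun t : ℝ => t - 1) (Icc 1 2) (Icc 0 1) := fun t ht =>
    ⟨by linarith [ht.1], by linarith [ht.2]⟩
  have c1 : ContinuousOn ρ (Icc 0 1) := hc.congr e1
  have c2 : ContinuousOn ρ (Icc 1 2) := (hc'.comp (by fun_prop) hm).congr e2
  have hu : Icc (0:ℝ) 1 ∪ Icc 1 2 = Icc 0 2 := Icc_union_Icc_eq_Icc (by norm_num) (by norm_num)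
  have hcont : ContinuousOn ρ (Icc 0 2) := by
    rw [← hu]; exact c1.union_of_isClosed c2 isClosed_Icc isClosed_Icc
  have hcross : ∀ x y, x ∈ Icc (0:ℝ) 1 → y ∈ Icc (1:ℝ) 2 → ρ x = ρ y → x = y := by
    intro x y hx hy hxy
    rw [e1 hx, e2 hy] at hxy
    have hb : γ x = γ 1 := h ⟨mem_image_of_mem _ hx, by rw [hxy]; exact mem_image_of_mem _ (hm hy)⟩
    have hx1 := hi hx (by simp) hb
    have hb2 : δ (y - 1) = δ 0 := by
      rw [h0, ← hb]; exact hxy.symm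
    have hy1 := hi' (hm hy) (by simp) hb2
    linarith
  have hinj : InjOn ρ (Icc 0 2) := by
    rw [← hu]
    rintro x (hx | hx) y (hy | hy) hxy
    · rw [e1 hx, e1 hy] at hxy; exact hi hx hy hxy
    · exact hcross x y hx hy hxy
    · exact (hcross y x hy hx hxy.symm).symm
    · rw [e2 hx, e2 hy] at hxy
      have := hi' (hm hx) (hm hy) hxy
      linarith
  have := IsArc.of_interval (by norm_num : (0:ℝ) < 2) hcont hinj
  have r0 : ρ 0 = γ 0 := e1 (by simp)
  have r2 : ρ 2 = δ 1 := by rw [e2 (by norm_num)]; norm_num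
  rw [r0, r2, ← hu, image_union] at this
  convert this using 2
  · exact (e1.image_eq).symm
  · rw [e2.image_eq, ← image_image (fun t => δ t) (fun t : ℝ => t - 1)]
    congr 1
    simp; norm_num

lemma IsArc.open_pc (h : IsArc P a b) : IsPathConnected (P \ {a, b}) := by
  obtain ⟨γ, hcont, hi, rfl, rfl, rfl⟩ := h
  have : γ '' Icc 0 1 \ {γ 0, γ 1} = γ '' Ioo 0 1 := by
    have h2 : ({γ 0, γ 1} : Set X) = γ '' {0, 1} := by rw [image_pair]
    have h3 : ({0, 1} : Set ℝ) ⊆ Icc 0 1 := by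
      rintro x (rfl | rfl) <;> simp
    rw [h2, ← hi.image_sdiff_subset h3]
    congr 1
    ext x
    simp only [Set.mem_sdiff, mem_Icc, mem_insert_iff, mem_singleton_iff, mem_Ioo, not_or]
    constructor
    · rintro ⟨⟨h1, h2⟩, h3, h4⟩
      exact ⟨lt_of_le_of_ne h1 (Ne.symm h3), lt_of_le_of_ne h2 h4⟩
    · rintro ⟨h1, h2⟩
      exact ⟨⟨h1.le, h2.le⟩, h1.ne', h2.ne⟩
  rw [this]
  exact ((convex_Ioo (0:ℝ) 1).isPathConnected ⟨1/2, by norm_num⟩).image'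
    (hcont.mono Ioo_subset_Icc_self)

lemma IsArc.mem_closure_open [T1Space X] (h : IsArc P a b) : a ∈ closure (P \ {a, b}) := by
  rw [mem_closure_iff_nhds]
  intro O hO
  have hO' : O ∩ {b}ᶜ ∈ 𝓝 a := inter_mem hO (isOpen_compl_singleton.mem_nhds h.ne)
  obtain ⟨c, P1, P2, h1, h2, hu, hi, hs⟩ := h.small_end hO'
  have hc := hs h1.right_mem
  refine ⟨c, hc.1, hu ▸ Or.inl h1.right_mem, ?_⟩
  rintro (h' | h')
  · exact h1.ne h'.symm
  · exact hc.2 h'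

lemma IsArc.image {Y : Type*} [TopologicalSpace Y] (h : IsArc P a b) {φ : X → Y}
    (hc : ContinuousOn φ P) (hi : InjOn φ P) : IsArc (φ '' P) (φ a) (φ b) := by
  obtain ⟨γ, hcont, hinj, rfl, rfl, rfl⟩ := h
  exact ⟨φ ∘ γ, hc.comp hcont (mapsTo_image _ _), hi.comp hinj (mapsTo_image _ _), rfl, rfl,
    image_comp _ _ _⟩

def JSplit (C : Set X) (a b : X) (A1 A2 : Set X) : Prop :=
  IsArc A1 a b ∧ IsArc A2 a b ∧ A1 ∩ A2 ⊆ {a, b} ∧ A1 ∪ A2 = C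

def IsJC (C : Set X) : Prop := ∃ a b A1 A2, JSplit C a b A1 A2

lemma JSplit.swap {C A1 A2 : Set X} (h : JSplit C a b A1 A2) : JSplit C a b A2 A1 :=
  ⟨h.2.1, h.1, by rw [inter_comm]; exact h.2.2.1, by rw [union_comm]; exact h.2.2.2⟩

lemma JSplit.rev {C A1 A2 : Set X} (h : JSplit C a b A1 A2) : JSplit C b a A1 A2 :=
  ⟨h.1.symm, h.2.1.symm, by rw [pair_comm]; exact h.2.2.1, h.2.2.2⟩

lemma JSplit.isJC {C A1 A2 : Set X} (h : JSplit C a b A1 A2) : IsJC C := ⟨_, _, _, _, h⟩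

lemma JSplit.isCompact {C A1 A2 : Set X} (h : JSplit C a b A1 A2) : IsCompact C := by
  rw [← h.2.2.2]; exact h.1.isCompact.union h.2.1.isCompact

lemma IsJC.isCompact {C : Set X} (h : IsJC C) : IsCompact C := by
  obtain ⟨_, _, _, _, h⟩ := h; exact h.isCompact

lemma IsJC.isClosed [T2Space X] {C : Set X} (h : IsJC C) : IsClosed C := h.isCompact.isClosed

lemma JSplit.resplit1 {C A1 A2 : Set X} (h : JSplit C a b A1 A2) (hc : c ∈ C) (hca : c ≠ a) :
    ∃ B1 B2, JSplit C a c B1 B2 := by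
  have key : ∀ {A1 A2 : Set X}, JSplit C a b A1 A2 → c ∈ A1 → ∃ B1 B2, JSplit C a c B1 B2 := by
    intro A1 A2 h hc
    by_cases hcb : c = b
    · subst hcb; exact ⟨_, _, h⟩
    obtain ⟨P1, P2, h1, h2, hu, hi⟩ := h.1.split hc hca hcb
    have hA12 : ∀ x ∈ A1, x ∈ A2 → x = a ∨ x = b := fun x h1 h2 => h.2.2.1 ⟨h1, h2⟩
    have hb1 : b ∉ P1 := fun hb => hcb (hi.subset ⟨hb, h2.right_mem⟩ : b = c).symm
    have ha2 : a ∉ P2 := fun ha => hca (hi.subset ⟨h1.left_mem, ha⟩ : a = c).symm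
    have hcA2 : c ∉ A2 := fun h3 => (hA12 c hc h3).elim hca hcb
    refine ⟨P1, A2 ∪ P2, h1, h.2.1.trans h2.symm ?_, ?_, ?_⟩
    · rintro x ⟨hx1, hx2⟩
      rcases hA12 x (hu ▸ Or.inr hx2) hx1 with rfl | rfl
      · exact absurd hx2 ha2
      · rfl
    · rintro x ⟨hx1, hx2 | hx2⟩
      · rcases hA12 x (hu ▸ Or.inl hx1) hx2 with rfl | rfl
        · left; rfl
        · exact absurd hx1 hb1
      · right; exact hi.subset ⟨hx1, hx2⟩
    · rw [← h.2.2.2, ← hu]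
      ext x; simp only [mem_union]; tauto
  rw [← h.2.2.2] at hc
  rcases hc with hc | hc
  · exact key h hc
  · exact key h.swap hc

lemma IsJC.split {C : Set X} (h : IsJC C) {x y : X} (hx : x ∈ C) (hy : y ∈ C) (hxy : x ≠ y) :
    ∃ A1 A2, JSplit C x y A1 A2 := by
  obtain ⟨a, b, A1, A2, h⟩ := h
  by_cases hxa : x = a
  · subst hxa; exact h.resplit1 hy hxy.symm
  · obtain ⟨B1, B2, h2⟩ := h.resplit1 hx hxa
    exact h2.rev.resplit1 hy hxy.symm

lemma JSplit.left_mem {C A1 A2 : Set X} (h : JSplit C a b A1 A2) : a ∈ C := by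
  rw [← h.2.2.2]; exact Or.inl h.1.left_mem

lemma IsJC.nonempty {C : Set X} (h : IsJC C) : C.Nonempty := by
  obtain ⟨_, _, _, _, h⟩ := h; exact ⟨_, h.left_mem⟩

lemma IsJC.exists_ne {C : Set X} (h : IsJC C) (x : X) : ∃ y ∈ C, y ≠ x := by
  obtain ⟨a, b, _, _, h⟩ := h
  by_cases hx : a = x
  · exact ⟨b, h.rev.left_mem, fun hb => h.1.ne (hx.trans hb.symm)⟩
  · exact ⟨a, h.left_mem, hx⟩

lemma IsJC.isPreconnected {C : Set X} (h : IsJC C) : IsPreconnected C := by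
  obtain ⟨a, b, _, _, h⟩ := h
  rw [← h.2.2.2]
  exact h.1.isPreconnected.union a h.1.left_mem h.2.1.left_mem h.2.1.isPreconnected

lemma JSplit.inter_eq {C A1 A2 : Set X} (h : JSplit C a b A1 A2) : A1 ∩ A2 = {a, b} := by
  apply Subset.antisymm h.2.2.1
  rintro x (rfl | rfl)
  · exact ⟨h.1.left_mem, h.2.1.left_mem⟩
  · exact ⟨h.1.right_mem, h.2.1.right_mem⟩

end arcs


lemma joinedIn_of_preconnected {X : Type*} [TopologicalSpace X] [LocallyPathConnectedSpace X]
    {U S : Set X} (hU : IsOpen U) (hS : IsPreconnected S) (hSU : S ⊆ U) {p q : X} (hp : p ∈ S)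
    (hq : q ∈ S) : JoinedIn U p q := by
  have h2 := hS.subset_connectedComponentIn hp hSU hq
  have h3 : IsConnected (connectedComponentIn U p) :=
    isConnected_connectedComponentIn_iff.2 (hSU hp)
  have h4 := (hU.connectedComponentIn.isConnected_iff_isPathConnected).1 h3
  exact (h4.joinedIn p (mem_connectedComponentIn (hSU hp)) q h2).mono
    (connectedComponentIn_subset _ _)

lemma JoinedIn.exists_compact {X : Type*} [TopologicalSpace X] {S : Set X} {p q : X}
    (h : JoinedIn S p q) : ∃ K, IsCompact K ∧ IsPreconnected K ∧ K ⊆ S ∧ p ∈ K ∧ q ∈ K := by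
  obtain ⟨γ, hγ⟩ := h
  exact ⟨range γ, isCompact_range γ.continuous, isPreconnected_range γ.continuous,
    by rintro _ ⟨t, rfl⟩; exact hγ t, ⟨0, γ.source⟩, ⟨1, γ.target⟩⟩

lemma exists_preconnected_compact {X : Type*} [MetricSpace X] [CompactSpace X]
    [LocallyPathConnectedSpace X] {U K : Set X} (hU : IsOpen U) (hUp : IsPreconnected U)
    (hK : IsCompact K) (hKU : K ⊆ U) :
    ∃ M, IsCompact M ∧ IsPreconnected M ∧ K ⊆ M ∧ M ⊆ U := by
  rcases K.eq_empty_or_nonempty with rfl | ⟨k, hk⟩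
  · exact ⟨∅, isCompact_empty, isPreconnected_empty, Subset.rfl, empty_subset _⟩
  have := hK.induction_on (p := fun s => ∃ M, IsCompact M ∧ IsPreconnected M ∧ k ∈ M ∧ s ⊆ M ∧ M ⊆ U)
    ⟨{k}, isCompact_singleton, isPreconnected_singleton, rfl, empty_subset _, by
      simpa using hKU hk⟩
    (fun s t hst ⟨M, h1, h2, h3, h4, h5⟩ => ⟨M, h1, h2, h3, hst.trans h4, h5⟩)
    (fun s t ⟨M, h1, h2, h3, h4, h5⟩ ⟨N, g1, g2, g3, g4, g5⟩ =>
      ⟨M ∪ N, h1.union g1, h2.union k h3 g3 g2, Or.inl h3, union_subset_union h4 g4,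
        union_subset h5 g5⟩) ?_
  · obtain ⟨M, h1, h2, h3, h4, h5⟩ := this
    exact ⟨M, h1, h2, h4, h5⟩
  · intro x hx
    obtain ⟨W, hW, hWc, hWU⟩ := exists_mem_nhds_isClosed_subset (hU.mem_nhds (hKU hx))
    obtain ⟨V, ⟨hV1, hV2⟩, hV⟩ :=
      (LocallyPathConnectedSpace.path_connected_basis x).mem_iff.1 hW
    obtain ⟨N, n1, n2, n3, n4, n5⟩ :=
      (joinedIn_of_preconnected hU hUp Subset.rfl (hKU hk) (hKU hx)).exists_compact
    have hxV : x ∈ V := mem_of_mem_nhds hV1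
    refine ⟨V, mem_nhdsWithin_of_mem_nhds hV1, N ∪ closure V, n1.union isClosed_closure.isCompact,
      n2.union x n5 (subset_closure hxV) hV2.isConnected.isPreconnected.closure, Or.inl n4,
      subset_closure.trans subset_union_right, union_subset n3 ?_⟩
    exact (closure_minimal hV hWc).trans hWU

lemma exists_open_connected {X : Type*} [TopologicalSpace X] [LocallyPathConnectedSpace X]
    {x : X} {O : Set X} (hO : O ∈ 𝓝 x) : ∃ V ⊆ O, IsOpen V ∧ IsPreconnected V ∧ x ∈ V := by
  obtain ⟨U, hU1, hU2, hU3⟩ := mem_nhds_iff.1 hO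
  refine ⟨connectedComponentIn U x, (connectedComponentIn_subset _ _).trans hU1,
    hU2.connectedComponentIn, isPreconnected_connectedComponentIn, mem_connectedComponentIn hU3⟩

lemma JoinedIn.component {X : Type*} [TopologicalSpace X] {S : Set X} {p q : X}
    (h : JoinedIn S p q) : JoinedIn {x | JoinedIn S p x} p q :=
  (isPathConnected_pathComponentIn h.mem.1).joinedIn p (JoinedIn.refl h.mem.1) q h

lemma joinedIn_concat {X : Type*} [TopologicalSpace X] {a : X} {p : ℕ → X} {S : ℕ → Set X}
    (hS : ∀ n, JoinedIn (S n) (p n) (p (n + 1))) (hlim : ∀ O ∈ 𝓝 a, ∃ N, ∀ n ≥ N, S n ⊆ O) :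
    JoinedIn ({a} ∪ ⋃ n, S n) a (p 0) := by
  choose σ hσ using hS
  set G : ℝ → X := fun x => (σ ⌊x⌋₊).extend (x - ⌊x⌋₊)
  have hGS : ∀ x, G x ∈ S ⌊x⌋₊ := by
    intro x
    have : G x ∈ range (σ ⌊x⌋₊) := by
      rw [← (σ ⌊x⌋₊).extend_range]; exact mem_range_self _
    obtain ⟨t, ht⟩ := this
    rw [← ht]; exact hσ _ t
  have hGk : ∀ (x : ℝ) (k : ℕ), ⌊x⌋₊ = k → G x = (σ k).extend (x - k) := by
    rintro x _ rfl; rfl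
  have hGn : ∀ n : ℕ, EqOn G (fun x => (σ n).extend (x - n)) (Icc n (n + 1)) := by
    intro n x hx
    rcases hx.2.eq_or_lt with h | h
    · have hf : ⌊x⌋₊ = n + 1 := by rw [h]; exact_mod_cast Nat.floor_natCast (n + 1)
      rw [hGk _ _ hf]
      rw [h]
      simp
    · have hf : ⌊x⌋₊ = n := by
        rw [Nat.floor_eq_iff ((Nat.cast_nonneg n).trans hx.1)]
        exact ⟨hx.1, h⟩
      rw [hGk _ _ hf]
  have hc1 : ∀ n : ℕ, ContinuousOn G (Icc n (n + 1)) := by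
    intro n
    refine ContinuousOn.congr ?_ (hGn n)
    exact ((σ n).continuous_extend.comp (by fun_prop)).continuousOn
  have hc2 : ∀ n : ℕ, ContinuousOn G (Icc 0 (n : ℝ)) := by
    intro n
    induction n with
    | zero => simp
    | succ n ih =>
      have := ih.union_of_isClosed (hc1 n) isClosed_Icc isClosed_Icc
      rw [Icc_union_Icc_eq_Icc (by positivity) (by linarith)] at this
      exact_mod_cast this
  have hc3 : ∀ x, 0 ≤ x → ContinuousWithinAt G (Ici 0) x := by
    intro x hx
    obtain ⟨n, hn⟩ := exists_nat_gt x
    refine ((hc2 n) x ⟨hx, hn.le⟩).mono_of_mem_nhdsWithin ?_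
    rw [← Ici_inter_Iic]
    exact inter_mem_nhdsWithin _ (Iic_mem_nhds hn)
  set g : ℝ → X := fun s => if s = 0 then a else G (1 / s - 1)
  have hg : ContinuousOn g (Icc 0 1) := by
    intro s hs
    rcases hs.1.eq_or_lt with h | h
    · subst h
      intro O hO
      have hO' : O ∈ 𝓝 a := by simpa [g] using hO
      obtain ⟨N, hN⟩ := hlim O hO'
      have : Iio (1 / ((N : ℝ) + 1)) ∈ 𝓝 (0 : ℝ) := Iio_mem_nhds (by positivity)
      show ∀ᶠ r in 𝓝[Icc 0 1] (0 : ℝ), g r ∈ O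
      filter_upwards [mem_nhdsWithin_of_mem_nhds this, self_mem_nhdsWithin] with r hr hr2
      show g r ∈ O
      rcases hr2.1.eq_or_lt with h | h
      · simp only [g, ← h, if_true]; exact mem_of_mem_nhds hO'
      · simp only [g, h.ne', if_false]
        apply hN ⌊1 / r - 1⌋₊ _ (hGS _)
        apply Nat.le_floor
        have h3 : (N : ℝ) + 1 < 1 / r := by
          rw [lt_div_iff₀ h]
          have h4 : r < 1 / ((N : ℝ) + 1) := hr
          rw [lt_div_iff₀ (by positivity)] at h4
          linarith
        linarith
    · have hev : g =ᶠ[𝓝[Icc 0 1] s] fun s => G (1 / s - 1) := by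
        filter_upwards [mem_nhdsWithin_of_mem_nhds (Ioi_mem_nhds h)] with r hr
        have : r ≠ 0 := ne_of_gt hr
        simp only [g, this, if_false]
      have hgs : g s = G (1 / s - 1) := by simp only [g, h.ne', if_false]
      have hev2 : g =ᶠ[𝓝[Icc 0 1 ∩ Ioi 0] s] fun s => G (1 / s - 1) :=
        hev.filter_mono (nhdsWithin_mono _ inter_subset_left)
      have key : ContinuousWithinAt g (Icc 0 1 ∩ Ioi 0) s := by
        refine ContinuousWithinAt.congr_of_eventuallyEq ?_ hev2 hgs
        have h1s : 1 ≤ 1 / s := by rw [le_div_iff₀ h]; linarith [hs.2]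
        refine ContinuousWithinAt.comp (t := Ici 0) (hc3 _ (by linarith)) ?_ ?_
        · refine ContinuousAt.continuousWithinAt ?_
          exact (continuousAt_const.div continuousAt_id h.ne').sub continuousAt_const
        · intro r hr
          have hr0 : 0 < r := hr.2
          have : 1 ≤ 1 / r := by rw [le_div_iff₀ hr0]; linarith [hr.1.2]
          simp only [mem_Ici]; linarith
      refine key.mono_of_mem_nhdsWithin ?_
      exact inter_mem_nhdsWithin _ (Ioi_mem_nhds h)
  have hgc : Continuous (fun t : unitInterval => g t) :=
    continuousOn_iff_continuous_domRestrict.1 hg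
  refine ⟨⟨⟨fun t => g t, hgc⟩, by simp [g], ?_⟩, ?_⟩
  · have : G 0 = p 0 := by simp [G]
    simp [g, this]
  · intro t
    show g t ∈ _
    by_cases ht : (t : ℝ) = 0
    · left; simp [g, ht]
    · right; simp only [g, ht, if_false]
      exact mem_iUnion.2 ⟨_, hGS _⟩

def EndH {X : Type*} [TopologicalSpace X] (G : Set X) (a : X) : Prop :=
  ∀ O ∈ 𝓝 a, ∃ A, IsClosed A ∧ IsPreconnected A ∧ A ⊆ G ∧ a ∉ A ∧ G \ A ⊆ O

section ms
variable {X : Type} [MetricSpace X] [MS X]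

lemma joinedIn_compl_singleton {x p q : X} (hp : p ≠ x) (hq : q ≠ x) : JoinedIn {x}ᶜ p q :=
  joinedIn_of_preconnected isOpen_compl_singleton (MS.nocut x) Subset.rfl hp hq

lemma EndH.local_joined {G : Set X} {a : X} (hG : IsClosed G) (h : EndH G a) {O : Set X}
    (hO : O ∈ 𝓝 a) : ∃ O' ∈ 𝓝 a, ∀ p ∈ O', ∀ q ∈ O', JoinedIn Gᶜ p q → JoinedIn (O ∩ Gᶜ) p q := by
  obtain ⟨U, hUO, hU, haU⟩ := _root_.mem_nhds_iff.1 hO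
  obtain ⟨A, hA, hAp, hAG, haA, hGA⟩ := h U (hU.mem_nhds haU)
  obtain ⟨V, hV, hVo, hVp, haV⟩ := exists_open_connected
    (inter_mem (hU.mem_nhds haU) (hA.isOpen_compl.mem_nhds haA))
  refine ⟨V, hVo.mem_nhds haV, fun p hp q hq hj => ?_⟩
  have h1 : JoinedIn (Uᶜ ∪ A)ᶜ p q := by
    rw [compl_union, compl_compl]
    exact joinedIn_of_preconnected (hU.inter hA.isOpen_compl) hVp hV hp hq
  have h2 : G ∩ (Uᶜ ∪ A) = A := by
    ext x
    constructor
    · rintro ⟨h1, h2 | h2⟩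
      · by_contra h3
        exact h2 (hGA ⟨h1, h3⟩)
      · exact h2
    · intro h3; exact ⟨hAG h3, Or.inr h3⟩
  refine (MS.j1 G (Uᶜ ∪ A) hG (hU.isClosed_compl.union hA) (by rw [h2]; exact hAp) p q hj h1).mono ?_
  intro x hx
  simp only [compl_union, compl_compl, mem_inter_iff] at hx
  exact ⟨hUO hx.2.1, hx.1⟩

lemma EndH.access {G : Set X} {a : X} (hG : IsClosed G) (h : EndH G a) {O : Set X}
    (hO : O ∈ 𝓝 a) {V : Set X} (haV : a ∈ closure V) (hV : ∀ p ∈ V, ∀ q ∈ V, JoinedIn Gᶜ p q) :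
    ∃ p ∈ V ∩ O, JoinedIn ({a} ∪ {q | JoinedIn (O ∩ Gᶜ) p q}) a p := by
  have hloc : ∀ n : ℕ, ∃ O' ∈ 𝓝 a, ∀ p ∈ O', ∀ q ∈ O', JoinedIn Gᶜ p q →
      JoinedIn ((O ∩ ball a (1 / (n + 1))) ∩ Gᶜ) p q := fun n =>
    h.local_joined hG (inter_mem hO (ball_mem_nhds _ (by positivity)))
  choose O' hO' hj using hloc
  have hex : ∀ n : ℕ, ∃ p ∈ V, ∀ m ≤ n, p ∈ O' m := by
    intro n
    have : (⋂ m ∈ Iic n, O' m) ∈ 𝓝 a := (biInter_mem (finite_Iic n)).2 fun m _ => hO' m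
    obtain ⟨p, h1, h2⟩ := mem_closure_iff_nhds.1 haV _ this
    exact ⟨p, h2, fun m hm => mem_iInter₂.1 h1 m hm⟩
  choose p hpV hpO using hex
  have hS : ∀ n : ℕ, JoinedIn ((O ∩ ball a (1 / (n + 1))) ∩ Gᶜ) (p n) (p (n + 1)) := fun n =>
    hj n _ (hpO n n le_rfl) _ (hpO (n + 1) n (by omega)) (hV _ (hpV _) _ (hpV _))
  have hcat := joinedIn_concat (fun n => (hS n).component) (a := a) (by
    intro W hW
    obtain ⟨ε, hε, hεW⟩ := Metric.mem_nhds_iff.1 hW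
    obtain ⟨N, hN⟩ := exists_nat_one_div_lt hε
    refine ⟨N, fun n hn x hx => hεW ?_⟩
    have h1 : dist x a < 1 / ((n:ℝ) + 1) := hx.mem.2.1.2
    have h2 : 1 / ((n:ℝ) + 1) ≤ 1 / ((N:ℝ) + 1) := by
      apply one_div_le_one_div_of_le (by positivity)
      have : (N : ℝ) ≤ n := by exact_mod_cast hn
      linarith
    exact mem_ball.2 (by linarith))
  have hp : ∀ n, JoinedIn (O ∩ Gᶜ) (p 0) (p n) := by
    intro n
    induction n with
    | zero => exact JoinedIn.refl ⟨((hS 0).mem.1).1.1, (hS 0).mem.1.2⟩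
    | succ n ih => exact ih.trans ((hS n).mono fun x hx => ⟨hx.1.1, hx.2⟩)
  refine ⟨p 0, ⟨hpV 0, (hS 0).mem.1.1.1⟩, hcat.mono ?_⟩
  refine union_subset_union_right _ (iUnion_subset fun n x hx => ?_)
  exact (hp n).trans (JoinedIn.mono hx fun x hx => ⟨hx.1.1, hx.2⟩)

lemma IsArc.joinedIn_compl {P : Set X} {a b p q : X} (h : IsArc P a b) (hp : p ∉ P) (hq : q ∉ P) :
    JoinedIn Pᶜ p q := by
  obtain ⟨γ, hc, hi, -, -, rfl⟩ := h
  set g : unitInterval → X := fun t => γ t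
  have hg : Continuous g := continuousOn_iff_continuous_domRestrict.1 hc
  have hgi : Function.Injective g := fun x y hxy => Subtype.ext (hi x.2 y.2 hxy)
  have himg : γ '' Icc 0 1 = g '' Icc 0 1 := by
    ext x
    constructor
    · rintro ⟨t, ht, rfl⟩
      exact ⟨⟨t, ht⟩, ⟨ht.1, ht.2⟩, rfl⟩
    · rintro ⟨t, -, rfl⟩
      exact ⟨t, t.2, rfl⟩
  rw [himg] at hp hq ⊢
  have hpt : ∀ t, p ≠ g t := fun t he => hp ⟨t, ⟨t.2.1, t.2.2⟩, he.symm⟩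
  have hqt : ∀ t, q ≠ g t := fun t he => hq ⟨t, ⟨t.2.1, t.2.2⟩, he.symm⟩
  obtain ⟨t, ht0, htm, ⟨n, hn⟩, htc⟩ := exists_monotone_Icc_subset_open_cover_unitInterval
    (c := fun V : {V : Set unitInterval // IsOpen V ∧ JoinedIn (g '' V)ᶜ p q} => V.1)
    (fun V => V.2.1) (by
      intro t _
      obtain ⟨K, k1, k2, k3, k4, k5⟩ :=
        (joinedIn_compl_singleton (hpt t) (hqt t)).exists_compact
      obtain ⟨σ, hσ⟩ := joinedIn_compl_singleton (hpt t) (hqt t)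
      have hcl : IsClosed (range σ) := (isCompact_range σ.continuous).isClosed
      refine mem_iUnion.2 ⟨⟨g ⁻¹' (range σ)ᶜ, hcl.isOpen_compl.preimage hg, σ, ?_⟩, ?_⟩
      · rintro r ⟨u, hu, he⟩
        exact hu ⟨r, he.symm⟩
      · rintro ⟨r, hr⟩
        exact hσ r hr)
  have key : ∀ m, JoinedIn (g '' Icc 0 (t m))ᶜ p q := by
    intro m
    induction m with
    | zero =>
      rw [ht0, Icc_self, image_singleton]
      exact joinedIn_compl_singleton (hpt 0) (hqt 0)
    | succ m ih =>
      obtain ⟨⟨V, hV1, hV2⟩, hV⟩ := htc m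
      have h2 : JoinedIn (g '' Icc (t m) (t (m + 1)))ᶜ p q :=
        hV2.mono (compl_subset_compl.2 (image_mono hV))
      have hle : t m ≤ t (m + 1) := htm (Nat.le_succ m)
      have h0 : (0 : unitInterval) ≤ t m := (t m).2.1
      have h3 := MS.j1 _ _ (isCompact_Icc.image hg).isClosed (isCompact_Icc.image hg).isClosed
        (by
          rw [← image_inter hgi, Icc_inter_Icc_eq_singleton h0 hle, image_singleton]
          exact isPreconnected_singleton) p q ih h2
      rwa [← image_union, Icc_union_Icc_eq_Icc h0 hle] at h3
  have := key n
  rwa [hn n le_rfl] at this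

end ms


lemma IsPreconnected.inter_frontier_nonempty' {X : Type*} [TopologicalSpace X] {S D : Set X}
    (hS : IsPreconnected S) (h1 : (S ∩ D).Nonempty) (h2 : ∃ x ∈ S, x ∉ D) :
    (S ∩ frontier D).Nonempty := by
  by_contra h
  rw [not_nonempty_iff_eq_empty] at h
  have hf : ∀ x ∈ S, x ∈ closure D → x ∈ interior D := by
    intro x hx hc
    by_contra hi
    have : x ∈ S ∩ frontier D := ⟨hx, hc, hi⟩
    rw [h] at this
    exact this
  obtain ⟨p, hp, hpD⟩ := h1
  obtain ⟨q, hq, hqD⟩ := h2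
  obtain ⟨x, -, hx1, hx2⟩ := hS (interior D) (closure D)ᶜ isOpen_interior
    isClosed_closure.isOpen_compl
    (fun x hx => by
      by_cases hc : x ∈ closure D
      · exact Or.inl (hf x hx hc)
      · exact Or.inr hc)
    ⟨p, hp, hf p hp (subset_closure hpD)⟩
    ⟨q, hq, fun hc => hqD (interior_subset (hf q hq hc))⟩
  exact hx2 (subset_closure (interior_subset hx1))

lemma JoinedIn.cross {X : Type*} [TopologicalSpace X] {S D : Set X} {p q : X}
    (h : JoinedIn S p q) (hp : p ∈ D) (hq : q ∉ D) : (S ∩ frontier D).Nonempty := by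
  obtain ⟨K, -, h2, h3, h4, h5⟩ := h.exists_compact
  have := h2.inter_frontier_nonempty' ⟨p, h4, hp⟩ ⟨q, h5, hq⟩
  exact this.mono (inter_subset_inter_left _ h3)

lemma IsPreconnected.subset_of_frontier {X : Type*} [TopologicalSpace X] {S D : Set X}
    (hS : IsPreconnected S) (h : (S ∩ D).Nonempty) (hd : Disjoint S (frontier D)) : S ⊆ D := by
  intro x hx
  by_contra hxD
  obtain ⟨y, h1, h2⟩ := hS.inter_frontier_nonempty' h ⟨x, hx, hxD⟩
  exact disjoint_left.1 hd h1 h2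

lemma IsArc.endH {X : Type*} [MetricSpace X] {P : Set X} {a b : X} (h : IsArc P a b) :
    EndH P a := by
  intro O hO
  obtain ⟨c, P1, P2, h1, h2, h3, h4, h5⟩ := h.small_end hO
  refine ⟨P2, h2.isClosed, h2.isPreconnected, h3 ▸ subset_union_right, fun ha => ?_, ?_⟩
  · have : a ∈ P1 ∩ P2 := ⟨h1.left_mem, ha⟩
    rw [h4] at this
    exact h1.ne this
  · rintro x ⟨hx, hx2⟩
    rw [← h3] at hx
    exact h5 (hx.resolve_right hx2)

lemma IsJC.end_arc {X : Type*} [MetricSpace X] {C : Set X} (h : IsJC C) {a : X} (ha : a ∈ C)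
    {O : Set X} (hO : O ∈ 𝓝 a) : ∃ A c d, IsArc A c d ∧ A ⊆ C ∧ a ∉ A ∧ C \ A ⊆ O := by
  obtain ⟨b, hb, hba⟩ := h.exists_ne a
  obtain ⟨A1, A2, k1, k2, k3, k4⟩ := h.split ha hb hba.symm
  obtain ⟨c, P1, P2, h1, h2, h3, h4, h5⟩ := k1.small_end hO
  obtain ⟨d, Q1, Q2, g1, g2, g3, g4, g5⟩ := k2.small_end hO
  have haP : a ∉ P2 := by
    intro ha
    have : a ∈ P1 ∩ P2 := ⟨h1.left_mem, ha⟩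
    rw [h4] at this
    exact h1.ne this
  have haQ : a ∉ Q2 := by
    intro ha
    have : a ∈ Q1 ∩ Q2 := ⟨g1.left_mem, ha⟩
    rw [g4] at this
    exact g1.ne this
  refine ⟨P2 ∪ Q2, c, d, h2.trans g2.symm ?_, ?_, ?_, ?_⟩
  · rintro x ⟨hx1, hx2⟩
    have : x ∈ A1 ∩ A2 := ⟨h3 ▸ Or.inr hx1, g3 ▸ Or.inr hx2⟩
    rcases k3 this with rfl | h
    · exact absurd hx1 haP
    · exact h
  · rw [← k4, ← h3, ← g3]
    exact union_subset_union subset_union_right subset_union_right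
  · simp [haP, haQ]
  · rw [← k4, ← h3, ← g3]
    rintro x ⟨(hx | hx) | (hx | hx), hx2⟩
    · exact h5 hx
    · exact absurd (Or.inl hx) hx2
    · exact g5 hx
    · exact absurd (Or.inr hx) hx2

lemma IsJC.endH {X : Type*} [MetricSpace X] {C : Set X} (h : IsJC C) {a : X} (ha : a ∈ C) :
    EndH C a := by
  intro O hO
  obtain ⟨A, c, d, h1, h2, h3, h4⟩ := h.end_arc ha hO
  exact ⟨A, h1.isClosed, h1.isPreconnected, h2, h3, h4⟩

lemma frontier_component {X : Type*} [TopologicalSpace X] [LocallyPathConnectedSpace X]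
    {U : Set X} (hU : IsOpen U) (p : X) : frontier {x | JoinedIn U p x} ⊆ Uᶜ := by
  intro x hx hxU
  rw [(isOpen_joinedIn hU p).frontier_eq] at hx
  exact hx.2 (joinedIn_of_closure hU hx.1 hxU)

lemma isConnected_component {X : Type*} [TopologicalSpace X] {U : Set X} {p : X} (hp : p ∈ U) :
    IsConnected {x | JoinedIn U p x} :=
  (isPathConnected_pathComponentIn hp).isConnected

section ms
variable {X : Type} [MetricSpace X] [MS X]

lemma crosscut_gen {G : Set X} {a b d : X} (hG : IsClosed G) (ha : EndH G a) (hb : EndH G b)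
    (hab : a ≠ b) (hac : a ∈ closure {x | JoinedIn Gᶜ d x})
    (hbc : b ∈ closure {x | JoinedIn Gᶜ d x}) :
    ∃ P, IsArc P a b ∧ P ⊆ {x | JoinedIn Gᶜ d x} ∪ {a, b} := by
  set V := {x | JoinedIn Gᶜ d x}
  have hV : ∀ p ∈ V, ∀ q ∈ V, JoinedIn Gᶜ p q := fun p hp q hq => hp.symm.trans hq
  obtain ⟨p, hp, hp2⟩ := ha.access hG univ_mem hac hV
  obtain ⟨q, hq, hq2⟩ := hb.access hG univ_mem hbc hV
  have hpq : JoinedIn V p q := (hV p hp.1 q hq.1).component.mono fun x hx => hp.1.trans hx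
  have h1 : JoinedIn (V ∪ {a, b}) a p := hp2.mono (by
    rintro x (hx | hx)
    · right; left; exact hx
    · left; exact JoinedIn.trans hp.1 (hx.mono inter_subset_right))
  have h2 : JoinedIn (V ∪ {a, b}) b q := hq2.mono (by
    rintro x (hx | hx)
    · right; right; exact hx
    · left; exact JoinedIn.trans hq.1 (hx.mono inter_subset_right))
  obtain ⟨P, hP1, hP2⟩ := ((h1.trans (hpq.mono subset_union_left)).trans h2.symm).exists_arc hab
  exact ⟨P, hP2, hP1⟩

lemma IsJC.subset_closure {C : Set X} (h : IsJC C) {p : X} (hp : p ∉ C) :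
    C ⊆ closure {x | JoinedIn Cᶜ p x} := by
  intro c hc
  by_contra hcl
  obtain ⟨A, u, v, h1, h2, h3, h4⟩ := h.end_arc hc (isClosed_closure.isOpen_compl.mem_nhds hcl)
  obtain ⟨x, hx1, hx2⟩ := (h1.joinedIn_compl (fun hpA => hp (h2 hpA)) h3).cross
    (D := {x | JoinedIn Cᶜ p x}) (JoinedIn.refl hp) (fun hh => hh.mem.2 hc)
  have hxC : x ∈ C := by
    have := frontier_component h.isClosed.isOpen_compl p hx2
    simpa using this
  exact h4 ⟨hxC, hx1⟩ (frontier_subset_closure hx2)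

lemma IsJC.frontier_eq {C : Set X} (h : IsJC C) {p : X} (hp : p ∉ C) :
    frontier {x | JoinedIn Cᶜ p x} = C := by
  apply Subset.antisymm
  · simpa using frontier_component h.isClosed.isOpen_compl p
  · intro x hx
    rw [(isOpen_joinedIn h.isClosed.isOpen_compl p).frontier_eq]
    exact ⟨h.subset_closure hp hx, fun hh => hh.mem.2 hx⟩

lemma IsJC.not_preconnected {C : Set X} (h : IsJC C) : ¬ IsPreconnected Cᶜ := by
  intro hpre
  have hCo := h.isClosed.isOpen_compl
  obtain ⟨a, b, A, B, hA, hB, hAB, rfl⟩ := h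
  obtain ⟨ε, hε, hε2⟩ := exists_between (dist_pos.2 hA.ne.symm)
  set S := frontier (ball a ε)
  have hSc : IsClosed S := isClosed_frontier
  have haS : a ∉ S := by
    rw [show S = _ from isOpen_ball.frontier_eq]
    exact fun h => h.2 (mem_ball_self hε)
  have hbS : b ∉ S := by
    intro hb
    have := closure_ball_subset_closedBall (frontier_subset_closure hb)
    exact absurd (mem_closedBall.1 this) (not_le.2 hε2)
  have hABS : ∀ x ∈ A, x ∈ B → x ∉ S := by
    intro x h1 h2 h3
    rcases hAB ⟨h1, h2⟩ with rfl | rfl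
    · exact haS h3
    · exact hbS h3
  obtain ⟨N1, n1, n2, n3⟩ := normal_exists_closure_subset (hA.isClosed.inter hSc)
    hB.isClosed.isOpen_compl (fun x hx hxB => hABS x hx.1 hxB hx.2)
  obtain ⟨N2, m1, m2, m3⟩ := normal_exists_closure_subset (hB.isClosed.inter hSc)
    (hA.isClosed.union (isClosed_closure (s := N1))).isOpen_compl (by
      rintro x hx (hxA | hx1)
      · exact hABS x hxA hx.1 hx.2
      · exact n3 hx1 hx.1)
  obtain ⟨M, M1, M2, M3, M4⟩ := exists_preconnected_compact (K := S \ (N1 ∪ N2)) hCo hpre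
    (hSc.isCompact.diff (n1.union m1)) (by
      rintro x ⟨hx1, hx2⟩ (hx | hx)
      · exact hx2 (Or.inl (n2 ⟨hx, hx1⟩))
      · exact hx2 (Or.inr (m2 ⟨hx, hx1⟩)))
  have hj := MS.j1 ((S ∩ closure N1) ∪ M) ((S ∩ closure N2) ∪ M)
    ((hSc.inter isClosed_closure).union M1.isClosed)
    ((hSc.inter isClosed_closure).union M1.isClosed)
    (by
      rw [← inter_union_distrib_right]
      have : S ∩ closure N1 ∩ (S ∩ closure N2) = ∅ := by
        apply eq_empty_of_forall_notMem
        rintro x ⟨⟨_, h1⟩, ⟨_, h2⟩⟩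
        exact m3 h2 (Or.inr h1)
      rw [this, empty_union]; exact M2) a b
    ((hB.isPathConnected.joinedIn a hB.left_mem b hB.right_mem).mono (by
      rintro x hx (⟨_, h1⟩ | h1)
      · exact n3 h1 hx
      · exact M4 h1 (Or.inr hx)))
    ((hA.isPathConnected.joinedIn a hA.left_mem b hA.right_mem).mono (by
      rintro x hx (⟨_, h1⟩ | h1)
      · exact m3 h1 (Or.inl hx)
      · exact M4 h1 (Or.inl hx)))
  obtain ⟨x, hx1, hx2⟩ := hj.cross (D := ball a ε) (mem_ball_self hε)
    (fun hb => by rw [mem_ball] at hb; linarith)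
  apply hx1
  by_cases h1 : x ∈ N1
  · exact Or.inl (Or.inl ⟨hx2, _root_.subset_closure h1⟩)
  by_cases h2 : x ∈ N2
  · exact Or.inr (Or.inl ⟨hx2, _root_.subset_closure h2⟩)
  · exact Or.inl (Or.inr (M3 ⟨hx2, by simp [h1, h2]⟩))

lemma IsJC.two {C : Set X} (h : IsJC C) {p q d : X} (hp : p ∉ C) (hq : q ∉ C) (hd : d ∉ C)
    (hdp : ¬ JoinedIn Cᶜ d p) (hdq : ¬ JoinedIn Cᶜ d q) : JoinedIn Cᶜ p q := by
  have hcl := h.isClosed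
  have hjc := h
  obtain ⟨a, b, A1, A2, hs⟩ := h
  have ha : a ∈ C := hs.left_mem
  have hb : b ∈ C := hs.rev.left_mem
  obtain ⟨h1, h2, h3, h4⟩ := hs
  obtain ⟨P, hP1, hP2⟩ := crosscut_gen hcl (hjc.endH ha) (hjc.endH hb) h1.ne
    (hjc.subset_closure hd ha) (hjc.subset_closure hd hb)
  have hPC : ∀ x ∈ P, x ∈ C → x = a ∨ x = b := by
    intro x hx hxC
    rcases hP2 hx with h | h
    · exact absurd hxC h.mem.2
    · exact h
  have hside : ∀ A A', IsArc A a b → IsArc A' a b → A ∩ A' ⊆ {a, b} → A ∪ A' = C →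
      JoinedIn (A ∪ P)ᶜ p q := by
    intro A A' hA hA' hAA hC
    obtain ⟨c, hc, hca, hcb⟩ := hA'.exists_interior
    have hcC : c ∈ C := hC ▸ Or.inr hc
    have hcn : c ∉ A ∪ P := by
      rintro (h | h)
      · rcases hAA ⟨h, hc⟩ with h | h
        · exact hca h
        · exact hcb h
      · rcases hPC c h hcC with h | h
        · exact hca h
        · exact hcb h
    have ho : IsOpen (A ∪ P)ᶜ := (hA.isClosed.union hP1.isClosed).isOpen_compl
    have key : ∀ r, r ∉ C → ¬ JoinedIn Cᶜ d r → JoinedIn (A ∪ P)ᶜ r c := by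
      intro r hr hdr
      refine joinedIn_of_closure ho (closure_mono ?_ (hjc.subset_closure hr hcC)) hcn
      intro x hx
      refine hx.component.mono ?_
      rintro y hy (hyA | hyP)
      · exact hy.mem.2 (hC ▸ Or.inl hyA)
      · rcases hP2 hyP with h | h | h
        · exact hdr (JoinedIn.trans h (JoinedIn.symm hy))
        · exact hy.mem.2 (h ▸ ha)
        · exact hy.mem.2 (h ▸ hb)
    exact (key p hp hdp).trans (key q hq hdq).symm
  have hint : (A1 ∪ P) ∩ (A2 ∪ P) = P := by
    rw [← inter_union_distrib_right]
    apply union_eq_self_of_subset_left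
    refine h3.trans ?_
    rintro x (rfl | rfl)
    · exact hP1.left_mem
    · exact hP1.right_mem
  refine (MS.j1 _ _ (h1.isClosed.union hP1.isClosed) (h2.isClosed.union hP1.isClosed)
    (by rw [hint]; exact hP1.isPreconnected) p q (hside A1 A2 h1 h2 h3 h4)
    (hside A2 A1 h2 h1 (by rwa [inter_comm]) (by rwa [union_comm]))).mono ?_
  apply compl_subset_compl.2
  rw [← h4]
  exact union_subset_union subset_union_left subset_union_left

end ms


section ms
variable {X : Type} [MetricSpace X] [MS X]

def JDom (D : Set X) : Prop := IsOpen D ∧ IsConnected D ∧ IsJC (frontier D)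

lemma IsJC.jdom {C : Set X} (h : IsJC C) {p : X} (hp : p ∉ C) : JDom {x | JoinedIn Cᶜ p x} :=
  ⟨isOpen_joinedIn h.isClosed.isOpen_compl p, isConnected_component hp, by
    rw [h.frontier_eq hp]; exact h⟩

lemma JDom.disj {D : Set X} (h : JDom D) {x : X} (hx : x ∈ D) : x ∉ frontier D := by
  rw [h.1.frontier_eq]; exact fun hh => hh.2 hx

lemma JDom.eq {D : Set X} (h : JDom D) {d : X} (hd : d ∈ D) :
    {x | JoinedIn (frontier D)ᶜ d x} = D := by
  ext x
  constructor
  · intro hx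
    by_contra hxD
    obtain ⟨y, h1, h2⟩ := JoinedIn.cross hx hd hxD
    exact h1 h2
  · intro hx
    exact joinedIn_of_preconnected isClosed_frontier.isOpen_compl h.2.1.isPreconnected
      (fun y hy => h.disj hy) hd hx

lemma JDom.joined {D : Set X} (h : JDom D) {x y : X} (hx : x ∈ D) (hy : y ∈ D) : JoinedIn D x y :=
  joinedIn_of_preconnected h.1 h.2.1.isPreconnected Subset.rfl hx hy

lemma JDom.crosscut {D : Set X} (h : JDom D) {a b : X} (ha : a ∈ frontier D) (hb : b ∈ frontier D)
    (hab : a ≠ b) : ∃ P, IsArc P a b ∧ P ⊆ D ∪ {a, b} := by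
  obtain ⟨d, hd⟩ := h.2.1.nonempty
  have := crosscut_gen (d := d) isClosed_frontier (h.2.2.endH ha) (h.2.2.endH hb) hab
    (by rw [h.eq hd]; exact frontier_subset_closure ha)
    (by rw [h.eq hd]; exact frontier_subset_closure hb)
  rwa [h.eq hd] at this

lemma JDom.exists_out {D : Set X} (h : JDom D) : ∃ d, d ∉ D ∧ d ∉ frontier D := by
  by_contra! hd
  apply h.2.2.not_preconnected
  have : (frontier D)ᶜ = D := by
    ext x
    constructor
    · intro hx; by_contra hxD; exact hx (hd x hxD)
    · intro hx; exact h.disj hx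
  rw [this]
  exact h.2.1.isPreconnected

lemma JDom.theta {D A1 A2 P : Set X} {a b : X} (h : JDom D) (hs : JSplit (frontier D) a b A1 A2)
    (hP : IsArc P a b) (hPD : P ⊆ D ∪ {a, b}) :
    ∃ E1 E2, JDom E1 ∧ JDom E2 ∧ Disjoint E1 E2 ∧ E1 ∪ E2 = D \ P ∧ frontier E1 = P ∪ A1 ∧
      frontier E2 = P ∪ A2 := by
  obtain ⟨d, hdD, hdC⟩ := h.exists_out
  have haC := hs.left_mem
  have hbC := hs.rev.left_mem
  have hPC : ∀ x ∈ P, x ∈ frontier D → x = a ∨ x = b := by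
    intro x hx hxC
    rcases hPD hx with h' | h'
    · exact absurd hxC (h.disj h')
    · exact h'
  have hext : ∀ y, JoinedIn (frontier D)ᶜ d y → y ∉ D := by
    intro y hy hyD
    obtain ⟨z, h1, h2⟩ := hy.symm.cross hyD hdD
    exact h1 h2
  have hout : ∀ x, x ∉ D → x ∈ closure {y | JoinedIn (frontier D)ᶜ d y} := by
    intro x hx
    by_cases hxC : x ∈ frontier D
    · exact h.2.2.subset_closure hdC hxC
    · obtain ⟨e, he⟩ := h.2.1.nonempty
      apply subset_closure
      apply h.2.2.two hdC hxC (h.disj he)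
      · intro hj
        have : d ∈ {x | JoinedIn (frontier D)ᶜ e x} := hj
        rw [h.eq he] at this; exact hdD this
      · intro hj
        have : x ∈ {x | JoinedIn (frontier D)ᶜ e x} := hj
        rw [h.eq he] at this; exact hx this
  have key : ∀ A A', JSplit (frontier D) a b A A' → ∃ E, JDom E ∧ frontier E = P ∪ A ∧ E ⊆ D ∧
      ∀ x, x ∉ P ∪ A → ¬ JoinedIn (P ∪ A)ᶜ d x → x ∈ E := by
    rintro A A' ⟨hA, hA', hAA, hC⟩
    have hAC : A ⊆ frontier D := hC ▸ subset_union_left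
    have hJ : IsJC (P ∪ A) := ⟨a, b, P, A, hP, hA, fun x hx => hPC x hx.1 (hAC hx.2), rfl⟩
    have hdJ : d ∉ P ∪ A := by
      rintro (h1 | h1)
      · rcases hPD h1 with h | h | h
        · exact hdD h
        · exact hdC (h ▸ haC)
        · exact hdC (h ▸ hbC)
      · exact hdC (hAC h1)
    have hne : ∃ e, e ∉ P ∪ A ∧ ¬ JoinedIn (P ∪ A)ᶜ d e := by
      by_contra! hall
      apply hJ.not_preconnected
      have : (P ∪ A)ᶜ = {x | JoinedIn (P ∪ A)ᶜ d x} := by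
        ext x; exact ⟨fun hx => hall x hx, fun hx => hx.mem.2⟩
      rw [this]
      exact (isConnected_component hdJ).isPreconnected
    obtain ⟨e, heJ, hde⟩ := hne
    refine ⟨_, hJ.jdom heJ, hJ.frontier_eq heJ, ?_, ?_⟩
    · intro x hx
      by_contra hxD
      apply hde
      have : JoinedIn (P ∪ A)ᶜ d x := by
        refine joinedIn_of_closure hJ.isClosed.isOpen_compl (closure_mono ?_ (hout x hxD)) hx.mem.2
        intro y hy
        refine hy.component.mono ?_
        rintro z hz (hzP | hzA)
        · rcases hPD hzP with h' | h' | h'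
          · exact hext z hz h'
          · exact hz.mem.2 (h' ▸ haC)
          · exact hz.mem.2 (h' ▸ hbC)
        · exact hz.mem.2 (hAC hzA)
      exact this.trans (JoinedIn.symm hx)
    · intro x hx hdx
      exact hJ.two heJ hx hdJ hde hdx
  obtain ⟨E1, j1, f1, s1, k1⟩ := key A1 A2 hs
  obtain ⟨E2, j2, f2, s2, k2⟩ := key A2 A1 hs.swap
  obtain ⟨h1, h2, h3, h4⟩ := hs
  have hA1C : A1 ⊆ frontier D := h4 ▸ subset_union_left
  have hA2C : A2 ⊆ frontier D := h4 ▸ subset_union_right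
  have n1 : ∀ x ∈ E1, x ∉ P := fun x hx hxP => j1.disj hx (f1 ▸ Or.inl hxP)
  have n2 : ∀ x ∈ E2, x ∉ P := fun x hx hxP => j2.disj hx (f2 ▸ Or.inl hxP)
  refine ⟨E1, E2, j1, j2, ?_, ?_, f1, f2⟩
  · rw [disjoint_iff_inter_eq_empty, ← not_nonempty_iff_eq_empty]
    intro hne
    have e1 : E2 ⊆ E1 := by
      apply j2.2.1.isPreconnected.subset_of_frontier (by rwa [inter_comm])
      rw [f1, disjoint_left]
      rintro x hx (h' | h')
      · exact n2 x hx h'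
      · exact h.disj (s2 hx) (hA1C h')
    have e2 : E1 ⊆ E2 := by
      apply j1.2.1.isPreconnected.subset_of_frontier hne
      rw [f2, disjoint_left]
      rintro x hx (h' | h')
      · exact n1 x hx h'
      · exact h.disj (s1 hx) (hA2C h')
    have e3 : P ∪ A1 = P ∪ A2 := by rw [← f1, ← f2, e1.antisymm e2]
    obtain ⟨c, hc, hca, hcb⟩ := h1.exists_interior
    have hc2 : c ∈ P ∪ A2 := e3 ▸ Or.inr hc
    have : c = a ∨ c = b := by
      rcases hc2 with h' | h'
      · exact hPC c h' (hA1C hc)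
      · exact h3 ⟨hc, h'⟩
    tauto
  · ext x
    constructor
    · rintro (hx | hx)
      · exact ⟨s1 hx, n1 x hx⟩
      · exact ⟨s2 hx, n2 x hx⟩
    · rintro ⟨hxD, hxP⟩
      have hxC := h.disj hxD
      have m1 : x ∉ P ∪ A1 := by rintro (h' | h'); exacts [hxP h', hxC (hA1C h')]
      have m2 : x ∉ P ∪ A2 := by rintro (h' | h'); exacts [hxP h', hxC (hA2C h')]
      by_contra hx
      have hx1 : JoinedIn (P ∪ A1)ᶜ d x := by
        by_contra hh; exact hx (Or.inl (k1 x m1 hh))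
      have hx2 : JoinedIn (P ∪ A2)ᶜ d x := by
        by_contra hh; exact hx (Or.inr (k2 x m2 hh))
      have hint : (P ∪ A1) ∩ (P ∪ A2) = P := by
        rw [← union_inter_distrib_left]
        apply union_eq_self_of_subset_right
        refine h3.trans ?_
        rintro x (rfl | rfl)
        · exact hP.left_mem
        · exact hP.right_mem
      have := MS.j1 _ _ (hP.isClosed.union h1.isClosed) (hP.isClosed.union h2.isClosed)
        (by rw [hint]; exact hP.isPreconnected) d x hx1 hx2
      obtain ⟨z, z1, z2⟩ := this.symm.cross hxD hdD
      rw [← h4] at z2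
      apply z1
      rcases z2 with h' | h'
      · exact Or.inl (Or.inr h')
      · exact Or.inr (Or.inr h')

lemma IsArc.dense_compl {P : Set X} {a b : X} (h : IsArc P a b) : interior P = ∅ := by
  obtain ⟨γ, hc, hi, -, -, rfl⟩ := h
  by_contra hne
  obtain ⟨x, hx⟩ := nonempty_iff_ne_empty.2 hne
  set U := interior (γ '' Icc 0 1)
  obtain ⟨r, hr, rfl⟩ := interior_subset hx
  have hU : γ ⁻¹' U ∈ 𝓝[Icc 0 1] r := (hc r hr) (isOpen_interior.mem_nhds hx)
  obtain ⟨s, t, hst, hs0, ht1, hstU⟩ : ∃ s t : ℝ, s < t ∧ 0 < s ∧ t ≤ 1 ∧ Ioo s t ⊆ γ ⁻¹' U := by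
    rw [Metric.mem_nhdsWithin_iff] at hU
    obtain ⟨ε, hε, hsub⟩ := hU
    by_cases hr1 : r < 1
    · refine ⟨max (r + 0) (r / 2 + min (r + ε) 1 / 2), min (r + ε) 1, ?_, ?_, min_le_right _ _, ?_⟩
      · have : r < min (r + ε) 1 := lt_min (by linarith) hr1
        apply max_lt <;> linarith
      · have : r < min (r + ε) 1 := lt_min (by linarith) hr1
        apply lt_max_of_lt_right
        linarith [hr.1]
      · rintro y ⟨hy1, hy2⟩
        have h1 : r + 0 < y := (le_max_left _ _).trans_lt hy1
        have h2 : y < r + ε := hy2.trans_le (min_le_left _ _)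
        have h3 : y < 1 := hy2.trans_le (min_le_right _ _)
        refine hsub ⟨?_, by linarith [hr.1], h3.le⟩
        rw [mem_ball, Real.dist_eq, abs_lt]
        constructor <;> linarith
    · have hr1 : r = 1 := le_antisymm hr.2 (not_lt.1 hr1)
      refine ⟨max (1 - ε) (1 / 2), 1, ?_, ?_, le_rfl, ?_⟩
      · apply max_lt <;> linarith
      · apply lt_max_of_lt_right; norm_num
      · rintro y ⟨hy1, hy2⟩
        have h1 : 1 - ε < y := (le_max_left _ _).trans_lt hy1
        have h2 : 1 / 2 < y := (le_max_right _ _).trans_lt hy1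
        refine hsub ⟨?_, by linarith, hy2.le⟩
        rw [mem_ball, Real.dist_eq, abs_lt]
        constructor <;> linarith
  have hsub : Icc s t ⊆ Icc (0:ℝ) 1 := Icc_subset_Icc hs0.le ht1
  have hrest : Icc 0 s ∪ Icc t 1 ⊆ Icc (0:ℝ) 1 :=
    union_subset (Icc_subset_Icc le_rfl (by linarith)) (Icc_subset_Icc (by linarith) le_rfl)
  have hWeq : γ '' Ioo s t = U ∩ (γ '' (Icc 0 s ∪ Icc t 1))ᶜ := by
    ext x
    constructor
    · rintro ⟨y, hy, rfl⟩
      refine ⟨hstU hy, ?_⟩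
      rintro ⟨z, hz, he⟩
      have := hi (hrest hz) (hsub (Ioo_subset_Icc_self hy)) he
      subst this
      rcases hz with h | h
      · linarith [h.2, hy.1]
      · linarith [h.1, hy.2]
    · rintro ⟨hx1, hx2⟩
      obtain ⟨y, hy, rfl⟩ := interior_subset hx1
      refine ⟨y, ?_, rfl⟩
      by_contra hy2
      apply hx2
      refine ⟨y, ?_, rfl⟩
      by_cases h : y ≤ s
      · exact Or.inl ⟨hy.1, h⟩
      · right
        refine ⟨?_, hy.2⟩
        by_contra h2
        exact hy2 ⟨not_le.1 h, not_le.1 h2⟩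
  have hWo : IsOpen (γ '' Ioo s t) := by
    rw [hWeq]
    refine isOpen_interior.inter ?_
    exact ((isCompact_Icc.union isCompact_Icc).image_of_continuousOn
      (hc.mono hrest)).isClosed.isOpen_compl
  have hfr : frontier (γ '' Ioo s t) ⊆ {γ s, γ t} := by
    rw [hWo.frontier_eq]
    rintro x ⟨hx1, hx2⟩
    have hcl : IsClosed (γ '' Icc s t) :=
      (isCompact_Icc.image_of_continuousOn (hc.mono hsub)).isClosed
    obtain ⟨y, hy, rfl⟩ := closure_minimal (image_mono Ioo_subset_Icc_self) hcl hx1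
    rcases hy.1.eq_or_lt with h | h
    · left; rw [h]
    rcases hy.2.eq_or_lt with h' | h'
    · right; rw [← h']; rfl
    exact absurd ⟨y, ⟨h, h'⟩, rfl⟩ hx2
  have hm : (s + t) / 2 ∈ Ioo s t := ⟨by linarith, by linarith⟩
  have hinj : ∀ u v, u ∈ Icc (0:ℝ) 1 → v ∈ Icc (0:ℝ) 1 → u ≠ v → γ u ≠ γ v :=
    fun u v hu hv huv he => huv (hi hu hv he)
  have hsI : s ∈ Icc (0:ℝ) 1 := hsub ⟨le_rfl, hst.le⟩
  have htI : t ∈ Icc (0:ℝ) 1 := hsub ⟨hst.le, le_rfl⟩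
  have hmI := hsub (Ioo_subset_Icc_self hm)
  have h0I : (0:ℝ) ∈ Icc (0:ℝ) 1 := by simp
  have hj := MS.j1 {γ s} {γ t} isClosed_singleton isClosed_singleton
    (by
      apply Set.Subsingleton.isPreconnected
      exact subsingleton_singleton.anti inter_subset_left) (γ ((s + t) / 2)) (γ 0)
    (joinedIn_compl_singleton (hinj _ _ hmI hsI hm.1.ne') (hinj _ _ h0I hsI hs0.ne))
    (joinedIn_compl_singleton (hinj _ _ hmI htI hm.2.ne)
      (hinj _ _ h0I htI (hs0.trans hst).ne))
  obtain ⟨z, z1, z2⟩ := hj.cross (D := γ '' Ioo s t) ⟨_, hm, rfl⟩ (by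
    rintro ⟨y, hy, he⟩
    have := hi (hsub (Ioo_subset_Icc_self hy)) h0I he
    linarith [hy.1])
  exact z1 (hfr z2)

lemma exists_faces : ∃ (C D D' : Set X) (a b : X) (A1 A2 : Set X), JSplit C a b A1 A2 ∧ JDom D ∧
    JDom D' ∧ Disjoint D D' ∧ frontier D = C ∧ frontier D' = C ∧ D ∪ D' = Cᶜ := by
  obtain ⟨a, b, hab⟩ := exists_pair_ne X
  obtain ⟨P, -, hP⟩ := (joinedIn_of_preconnected isOpen_univ isPreconnected_univ Subset.rfl
    (mem_univ a) (mem_univ b)).exists_arc hab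
  have hd : Dense Pᶜ := interior_eq_empty_iff_dense_compl.1 hP.dense_compl
  obtain ⟨d, hdP⟩ := hd.nonempty
  have hV : {x | JoinedIn Pᶜ d x} = Pᶜ := by
    ext x; exact ⟨fun hx => hx.mem.2, fun hx => hP.joinedIn_compl hdP hx⟩
  obtain ⟨Q, hQ, hQP⟩ := crosscut_gen (d := d) hP.isClosed hP.endH hP.symm.endH hab
    (by rw [hV]; exact hd a) (by rw [hV]; exact hd b)
  rw [hV] at hQP
  have hs : JSplit (P ∪ Q) a b P Q := ⟨hP, hQ, by
    rintro x ⟨h1, h2⟩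
    rcases hQP h2 with h | h
    · exact absurd h1 h
    · exact h, rfl⟩
  have hJ := hs.isJC
  have hne : ∃ p q, p ∉ P ∪ Q ∧ q ∉ P ∪ Q ∧ ¬ JoinedIn (P ∪ Q)ᶜ p q := by
    by_contra! hall
    apply hJ.not_preconnected
    by_cases hne : ((P ∪ Q)ᶜ).Nonempty
    · obtain ⟨p, hp⟩ := hne
      have : (P ∪ Q)ᶜ = {x | JoinedIn (P ∪ Q)ᶜ p x} := by
        ext x; exact ⟨fun hx => hall p x hp hx, fun hx => hx.mem.2⟩
      rw [this]
      exact (isConnected_component hp).isPreconnected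
    · rw [not_nonempty_iff_eq_empty.1 hne]; exact isPreconnected_empty
  obtain ⟨p, q, hp, hq, hpq⟩ := hne
  refine ⟨P ∪ Q, _, _, a, b, P, Q, hs, hJ.jdom hp, hJ.jdom hq, ?_, hJ.frontier_eq hp,
    hJ.frontier_eq hq, ?_⟩
  · rw [disjoint_left]
    intro x hx1 hx2
    exact hpq (JoinedIn.trans hx1 (JoinedIn.symm hx2))
  · ext x
    constructor
    · rintro (hx | hx) <;> exact hx.mem.2
    · intro hx
      by_cases h : JoinedIn (P ∪ Q)ᶜ p x
      · exact Or.inl h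
      · exact Or.inr (hJ.two hq hx hp hpq h)

end ms


structure IsLoop {X : Type*} [TopologicalSpace X] (c : ℝ → X) (C : Set X) : Prop where
  cont : ContinuousOn c (Icc 0 1)
  ends : c 0 = c 1
  inj : ∀ x ∈ Icc (0:ℝ) 1, ∀ y ∈ Ioo (0:ℝ) 1, c x = c y → x = y
  img : c '' Icc 0 1 = C

lemma IsJC.exists_loop {X : Type*} [TopologicalSpace X] {C : Set X} (h : IsJC C) {t0 : X}
    (ht : t0 ∈ C) : ∃ c, IsLoop c C ∧ c 0 = t0 := by
  obtain ⟨b, hb, hbt⟩ := h.exists_ne t0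
  obtain ⟨A1, A2, ⟨γ, gc, gi, g0, g1, gP⟩, h2, h3, h4⟩ := h.split ht hb hbt.symm
  obtain ⟨δ, dc, di, d0, d1, dP⟩ := h2.symm
  set c : ℝ → X := fun t => if t ≤ 1 / 2 then γ (2 * t) else δ (2 * t - 1) with hcdef
  have e1 : EqOn c (fun t => γ (2 * t)) (Icc 0 (1 / 2)) := fun t ht => by
    simp only [hcdef]; rw [if_pos ht.2]
  have e2 : EqOn c (fun t => δ (2 * t - 1)) (Icc (1 / 2) 1) := fun t ht => by
    simp only [hcdef]
    rcases ht.1.eq_or_lt with h | h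
    · rw [if_pos h.ge, ← h]; norm_num; rw [g1, d0]
    · rw [if_neg (not_le.2 h)]
  have hI : Icc (0:ℝ) (1/2) ∪ Icc (1/2) 1 = Icc 0 1 :=
    Icc_union_Icc_eq_Icc (by norm_num) (by norm_num)
  have i1 : c '' Icc 0 (1/2) = A1 := by
    rw [e1.image_eq, ← gP]
    ext x; constructor
    · rintro ⟨t, ht, rfl⟩; exact ⟨2 * t, ⟨by linarith [ht.1], by linarith [ht.2]⟩, rfl⟩
    · rintro ⟨t, ht, rfl⟩
      exact ⟨t / 2, ⟨by linarith [ht.1], by linarith [ht.2]⟩, by simp only; congr 1; ring⟩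
  have i2 : c '' Icc (1/2) 1 = A2 := by
    rw [e2.image_eq, ← dP]
    ext x; constructor
    · rintro ⟨t, ht, rfl⟩; exact ⟨2 * t - 1, ⟨by linarith [ht.1], by linarith [ht.2]⟩, rfl⟩
    · rintro ⟨t, ht, rfl⟩
      exact ⟨(t + 1) / 2, ⟨by linarith [ht.1], by linarith [ht.2]⟩, by simp only; congr 1; ring⟩
  have c0 : c 0 = t0 := by rw [e1 ⟨le_rfl, by norm_num⟩]; simp [g0]
  have c1 : c 1 = t0 := by rw [e2 ⟨by norm_num, le_rfl⟩]; norm_num; exact d1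
  have ch : c (1/2) = b := by rw [e1 ⟨by norm_num, le_rfl⟩]; norm_num; exact g1
  have inj1 : InjOn c (Icc 0 (1/2)) := by
    intro x hx y hy hxy
    rw [e1 hx, e1 hy] at hxy
    have := gi ⟨by linarith [hx.1], by linarith [hx.2]⟩ ⟨by linarith [hy.1], by linarith [hy.2]⟩ hxy
    linarith
  have inj2 : InjOn c (Icc (1/2) 1) := by
    intro x hx y hy hxy
    rw [e2 hx, e2 hy] at hxy
    have := di ⟨by linarith [hx.1], by linarith [hx.2]⟩ ⟨by linarith [hy.1], by linarith [hy.2]⟩ hxy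
    linarith
  have key : ∀ x ∈ Icc (0:ℝ) (1/2), ∀ y ∈ Icc (1/2:ℝ) 1, c x = c y →
      (x = 0 ∧ y = 1) ∨ (x = 1/2 ∧ y = 1/2) := by
    intro x hx y hy hxy
    have : c x ∈ A1 ∩ A2 := ⟨i1 ▸ mem_image_of_mem c hx, by rw [hxy]; exact i2 ▸ mem_image_of_mem c hy⟩
    rcases h3 this with h | h
    · left
      exact ⟨inj1 hx ⟨le_rfl, by norm_num⟩ (by rw [h, c0]),
        inj2 hy ⟨by norm_num, le_rfl⟩ (by rw [← hxy, h, c1])⟩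
    · right
      have h : c x = b := h
      exact ⟨inj1 hx ⟨by norm_num, le_rfl⟩ (by rw [h, ch]),
        inj2 hy ⟨le_rfl, by norm_num⟩ (by rw [← hxy, h, ch])⟩
  refine ⟨c, ⟨?_, by rw [c0, c1], ?_, ?_⟩, c0⟩
  · rw [← hI]
    apply ContinuousOn.union_of_isClosed _ _ isClosed_Icc isClosed_Icc
    · refine ContinuousOn.congr ?_ e1
      exact gc.comp (by fun_prop) (fun t ht => ⟨by linarith [ht.1], by linarith [ht.2]⟩)
    · refine ContinuousOn.congr ?_ e2
      exact dc.comp (by fun_prop) (fun t ht => ⟨by linarith [ht.1], by linarith [ht.2]⟩)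
  · intro x hx y hy hxy
    rw [← hI] at hx
    have hy' : y ∈ Icc (0:ℝ) (1/2) ∪ Icc (1/2) 1 := hI ▸ Ioo_subset_Icc_self hy
    rcases hx with hx | hx <;> rcases hy' with hy' | hy'
    · exact inj1 hx hy' hxy
    · rcases key x hx y hy' hxy with h | h
      · linarith [hy.2]
      · linarith
    · rcases key y hy' x hx hxy.symm with h | h
      · linarith [hy.1]
      · linarith
    · exact inj2 hx hy' hxy
  · rw [← hI, image_union, i1, i2, h4]

namespace IsLoop
variable {X : Type*} [MetricSpace X] {c : ℝ → X} {C : Set X}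

lemma arc (h : IsLoop c C) {s t : ℝ} (hs : 0 ≤ s) (hst : s < t) (ht : t ≤ 1) (hne : 0 < s ∨ t < 1) :
    IsArc (c '' Icc s t) (c s) (c t) := by
  apply IsArc.of_interval hst
  · exact h.cont.mono (Icc_subset_Icc hs ht)
  · intro x hx y hy hxy
    have hx1 : x ∈ Icc (0:ℝ) 1 := ⟨hs.trans hx.1, hx.2.trans ht⟩
    have hy1 : y ∈ Icc (0:ℝ) 1 := ⟨hs.trans hy.1, hy.2.trans ht⟩
    by_cases hyy : y ∈ Ioo (0:ℝ) 1
    · exact h.inj x hx1 y hyy hxy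
    by_cases hxx : x ∈ Ioo (0:ℝ) 1
    · exact (h.inj y hy1 x hxx hxy.symm).symm
    rw [mem_Ioo, not_and_or, not_lt, not_lt] at hyy hxx
    rcases hne with h1 | h1
    · have : 1 ≤ y := hyy.resolve_left (by linarith [hy.1])
      have : 1 ≤ x := hxx.resolve_left (by linarith [hx.1])
      linarith [hx1.2, hy1.2]
    · have : y ≤ 0 := hyy.resolve_right (by linarith [hy.2])
      have : x ≤ 0 := hxx.resolve_right (by linarith [hx.2])
      linarith [hx1.1, hy1.1]

lemma jsplit (h : IsLoop c C) {s t : ℝ} (hs : 0 < s) (hst : s < t) (ht : t < 1) :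
    JSplit C (c s) (c t) (c '' Icc s t) (c '' Icc t 1 ∪ c '' Icc 0 s) := by
  refine ⟨h.arc hs.le hst ht.le (Or.inl hs), ?_, ?_, ?_⟩
  · have a1 := h.arc (hs.trans hst).le ht le_rfl (Or.inl (hs.trans hst))
    have a2 := h.arc le_rfl hs (hst.trans ht).le (Or.inr (hst.trans ht))
    rw [h.ends] at a2
    refine (a1.trans a2 ?_).symm
    rintro x ⟨⟨y, hy, rfl⟩, ⟨z, hz, he⟩⟩
    by_cases hy1 : y = 1
    · rw [hy1]; rfl
    have := h.inj z ⟨hz.1, by linarith [hz.2]⟩ y ⟨by linarith [hy.1], lt_of_le_of_ne hy.2 hy1⟩ he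
    linarith [hz.2, hy.1]
  · rintro x ⟨⟨y, hy, rfl⟩, ⟨z, hz, he⟩ | ⟨z, hz, he⟩⟩
    · have := h.inj z ⟨by linarith [hz.1], hz.2⟩ y ⟨by linarith [hy.1], by linarith [hy.2]⟩ he
      right
      rw [← he, show z = t by linarith [hz.1, hy.2]]; rfl
    · have := h.inj z ⟨by linarith [hz.1], by linarith [hz.2]⟩ y
        ⟨by linarith [hy.1], by linarith [hy.2]⟩ he
      left
      rw [← he, show z = s by linarith [hz.2, hy.1]]
  · rw [← h.img, union_comm, union_assoc, ← image_union, ← image_union,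
      Icc_union_Icc_eq_Icc hs.le hst.le, union_comm,
      Icc_union_Icc_eq_Icc (hs.trans hst).le ht.le]

lemma ord (h : IsLoop c C) {B : Set X} (hB : IsPreconnected B) (hBC : B ⊆ C) (h0 : c 0 ∉ B) :
    OrdConnected {t | t ∈ Icc (0:ℝ) 1 ∧ c t ∈ B} := by
  constructor
  rintro u ⟨hu, huB⟩ s ⟨hs, hsB⟩ r hr
  have hr1 : r ∈ Icc (0:ℝ) 1 := ⟨hu.1.trans hr.1, hr.2.trans hs.2⟩
  refine ⟨hr1, ?_⟩
  by_contra hrB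
  have hu0 : 0 < u := lt_of_le_of_ne hu.1 (fun e => h0 (e ▸ huB))
  have hs1 : s < 1 := lt_of_le_of_ne hs.2 (fun e => h0 (h.ends ▸ e ▸ hsB))
  have hur : u < r := lt_of_le_of_ne hr.1 (fun e => hrB (e ▸ huB))
  have hrs : r < s := lt_of_le_of_ne hr.2 (fun e => hrB (e ▸ hsB))
  have k1 : IsClosed (c '' Icc 0 r) := (isCompact_Icc.image_of_continuousOn
    (h.cont.mono (Icc_subset_Icc le_rfl hr1.2))).isClosed
  have k2 : IsClosed (c '' Icc r 1) := (isCompact_Icc.image_of_continuousOn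
    (h.cont.mono (Icc_subset_Icc hr1.1 le_rfl))).isClosed
  rcases isPreconnected_iff_subset_of_disjoint_closed.1 hB _ _ k1 k2 (by
      rw [← image_union, Icc_union_Icc_eq_Icc hr1.1 hr1.2, h.img]; exact hBC) (by
      apply eq_empty_of_forall_notMem
      rintro x ⟨hxB, ⟨y, hy, hey⟩, ⟨z, hz, hez⟩⟩
      have hz1 : z ≠ 1 := by
        rintro rfl
        rw [← hez, ← h.ends] at hxB
        exact h0 hxB
      have := h.inj y ⟨hy.1, hy.2.trans hr1.2⟩ z ⟨by linarith [hz.1], lt_of_le_of_ne hz.2 hz1⟩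
        (hey.trans hez.symm)
      have : z = r := by linarith [hz.1, hy.2]
      rw [this] at hez
      exact hrB (hez ▸ hxB)) with h1 | h1
  · obtain ⟨y, hy, he⟩ := h1 hsB
    have := h.inj y ⟨hy.1, hy.2.trans hr1.2⟩ s ⟨by linarith, hs1⟩ he
    linarith [hy.2]
  · obtain ⟨y, hy, he⟩ := h1 huB
    have := h.inj y ⟨hr1.1.trans hy.1, hy.2⟩ u ⟨hu0, by linarith⟩ he
    linarith [hy.1]

lemma inter_pre (h : IsLoop c C) {B : Set X} (hB : IsPreconnected B) (hBC : B ⊆ C) (h0 : c 0 ∉ B)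
    {u s : ℝ} (hu : 0 ≤ u) (hs : s ≤ 1) : IsPreconnected (B ∩ c '' Icc u s) := by
  have h1 := h.ord hB hBC h0
  have h2 : OrdConnected ({t | t ∈ Icc (0:ℝ) 1 ∧ c t ∈ B} ∩ Icc u s) := h1.inter ordConnected_Icc
  have h3 := h2.isPreconnected.image c (h.cont.mono fun t ht => ht.1.1)
  convert h3 using 1
  ext x
  constructor
  · rintro ⟨hx, t, ht, rfl⟩
    exact ⟨t, ⟨⟨⟨hu.trans ht.1, ht.2.trans hs⟩, hx⟩, ht⟩, rfl⟩
  · rintro ⟨t, ht, rfl⟩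
    exact ⟨ht.1.2, t, ht.2, rfl⟩

lemma finite_cover (h : IsLoop c C) {U2 K : Set X} (hU : IsOpen U2) (hK : IsClosed K)
    (hKU : K ⊆ U2) : ∃ S : Set (Set X), S.Finite ∧ (∀ B ∈ S, IsPreconnected B ∧ B ⊆ C ∧ B ⊆ U2) ∧
      C ∩ K ⊆ ⋃₀ S := by
  have := (isCompact_Icc (a := (0:ℝ)) (b := 1)).induction_on
    (p := fun s => ∃ S : Set (Set X), S.Finite ∧
      (∀ B ∈ S, IsPreconnected B ∧ B ⊆ C ∧ B ⊆ U2) ∧ c '' (s ∩ Icc 0 1) ∩ K ⊆ ⋃₀ S)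
    ⟨∅, finite_empty, by simp, by simp⟩
    (fun s t hst ⟨S, h1, h2, h3⟩ => ⟨S, h1, h2, Subset.trans
      (inter_subset_inter_left _ (image_mono (inter_subset_inter_left _ hst))) h3⟩)
    (fun s t ⟨S, h1, h2, h3⟩ ⟨S', h1', h2', h3'⟩ => ⟨S ∪ S', h1.union h1', fun B hB =>
      hB.elim (h2 B) (h2' B), by
        rw [union_inter_distrib_right, image_union, union_inter_distrib_right, sUnion_union]
        exact union_subset_union h3 h3'⟩) ?_
  · obtain ⟨S, h1, h2, h3⟩ := this
    rw [inter_self, h.img] at h3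
    exact ⟨S, h1, h2, h3⟩
  · intro t ht
    by_cases htU : c t ∈ U2
    · have h1 : c ⁻¹' U2 ∈ 𝓝[Icc 0 1] t := h.cont t ht (hU.mem_nhds htU)
      obtain ⟨ε, hε, hsub⟩ := Metric.mem_nhdsWithin_iff.1 h1
      refine ⟨ball t ε, mem_nhdsWithin_of_mem_nhds (ball_mem_nhds _ hε),
        {c '' (ball t ε ∩ Icc 0 1)}, finite_singleton _, ?_, ?_⟩
      · rintro B rfl
        refine ⟨?_, ?_, ?_⟩
        · apply IsPreconnected.image _ _ (h.cont.mono inter_subset_right)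
          exact ((convex_ball t ε).inter (convex_Icc 0 1)).isPreconnected
        · rw [← h.img]; exact image_mono inter_subset_right
        · rintro _ ⟨y, hy, rfl⟩; exact hsub hy
      · rw [sUnion_singleton]; exact inter_subset_left
    · have h1 : c ⁻¹' Kᶜ ∈ 𝓝[Icc 0 1] t :=
        h.cont t ht (hK.isOpen_compl.mem_nhds fun hh => htU (hKU hh))
      refine ⟨_, h1, ∅, finite_empty, by simp, ?_⟩
      rintro _ ⟨⟨y, hy, rfl⟩, hyK⟩
      exact absurd hyK hy.1

end IsLoop

lemma JoinedIn.first_hit {X : Type*} [MetricSpace X] {T R : Set X} {b x : X} (h : JoinedIn T b x)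
    (hR : IsClosed R) (hx : x ∈ R) : ∃ r ∈ R ∩ T, JoinedIn ((T \ R) ∪ {r}) b r := by
  obtain ⟨γ, hγ⟩ := h
  have hc : IsCompact (γ ⁻¹' R) := (hR.preimage γ.continuous).isCompact
  obtain ⟨τ, hτ, hmin⟩ := hc.exists_isLeast ⟨1, by simpa using hx⟩
  refine ⟨γ τ, ⟨hτ, hγ τ⟩, ?_⟩
  have hpc : IsPathConnected (γ.extend '' Icc 0 (τ : ℝ)) :=
    ((convex_Icc 0 (τ:ℝ)).isPathConnected ⟨0, le_rfl, τ.2.1⟩).image γ.continuous_extend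
  have h0 : b ∈ γ.extend '' Icc 0 (τ : ℝ) := ⟨0, ⟨le_rfl, τ.2.1⟩, by simp⟩
  have h1 : γ τ ∈ γ.extend '' Icc 0 (τ : ℝ) := ⟨τ, ⟨τ.2.1, le_rfl⟩, by simp⟩
  refine (hpc.joinedIn b h0 _ h1).mono ?_
  rintro _ ⟨t, ht, rfl⟩
  have ht1 : t ∈ unitInterval := ⟨ht.1, ht.2.trans τ.2.2⟩
  rw [γ.extend_apply ht1]
  by_cases hRt : γ ⟨t, ht1⟩ ∈ R
  · right
    have h2 : τ ≤ ⟨t, ht1⟩ := hmin hRt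
    have : (⟨t, ht1⟩ : unitInterval) = τ := le_antisymm ht.2 h2
    rw [this]; rfl
  · left; exact ⟨hγ _, hRt⟩


inductive Cut {X : Type} [MetricSpace X] (Good : Set X → Prop) : Set X → Prop
  | leaf (D : Set X) : JDom D → Good D → Cut Good D
  | split (D : Set X) (a b : X) (A1 A2 P E1 E2 : Set X) : JDom D →
      JSplit (frontier D) a b A1 A2 → IsArc P a b → P ⊆ D ∪ {a, b} →
      JDom E1 → JDom E2 → Disjoint E1 E2 → E1 ∪ E2 = D \ P →
      frontier E1 = P ∪ A1 → frontier E2 = P ∪ A2 → Cut Good E1 → Cut Good E2 → Cut Good D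

lemma Cut.bind {X : Type} [MetricSpace X] {G G' : Set X → Prop} {D : Set X} (h : Cut G D)
    (hG : ∀ E ⊆ D, JDom E → G E → Cut G' E) : Cut G' D := by
  induction h with
  | leaf D h1 h2 => exact hG D Subset.rfl h1 h2
  | split D a b A1 A2 P E1 E2 h1 h2 h3 h4 h5 h6 h7 h8 h9 h10 _ _ ih1 ih2 =>
    have s1 : E1 ⊆ D := fun x hx => (h8 ▸ Or.inl hx : x ∈ D \ P).1
    have s2 : E2 ⊆ D := fun x hx => (h8 ▸ Or.inr hx : x ∈ D \ P).1
    exact .split D a b A1 A2 P E1 E2 h1 h2 h3 h4 h5 h6 h7 h8 h9 h10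
      (ih1 fun E hE => hG E (hE.trans s1)) (ih2 fun E hE => hG E (hE.trans s2))

section ms
variable {X : Type} [MetricSpace X] [MS X]

lemma comp_spread {D U2 V B : Set X} (hD : JDom D) (hU2 : IsOpen U2) {p : X}
    (hV : V = {x | JoinedIn (D ∩ U2) p x}) (hB : IsPreconnected B) (hBC : B ⊆ frontier D)
    (hBU : B ⊆ U2) (hmeet : (B ∩ closure V).Nonempty) : B ⊆ closure V := by
  have hVD : ∀ v ∈ V, v ∈ D := by rw [hV]; exact fun v hv => hv.mem.2.1
  have key : ∀ x ∈ B, x ∈ closure V → ∃ N ∈ 𝓝 x, N ∩ frontier D ⊆ closure V := by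
    intro x hxB hxV
    obtain ⟨O', hO', hj⟩ := (hD.2.2.endH (hBC hxB)).local_joined isClosed_frontier
      (hU2.mem_nhds (hBU hxB))
    obtain ⟨O, hOO, hO, hxO⟩ := _root_.mem_nhds_iff.1 hO'
    refine ⟨O, hO.mem_nhds hxO, ?_⟩
    obtain ⟨v, hvO, hvV⟩ := _root_.mem_closure_iff.1 hxV O hO hxO
    rintro y ⟨hyO, hyC⟩
    rw [_root_.mem_closure_iff]
    intro N hN hyN
    obtain ⟨e, ⟨heN, heO⟩, heD⟩ := _root_.mem_closure_iff.1 (frontier_subset_closure hyC) (N ∩ O)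
      (hN.inter hO) ⟨hyN, hyO⟩
    refine ⟨e, heN, ?_⟩
    have hve : JoinedIn (frontier D)ᶜ v e := by
      have : e ∈ {x | JoinedIn (frontier D)ᶜ v x} := by rw [hD.eq (hVD v hvV)]; exact heD
      exact this
    have h2 := (hj v (hOO hvO) e (hOO heO) hve).component
    have h3 : JoinedIn (D ∩ U2) v e := by
      refine h2.mono ?_
      intro z hz
      refine ⟨?_, hz.mem.2.1⟩
      have : z ∈ {x | JoinedIn (frontier D)ᶜ v x} := JoinedIn.mono hz inter_subset_right
      rwa [hD.eq (hVD v hvV)] at this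
    rw [hV] at hvV ⊢
    exact JoinedIn.trans hvV h3
  set W := {x | ∃ N ∈ 𝓝 x, N ∩ frontier D ⊆ closure V}
  have hW : IsOpen W := by
    rw [isOpen_iff_mem_nhds]
    rintro x ⟨N, hN, hNV⟩
    filter_upwards [eventually_mem_nhds_iff.2 hN] with y hy
    exact ⟨N, hy, hNV⟩
  by_contra hnot
  obtain ⟨x, hxB, hxV⟩ := not_subset.1 hnot
  obtain ⟨y, hyB, hyV⟩ := hmeet
  obtain ⟨z, hzB, ⟨N, hN, hNV⟩, hzV⟩ := hB W (closure V)ᶜ hW isClosed_closure.isOpen_compl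
    (fun z hz => by
      by_cases hzV : z ∈ closure V
      · exact Or.inl (key z hz hzV)
      · exact Or.inr hzV) ⟨y, hyB, key y hyB hyV⟩ ⟨x, hxB, hxV⟩
  exact hzV (hNV ⟨mem_of_mem_nhds hN, hBC hzB⟩)

lemma cut_claim {U1 U2 : Set X} (hU1p : IsPreconnected U1)
    (hU2 : IsOpen U2) (hcl : closure U1 ⊆ U2) (n : ℕ) : ∀ (D : Set X) (S : Set (Set X)), JDom D →
    ¬ U1 ⊆ D → S.Finite → S.ncard = n →
    (∀ B ∈ S, IsPreconnected B ∧ B ⊆ frontier D ∧ B ⊆ U2) → frontier D ∩ closure U1 ⊆ ⋃₀ S →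
    Cut (fun E => frontier E ⊆ U2 ∨ Disjoint E U1) D := by
  induction n using Nat.strong_induction_on with
  | _ n ih =>
  intro D S hD hUD hSf hSn hS hcov
  by_cases hgood : frontier D ⊆ U2 ∨ Disjoint D U1
  · exact .leaf D hD hgood
  rw [not_or, not_subset, not_disjoint_iff] at hgood
  obtain ⟨⟨t0, ht0C, ht0U⟩, p, hpD, hpU⟩ := hgood
  have hC : IsClosed (frontier D) := isClosed_frontier
  have hpU2 : p ∈ U2 := hcl (subset_closure hpU)
  have hstay : ∀ v ∈ D, ∀ e, JoinedIn (frontier D)ᶜ v e → e ∈ D := by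
    intro v hv e he
    have : e ∈ {x | JoinedIn (frontier D)ᶜ v x} := he
    rwa [hD.eq hv] at this
  obtain ⟨V, hV⟩ : ∃ V, V = {x | JoinedIn (D ∩ U2) p x} := ⟨_, rfl⟩
  have hVD : ∀ v ∈ V, v ∈ D := by rw [hV]; exact fun v hv => hv.mem.2.1
  have hVU : ∀ v ∈ V, v ∈ U2 := by rw [hV]; exact fun v hv => hv.mem.2.2
  have hVj : ∀ v ∈ V, ∀ w ∈ V, JoinedIn (D ∩ U2) v w := by
    rw [hV]; exact fun v hv w hw => JoinedIn.trans (JoinedIn.symm hv) hw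
  have hVC : ∀ v ∈ V, v ∉ frontier D := fun v hv => hD.disj (hVD v hv)
  have hVext : ∀ v ∈ V, ∀ e, JoinedIn (U2 ∩ (frontier D)ᶜ) v e → e ∈ V := by
    intro v hv e he
    have h1 : JoinedIn (D ∩ U2) v e := he.component.mono fun z hz =>
      ⟨hstay v (hVD v hv) z (JoinedIn.mono hz inter_subset_right), hz.mem.2.1⟩
    rw [hV] at hv ⊢
    exact JoinedIn.trans hv h1
  have hVC' : ∀ v ∈ V, ∀ w ∈ V, JoinedIn (frontier D)ᶜ v w := fun v hv w hw =>
    (hVj v hv w hw).mono fun z hz => hD.disj hz.1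
  have hspread : ∀ B, IsPreconnected B → B ⊆ frontier D → B ⊆ U2 → (B ∩ closure V).Nonempty →
      B ⊆ closure V := fun B h1 h2 h3 h4 => comp_spread hD hU2 hV h1 h2 h3 h4
  have hpV : p ∈ V := by rw [hV]; exact JoinedIn.refl ⟨hpD, hpU2⟩
  obtain ⟨w, hwU, hwC, hwV⟩ : ∃ w ∈ U1, w ∈ frontier D ∧ w ∈ closure V := by
    obtain ⟨x, hxU, hxD⟩ := not_subset.1 hUD
    obtain ⟨w, hw1, hw2⟩ := hU1p.inter_frontier_nonempty' (D := V) ⟨p, hpU, hpV⟩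
      ⟨x, hxU, fun h => hxD (hVD x h)⟩
    have h3 : w ∉ D ∩ U2 := by
      rw [hV] at hw2
      exact frontier_component (hD.1.inter hU2) p hw2
    have hwcl := frontier_subset_closure hw2
    refine ⟨w, hw1, ?_, hwcl⟩
    rw [hD.1.frontier_eq]
    exact ⟨closure_mono hVD hwcl, fun h => h3 ⟨h, hcl (subset_closure hw1)⟩⟩
  obtain ⟨c, hc, hc0⟩ := hD.2.2.exists_loop ht0C
  have hcC : ∀ t ∈ Icc (0:ℝ) 1, c t ∈ frontier D := fun t ht => hc.img ▸ mem_image_of_mem c ht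
  obtain ⟨T, hT⟩ : ∃ T, T = {t | t ∈ Icc (0:ℝ) 1 ∧ c t ∈ closure U1 ∩ closure V} := ⟨_, rfl⟩
  have hTc : IsCompact T := by
    have : IsClosed (Icc (0:ℝ) 1 ∩ c ⁻¹' (closure U1 ∩ closure V)) :=
      hc.cont.preimage_isClosed_of_isClosed isClosed_Icc (isClosed_closure.inter isClosed_closure)
    rw [hT]
    exact isCompact_Icc.of_isClosed_subset this inter_subset_left
  have hTn : T.Nonempty := by
    rw [← hc.img] at hwC
    obtain ⟨t, ht, rfl⟩ := hwC
    exact ⟨t, by rw [hT]; exact ⟨ht, subset_closure hwU, hwV⟩⟩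
  obtain ⟨u, huT, humin⟩ := hTc.exists_isLeast hTn
  obtain ⟨s, hsT, hsmax⟩ := hTc.exists_isGreatest hTn
  have hTm : ∀ t ∈ Icc (0:ℝ) 1, c t ∈ closure U1 → c t ∈ closure V → u ≤ t ∧ t ≤ s := by
    intro t h1 h2 h3
    have : t ∈ T := by rw [hT]; exact ⟨h1, h2, h3⟩
    exact ⟨humin this, hsmax this⟩
  rw [hT] at huT hsT
  obtain ⟨huI, huU, huV⟩ := huT
  obtain ⟨hsI, hsU, hsV⟩ := hsT
  have hus : u ≤ s := (hTm u huI huU huV).2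
  have hu0 : 0 < u := lt_of_le_of_ne huI.1 (fun e => ht0U (hcl (by rw [← hc0, e]; exact huU)))
  have hs1 : s < 1 := lt_of_le_of_ne hsI.2
    (fun e => ht0U (hcl (by rw [← hc0, hc.ends, ← e]; exact hsU)))
  obtain ⟨u1, hu1, hu1u, hu1U⟩ : ∃ u1, 0 < u1 ∧ u1 < u ∧ c '' Icc u1 u ⊆ U2 := by
    have h1 : c ⁻¹' U2 ∈ 𝓝[Icc 0 1] u := hc.cont u huI (hU2.mem_nhds (hcl huU))
    obtain ⟨ε, hε, hsub⟩ := Metric.mem_nhdsWithin_iff.1 h1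
    refine ⟨max (u / 2) (u - ε / 2), lt_max_of_lt_left (by linarith),
      max_lt (by linarith) (by linarith), ?_⟩
    rintro _ ⟨t, ht, rfl⟩
    have h2 := (le_max_left _ _).trans ht.1
    have h3 := (le_max_right _ _).trans ht.1
    refine hsub ⟨?_, by linarith, by linarith [ht.2, huI.2]⟩
    rw [mem_ball, Real.dist_eq, abs_lt]
    constructor <;> linarith [ht.2]
  obtain ⟨s1, hs11, hss1, hs1U⟩ : ∃ s1, s1 < 1 ∧ s < s1 ∧ c '' Icc s s1 ⊆ U2 := by
    have h1 : c ⁻¹' U2 ∈ 𝓝[Icc 0 1] s := hc.cont s hsI (hU2.mem_nhds (hcl hsU))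
    obtain ⟨ε, hε, hsub⟩ := Metric.mem_nhdsWithin_iff.1 h1
    refine ⟨min ((s + 1) / 2) (s + ε / 2), min_lt_of_left_lt (by linarith),
      lt_min (by linarith) (by linarith), ?_⟩
    rintro _ ⟨t, ht, rfl⟩
    have h2 := ht.2.trans (min_le_left _ _)
    have h3 := ht.2.trans (min_le_right _ _)
    refine hsub ⟨?_, by linarith [ht.1, hsI.1], by linarith⟩
    rw [mem_ball, Real.dist_eq, abs_lt]
    constructor <;> linarith [ht.1]
  have hsubI : ∀ {x y : ℝ}, 0 ≤ x → y ≤ 1 → Icc x y ⊆ Icc (0:ℝ) 1 := fun hx hy =>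
    Icc_subset_Icc hx hy
  have himC : ∀ {x y : ℝ}, 0 ≤ x → y ≤ 1 → c '' Icc x y ⊆ frontier D := fun hx hy => by
    rw [← hc.img]; exact image_mono (hsubI hx hy)
  have himp : ∀ {x y : ℝ}, 0 ≤ x → y ≤ 1 → IsPreconnected (c '' Icc x y) := fun hx hy =>
    isPreconnected_Icc.image c (hc.cont.mono (hsubI hx hy))
  have hu1V : c '' Icc u1 u ⊆ closure V := hspread _ (himp hu1.le huI.2) (himC hu1.le huI.2) hu1U
    ⟨c u, ⟨u, ⟨hu1u.le, le_rfl⟩, rfl⟩, huV⟩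
  have hs1V : c '' Icc s s1 ⊆ closure V := hspread _ (himp hsI.1 hs11.le) (himC hsI.1 hs11.le) hs1U
    ⟨c s, ⟨s, ⟨le_rfl, hss1.le⟩, rfl⟩, hsV⟩
  have hu1I : u1 ∈ Icc (0:ℝ) 1 := ⟨hu1.le, by linarith [huI.2]⟩
  have hs1I : s1 ∈ Icc (0:ℝ) 1 := ⟨by linarith [hsI.1], hs11.le⟩
  have cu1V : c u1 ∈ closure V := hu1V ⟨u1, ⟨le_rfl, hu1u.le⟩, rfl⟩
  have cs1V : c s1 ∈ closure V := hs1V ⟨s1, ⟨hss1.le, le_rfl⟩, rfl⟩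
  have cu1U : c u1 ∈ U2 := hu1U ⟨u1, ⟨le_rfl, hu1u.le⟩, rfl⟩
  have cs1U : c s1 ∈ U2 := hs1U ⟨s1, ⟨hss1.le, le_rfl⟩, rfl⟩
  have cu1n : c u1 ∉ closure U1 := fun h => by linarith [(hTm u1 hu1I h cu1V).1]
  have cs1n : c s1 ∉ closure U1 := fun h => by linarith [(hTm s1 hs1I h cs1V).2]
  obtain ⟨K, hK⟩ : ∃ K, K = (closure V ∩ closure U1) ∪ c '' Icc u s := ⟨_, rfl⟩
  have hKc : IsClosed K := by
    rw [hK]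
    refine (isClosed_closure.inter isClosed_closure).union ?_
    exact (isCompact_Icc.image_of_continuousOn (hc.cont.mono (hsubI huI.1 hsI.2))).isClosed
  have hfarK : ∀ t ∈ Icc (0:ℝ) 1, (t < u ∨ s < t) → c t ∉ K := by
    intro t ht htus
    rw [hK]
    rintro (⟨h1, h2⟩ | ⟨r, hr, he⟩)
    · have := hTm t ht h2 h1
      rcases htus with h | h <;> linarith
    · have := hc.inj t ht r ⟨by linarith [hr.1], by linarith [hr.2]⟩ he.symm
      rcases htus with h | h
      · linarith [hr.1]
      · linarith [hr.2]
  have hVK : ∀ v ∈ V, v ∉ closure U1 → v ∉ K := by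
    intro v hv hvU
    rw [hK]
    rintro (h | h)
    · exact hvU h.2
    · exact hVC v hv (himC huI.1 hsI.2 h)
  have hacc : ∀ t ∈ Icc (0:ℝ) 1, c t ∈ closure V → c t ∈ U2 → c t ∉ K →
      ∃ q ∈ V, JoinedIn ({c t} ∪ (V \ closure U1)) (c t) q ∧ q ∉ closure U1 := by
    intro t ht htV htU htK
    obtain ⟨q, ⟨hqV, hqO⟩, hqj⟩ := (hD.2.2.endH (hcC t ht)).access hC (O := U2 ∩ Kᶜ)
      ((hU2.inter hKc.isOpen_compl).mem_nhds ⟨htU, htK⟩) htV hVC'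
    have hVn : ∀ v ∈ V, v ∉ K → v ∉ closure U1 := fun v hv hvK hvU =>
      hvK (by rw [hK]; exact Or.inl ⟨subset_closure hv, hvU⟩)
    refine ⟨q, hqV, hqj.mono ?_, hVn q hqV hqO.2⟩
    rintro x (hx | hx)
    · exact Or.inl hx
    · right
      have hxV := hVext q hqV x (JoinedIn.mono hx fun z hz => ⟨hz.1.1, hz.2⟩)
      exact ⟨hxV, hVn x hxV hx.mem.2.1.2⟩
  have cs1K := hfarK s1 hs1I (Or.inr hss1)
  have cu1K := hfarK u1 hu1I (Or.inl hu1u)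
  obtain ⟨p', hp'V, hp'j, hp'n⟩ := hacc s1 hs1I cs1V cs1U cs1K
  obtain ⟨q', hq'V, hq'j, hq'n⟩ := hacc u1 hu1I cu1V cu1U cu1K
  have hAK : (frontier D ∪ U2ᶜ) ∩ K = c '' Icc u s := by
    apply Subset.antisymm
    · rintro x ⟨hx1, hx2⟩
      rw [hK] at hx2
      rcases hx2 with ⟨hxV, hxU⟩ | hx2
      · rcases hx1 with hx1 | hx1
        · rw [← hc.img] at hx1
          obtain ⟨t, ht, rfl⟩ := hx1
          exact ⟨t, hTm t ht hxU hxV, rfl⟩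
        · exact absurd (hcl hxU) hx1
      · exact hx2
    · intro x hx
      exact ⟨Or.inl (himC huI.1 hsI.2 hx), by rw [hK]; exact Or.inr hx⟩
  have hfarj : JoinedIn Kᶜ (c s1) (c u1) := by
    have hj := hc.jsplit hu1 (show u1 < s1 by linarith) hs11
    refine (hj.2.1.isPathConnected.joinedIn _ hj.2.1.right_mem _ hj.2.1.left_mem).mono ?_
    rintro _ (⟨t, ht, rfl⟩ | ⟨t, ht, rfl⟩)
    · exact hfarK t ⟨by linarith [ht.1, hs1I.1], ht.2⟩ (Or.inr (by linarith [ht.1]))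
    · exact hfarK t ⟨ht.1, by linarith [ht.2, hu1I.2]⟩ (Or.inl (by linarith [ht.2]))
  have hJ := MS.j1 (frontier D ∪ U2ᶜ) K (hC.union hU2.isClosed_compl) hKc
    (by rw [hAK]; exact himp huI.1 hsI.2) p' q'
    ((hVj p' hp'V q' hq'V).mono (by
      rintro x ⟨h1, h2⟩ (h | h)
      · exact hD.disj h1 h
      · exact h h2))
    (((hp'j.symm.mono (by
      rintro x (rfl | ⟨hx, hx2⟩)
      · exact cs1K
      · exact hVK x hx hx2)).trans hfarj).trans (hq'j.mono (by
      rintro x (rfl | ⟨hx, hx2⟩)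
      · exact cu1K
      · exact hVK x hx hx2)))
  have hJ2 : JoinedIn (V \ closure U1) p' q' := by
    refine hJ.component.mono ?_
    intro x hx
    have hxV : x ∈ V := hVext p' hp'V x (JoinedIn.mono hx (by
      intro z hz
      rw [compl_union, compl_union, compl_compl] at hz
      exact ⟨hz.1.2, hz.1.1⟩))
    refine ⟨hxV, fun hxU => hx.mem.2 (Or.inr ?_)⟩
    rw [hK]; exact Or.inl ⟨subset_closure hxV, hxU⟩
  have hne : c u1 ≠ c s1 := fun he => by
    have := hc.inj u1 hu1I s1 ⟨by linarith, hs11⟩ he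
    linarith
  obtain ⟨Q, hQs, hQ⟩ : ∃ Q ⊆ (V \ closure U1) ∪ {c u1, c s1}, IsArc Q (c u1) (c s1) := by
    refine JoinedIn.exists_arc ?_ hne
    refine ((hq'j.mono ?_).trans (hJ2.symm.mono ?_)).trans (hp'j.symm.mono ?_)
    · rintro x (rfl | hx)
      · right; left; rfl
      · left; exact hx
    · exact subset_union_left
    · rintro x (rfl | hx)
      · right; right; rfl
      · left; exact hx
  have hsp := hc.jsplit hu1 (show u1 < s1 by linarith) hs11
  obtain ⟨E1, E2, hE1, hE2, hdis, hun, hf1, hf2⟩ := hD.theta hsp hQ (by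
    intro x hx
    rcases hQs hx with h | h
    · exact Or.inl (hVD x h.1)
    · exact Or.inr h)
  have hQU : Q ⊆ U2 := by
    intro x hx
    rcases hQs hx with h | rfl | rfl
    · exact hVU x h.1
    · exact cu1U
    · exact cs1U
  have hQn : ∀ x ∈ Q, x ∉ closure U1 := by
    intro x hx
    rcases hQs hx with h | rfl | rfl
    · exact h.2
    · exact cu1n
    · exact cs1n
  have hE1D : E1 ⊆ D := fun x hx => (hun ▸ Or.inl hx : x ∈ D \ Q).1
  have hE2D : E2 ⊆ D := fun x hx => (hun ▸ Or.inr hx : x ∈ D \ Q).1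
  obtain ⟨Bu, hBuS, hBu⟩ := hcov ⟨hcC u huI, huU⟩
  obtain ⟨Bs, hBsS, hBs⟩ := hcov ⟨hcC s hsI, hsU⟩
  have hB0 : ∀ B ∈ S, c 0 ∉ B := fun B hB h => ht0U (hc0 ▸ (hS B hB).2.2 h)
  refine .split D _ _ _ _ Q E1 E2 hD hsp hQ (by
    intro x hx
    rcases hQs hx with h | h
    · exact Or.inl (hVD x h.1)
    · exact Or.inr h) hE1 hE2 hdis hun hf1 hf2 ?_ ?_
  · by_cases hboth : ∃ B ∈ S, c u ∈ B ∧ c s ∈ B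
    · obtain ⟨B, hBS, hB1, hB2⟩ := hboth
      refine .leaf _ hE1 (Or.inl ?_)
      rw [hf1]
      refine union_subset hQU ?_
      rintro _ ⟨t, ht, rfl⟩
      by_cases h1 : t ≤ u
      · exact hu1U ⟨t, ⟨ht.1, h1⟩, rfl⟩
      by_cases h2 : s ≤ t
      · exact hs1U ⟨t, ⟨h2, ht.2⟩, rfl⟩
      exact (hS B hBS).2.2 (((hc.ord (hS B hBS).1 (hS B hBS).2.1 (hB0 B hBS)).out ⟨huI, hB1⟩
        ⟨hsI, hB2⟩ ⟨(not_le.1 h1).le, (not_le.1 h2).le⟩).2)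
    · have hBne : Bu ≠ Bs := fun he => hboth ⟨Bu, hBuS, hBu, he ▸ hBs⟩
      set N := c '' Icc u1 s1 with hN
      have hpre : ∀ B ∈ S, IsPreconnected (B ∩ N) := fun B hB =>
        hc.inter_pre (hS B hB).1 (hS B hB).2.1 (hB0 B hB) hu1.le hs11.le
      obtain ⟨M, hM⟩ : ∃ M, M = ((((Bs ∩ N) ∪ c '' Icc s s1) ∪ Q) ∪ c '' Icc u1 u) ∪ (Bu ∩ N) :=
        ⟨_, rfl⟩
      have hNu : c u ∈ N := ⟨u, ⟨hu1u.le, by linarith⟩, rfl⟩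
      have hNs : c s ∈ N := ⟨s, ⟨by linarith, hss1.le⟩, rfl⟩
      have hMp : IsPreconnected M := by
        rw [hM]
        have m1 := (hpre Bs hBsS).union (c s) (⟨hBs, hNs⟩ : c s ∈ Bs ∩ N)
          (⟨s, ⟨le_rfl, hss1.le⟩, rfl⟩ : c s ∈ c '' Icc s s1)
          (himp hsI.1 hs11.le (x := s) (y := s1))
        have m2 := m1.union (c s1) (Or.inr ⟨s1, ⟨hss1.le, le_rfl⟩, rfl⟩) hQ.right_mem
          hQ.isPreconnected
        have m3 := m2.union (c u1) (Or.inr hQ.left_mem)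
          (⟨u1, ⟨le_rfl, hu1u.le⟩, rfl⟩ : c u1 ∈ c '' Icc u1 u)
          (himp hu1.le huI.2 (x := u1) (y := u))
        exact m3.union (c u) (Or.inr ⟨u, ⟨hu1u.le, le_rfl⟩, rfl⟩) ⟨hBu, hNu⟩ (hpre Bu hBuS)
      have hMf : M ⊆ Q ∪ N := by
        rw [hM]
        rintro x ((((hx | hx) | hx) | hx) | hx)
        · exact Or.inr hx.2
        · exact Or.inr (image_mono (Icc_subset_Icc (by linarith) le_rfl) hx)
        · exact Or.inl hx
        · exact Or.inr (image_mono (Icc_subset_Icc le_rfl (by linarith)) hx)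
        · exact Or.inr hx.2
      have hMU : M ⊆ U2 := by
        rw [hM]
        rintro x ((((hx | hx) | hx) | hx) | hx)
        · exact (hS Bs hBsS).2.2 hx.1
        · exact hs1U hx
        · exact hQU hx
        · exact hu1U hx
        · exact (hS Bu hBuS).2.2 hx.1
      have hfin : (S \ {Bu, Bs}).Finite := hSf.subset sdiff_subset
      refine ih _ ?_ E1 (insert M ((fun B => B ∩ N) '' (S \ {Bu, Bs}))) hE1
        (fun h => hUD (h.trans hE1D)) ((hfin.image _).insert _) rfl ?_ ?_
      · have n1 := ncard_insert_le M ((fun B => B ∩ N) '' (S \ {Bu, Bs}))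
        have n2 := ncard_image_le (f := fun B => B ∩ N) hfin
        have n3 : ({Bu, Bs} : Set (Set X)) ⊆ S := by
          rintro B (rfl | rfl)
          · exact hBuS
          · exact hBsS
        have n4 := ncard_sdiff_add_ncard_of_subset n3 hSf
        rw [ncard_pair hBne] at n4
        omega
      · rintro B (rfl | ⟨B', ⟨hB', -⟩, rfl⟩)
        · exact ⟨hMp, by rw [hf1]; exact hMf, hMU⟩
        · refine ⟨hpre B' hB', ?_, inter_subset_left.trans (hS B' hB').2.2⟩
          rw [hf1]
          exact inter_subset_right.trans subset_union_right
      · rintro x ⟨hx1, hx2⟩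
        rw [hf1] at hx1
        rcases hx1 with hx1 | hx1
        · exact absurd hx2 (hQn x hx1)
        have hxC : x ∈ frontier D := himC hu1.le hs11.le hx1
        obtain ⟨B, hBS, hxB⟩ := hcov ⟨hxC, hx2⟩
        by_cases hBB : B = Bu ∨ B = Bs
        · refine ⟨M, Or.inl rfl, ?_⟩
          rw [hM]
          rcases hBB with rfl | rfl
          · exact Or.inr ⟨hxB, hx1⟩
          · exact Or.inl (Or.inl (Or.inl (Or.inl ⟨hxB, hx1⟩)))
        · exact ⟨B ∩ N, Or.inr ⟨B, ⟨hBS, hBB⟩, rfl⟩, hxB, hx1⟩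
  · set F := c '' Icc s1 1 ∪ c '' Icc 0 u1 with hF
    obtain ⟨S2, hS2⟩ : ∃ S2, S2 = {B ∈ S | Disjoint B (closure V) ∧ B ⊆ F} := ⟨_, rfl⟩
    have hS2S : S2 ⊆ S := by rw [hS2]; exact fun B hB => hB.1
    refine ih _ ?_ E2 S2 hE2 (fun h => hUD (h.trans hE2D)) (hSf.subset hS2S) rfl ?_ ?_
    · rw [← hSn]
      apply ncard_lt_ncard _ hSf
      refine ⟨hS2S, fun h => ?_⟩
      have := h hBuS
      rw [hS2] at this
      exact disjoint_left.1 this.2.1 hBu huV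
    · intro B hB
      rw [hS2] at hB
      refine ⟨(hS B hB.1).1, ?_, (hS B hB.1).2.2⟩
      rw [hf2]
      exact hB.2.2.trans subset_union_right
    · rintro x ⟨hx1, hx2⟩
      rw [hf2] at hx1
      rcases hx1 with hx1 | hx1
      · exact absurd hx2 (hQn x hx1)
      have hxV : x ∉ closure V := by
        intro hxV
        rcases hx1 with ⟨t, ht, rfl⟩ | ⟨t, ht, rfl⟩
        · have := hTm t ⟨by linarith [ht.1, hs1I.1], ht.2⟩ hx2 hxV
          linarith [ht.1]
        · have := hTm t ⟨ht.1, by linarith [ht.2, hu1I.2]⟩ hx2 hxV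
          linarith [ht.2]
      have hxC : x ∈ frontier D := hsp.2.2.2 ▸ Or.inr hx1
      obtain ⟨B, hBS, hxB⟩ := hcov ⟨hxC, hx2⟩
      have hBd : Disjoint B (closure V) := by
        rw [disjoint_iff_inter_eq_empty, ← not_nonempty_iff_eq_empty]
        intro hne
        exact hxV (hspread B (hS B hBS).1 (hS B hBS).2.1 (hS B hBS).2.2 hne hxB)
      refine ⟨B, ?_, hxB⟩
      rw [hS2]
      refine ⟨hBS, hBd, ?_⟩
      rcases isPreconnected_iff_subset_of_disjoint_closed.1 (hS B hBS).1 _ _ hsp.1.isClosed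
        hsp.2.1.isClosed (by rw [hsp.2.2.2]; exact (hS B hBS).2.1) (by
          apply eq_empty_of_forall_notMem
          rintro z ⟨hzB, hz⟩
          rcases hsp.2.2.1 hz with rfl | rfl
          · exact disjoint_left.1 hBd hzB cu1V
          · exact disjoint_left.1 hBd hzB cs1V) with h | h
      · exfalso
        rcases hsp.2.2.1 ⟨h hxB, hx1⟩ with rfl | rfl
        · exact hxV cu1V
        · exact hxV cs1V
      · exact h

end ms


section ms
variable {X : Type} [MetricSpace X] [MS X]

lemma JDom.stay {D : Set X} (hD : JDom D) {v e : X} (hv : v ∈ D)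
    (he : JoinedIn (frontier D)ᶜ v e) : e ∈ D := by
  have : e ∈ {x | JoinedIn (frontier D)ᶜ v x} := he
  rwa [hD.eq hv] at this

lemma JDom.access {D : Set X} (hD : JDom D) {a : X} (ha : a ∈ frontier D) {O : Set X}
    (hO : O ∈ 𝓝 a) : ∃ p ∈ D ∩ O, JoinedIn ({a} ∪ (D ∩ O)) a p := by
  obtain ⟨p, hp, hj⟩ := (hD.2.2.endH ha).access isClosed_frontier hO
    (frontier_subset_closure ha) (fun p hp q hq => (hD.joined hp hq).mono fun z hz => hD.disj hz)
  refine ⟨p, hp, hj.mono ?_⟩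
  rintro x (hx | hx)
  · exact Or.inl hx
  · exact Or.inr ⟨hD.stay hp.1 (JoinedIn.mono hx inter_subset_right), hx.mem.2.1⟩

lemma JDom.presplit {D U1 : Set X} (hD : JDom D) (hU : IsOpen U1) (hUp : IsPreconnected U1)
    (hUn : U1.Nonempty) (hUD : U1 ⊆ D) : ∃ a b A1 A2 P, JSplit (frontier D) a b A1 A2 ∧
      IsArc P a b ∧ P ⊆ D ∪ {a, b} ∧ (P ∩ U1).Nonempty := by
  obtain ⟨x, hx⟩ := hUn
  obtain ⟨a, ha⟩ := hD.2.2.nonempty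
  obtain ⟨b, hb, hba⟩ := hD.2.2.exists_ne a
  have hxa : a ≠ x := fun h => hD.disj (hUD hx) (h ▸ ha)
  obtain ⟨p, hp, hpj⟩ := hD.access ha univ_mem
  obtain ⟨R, hRs, hR⟩ : ∃ R ⊆ {a} ∪ D, IsArc R a x := by
    refine JoinedIn.exists_arc ?_ hxa
    refine (hpj.mono ?_).trans ((hD.joined hp.1 (hUD hx)).mono subset_union_right)
    exact union_subset_union_right _ inter_subset_left
  have hbR : b ∉ R := by
    intro h
    rcases hRs h with h | h
    · exact hba h
    · exact hD.disj h hb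
  obtain ⟨y, hyU, hyR⟩ : ∃ y ∈ U1, y ∉ R := by
    by_contra! hh
    have : x ∈ interior R := mem_interior.2 ⟨U1, hh, hU, hx⟩
    rw [hR.dense_compl] at this
    exact this
  obtain ⟨q, ⟨hqD, hqR⟩, hqj⟩ := hD.access hb (hR.isClosed.isOpen_compl.mem_nhds hbR)
  have hqy : JoinedIn (D \ R) q y := by
    have hint : frontier D ∩ R = {a} := by
      ext z
      constructor
      · rintro ⟨h1, h2⟩
        rcases hRs h2 with h | h
        · exact h
        · exact absurd h1 (hD.disj h)
      · rintro rfl; exact ⟨ha, hR.left_mem⟩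
    have := MS.j1 (frontier D) R isClosed_frontier hR.isClosed
      (by rw [hint]; exact isPreconnected_singleton) q y
      ((hD.joined hqD (hUD hyU)).mono fun z hz => hD.disj hz) (hR.joinedIn_compl hqR hyR)
    refine this.component.mono fun z hz => ⟨?_, ?_⟩
    · exact hD.stay hqD (JoinedIn.mono hz (compl_subset_compl.2 subset_union_left))
    · exact fun h => hz.mem.2 (Or.inr h)
  have hall : JoinedIn (({b} ∪ (D \ R)) ∪ U1) b x := by
    refine ((hqj.mono ?_).trans (hqy.mono ?_)).trans
      ((joinedIn_of_preconnected hU hUp Subset.rfl hyU hx).mono subset_union_right)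
    · rintro z (h | h)
      · exact Or.inl (Or.inl h)
      · exact Or.inl (Or.inr h)
    · rintro z h
      exact Or.inl (Or.inr h)
  obtain ⟨r, ⟨hrR, hrT⟩, hrj⟩ := hall.first_hit hR.isClosed hR.right_mem
  have hrU : r ∈ U1 := by
    rcases hrT with (h | h) | h
    · rw [h] at hrR; exact absurd hrR hbR
    · exact absurd hrR h.2
    · exact h
  have hbr : b ≠ r := fun h => hbR (h ▸ hrR)
  have har : r ≠ a := fun h => hD.disj (hUD hrU) (h ▸ ha)
  obtain ⟨S, hSs, hS⟩ := hrj.exists_arc hbr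
  obtain ⟨R1, hR1, hR1R⟩ : ∃ R1, IsArc R1 a r ∧ R1 ⊆ R := by
    by_cases hrx : r = x
    · rw [hrx]; exact ⟨R, hR, Subset.rfl⟩
    · obtain ⟨P1, P2, h1, h2, h3, h4⟩ := hR.split hrR har hrx
      exact ⟨P1, h1, h3 ▸ subset_union_left⟩
  obtain ⟨A1, A2, hs⟩ := hD.2.2.split ha hb hba.symm
  refine ⟨a, b, A1, A2, R1 ∪ S, hs, hR1.trans hS.symm ?_, ?_, r, Or.inl hR1.right_mem, hrU⟩
  · rintro z ⟨h1, h2⟩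
    rcases hSs h2 with h | h
    · exact absurd (hR1R h1) h.2
    · exact h
  · rintro z (h | h)
    · rcases hRs (hR1R h) with h | h
      · right; left; exact h
      · left; exact h
    · rcases hSs h with ⟨(h | h) | h, -⟩ | h
      · right; right; exact h
      · left; exact h.1
      · left; exact hUD h
      · left; rw [h]; exact hUD hrU

lemma cut_one {U1 U2 : Set X} (hU1 : IsOpen U1) (hU1p : IsPreconnected U1)
    (hU2 : IsOpen U2) (hcl : closure U1 ⊆ U2) {D : Set X} (hD : JDom D) :
    Cut (fun E => frontier E ⊆ U2 ∨ Disjoint E U1) D := by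
  have key : ∀ E, JDom E → ¬ U1 ⊆ E → Cut (fun E => frontier E ⊆ U2 ∨ Disjoint E U1) E := by
    intro E hE hUE
    obtain ⟨t0, ht0⟩ := hE.2.2.nonempty
    obtain ⟨c, hc, -⟩ := hE.2.2.exists_loop ht0
    obtain ⟨S, h1, h2, h3⟩ := hc.finite_cover hU2 isClosed_closure hcl
    exact cut_claim hU1p hU2 hcl _ E S hE hUE h1 rfl h2 h3
  by_cases hUD : U1 ⊆ D
  · by_cases hUn : U1.Nonempty
    · obtain ⟨a, b, A1, A2, P, hs, hP, hPD, z, hzP, hzU⟩ := hD.presplit hU1 hU1p hUn hUD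
      obtain ⟨E1, E2, h1, h2, h3, h4, h5, h6⟩ := hD.theta hs hP hPD
      refine .split D a b A1 A2 P E1 E2 hD hs hP hPD h1 h2 h3 h4 h5 h6 (key E1 h1 ?_) (key E2 h2 ?_)
      · exact fun h => (h4 ▸ Or.inl (h hzU) : z ∈ D \ P).2 hzP
      · exact fun h => (h4 ▸ Or.inr (h hzU) : z ∈ D \ P).2 hzP
    · rw [not_nonempty_iff_eq_empty] at hUn
      exact .leaf D hD (Or.inr (by rw [hUn]; exact disjoint_bot_right))
  · exact key D hD hUD

lemma cut_small {D : Set X} (hD : JDom D) {ε : ℝ} (hε : 0 < ε) :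
    Cut (fun E => ∃ x, E ⊆ ball x ε) D := by
  have hloc : ∀ x : X, ∃ U1 U2 : Set X, IsOpen U1 ∧ IsPreconnected U1 ∧ x ∈ U1 ∧ IsOpen U2 ∧
      closure U1 ⊆ U2 ∧ ∀ E ⊆ D, frontier E ⊆ U2 → E ⊆ ball x ε := by
    intro x
    obtain ⟨z, hz, hzx⟩ := hD.2.2.exists_ne x
    obtain ⟨M, M1, M2, M3, M4⟩ := exists_preconnected_compact (K := (ball x ε)ᶜ ∪ {z})
      (isOpen_compl_singleton (x := x)) (MS.nocut x)
      (isOpen_ball.isClosed_compl.isCompact.union isCompact_singleton) (by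
        rintro y (hy | rfl)
        · rintro rfl; exact hy (mem_ball_self hε)
        · exact hzx)
    have hxM : x ∈ Mᶜ := fun h => M4 h rfl
    obtain ⟨O, hO, hOc, hOM⟩ := exists_mem_nhds_isClosed_subset (M1.isClosed.isOpen_compl.mem_nhds hxM)
    obtain ⟨V, hVO, hV1, hV2, hV3⟩ := exists_open_connected hO
    refine ⟨V, Mᶜ, hV1, hV2, hV3, M1.isClosed.isOpen_compl, (closure_minimal hVO hOc).trans hOM, ?_⟩
    intro E hED hEf
    have hdis : ∀ y ∈ M, y ∉ E := by
      intro y hyM hyE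
      have := M2.subset_of_frontier (D := E) ⟨y, hyM, hyE⟩
        (disjoint_left.2 fun w hw hw2 => hEf hw2 hw)
      exact hD.disj (hED (this (M3 (Or.inr rfl)))) hz
    intro y hy
    by_contra hyb
    exact hdis y (M3 (Or.inl hyb)) hy
  choose U1 U2 h1 h2 h3 h4 h5 h6 using hloc
  obtain ⟨F, hF⟩ := (isCompact_univ (X := X)).elim_finite_subcover U1 h1
    (fun x _ => mem_iUnion.2 ⟨x, h3 x⟩)
  have key : ∀ F : Finset X, Cut (fun E => (∃ x, E ⊆ ball x ε) ∨ ∀ x ∈ F, Disjoint E (U1 x)) D := by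
    intro F
    classical
    induction F using Finset.induction_on with
    | empty => exact .leaf D hD (Or.inr (by simp))
    | insert a F _ ih =>
      refine ih.bind fun E hED hE hG => ?_
      rcases hG with hG | hG
      · exact .leaf E hE (Or.inl hG)
      refine (cut_one (h1 a) (h2 a) (h4 a) (h5 a) hE).bind fun E' hE'E hE' hG' => .leaf E' hE' ?_
      rcases hG' with hG' | hG'
      · exact Or.inl ⟨a, h6 a E' (hE'E.trans hED) hG'⟩
      · right
        intro x hx
        rw [Finset.mem_insert] at hx
        rcases hx with rfl | hx
        · exact hG'
        · exact (hG x hx).mono_left hE'E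
  refine (key F).bind fun E _ hE hG => .leaf E hE ?_
  rcases hG with hG | hG
  · exact hG
  · exfalso
    obtain ⟨e, he⟩ := hE.2.1.nonempty
    obtain ⟨x, hx, hxe⟩ := mem_iUnion₂.1 (hF (mem_univ e))
    exact disjoint_left.1 (hG x hx) he hxe

end ms


structure Half {X Y : Type} [MetricSpace X] [MetricSpace Y] (Γ : Set (X × Y))
    (F : Set (Set X × Set Y)) : Prop where
  func : ∀ x y y', (x, y) ∈ Γ → (x, y') ∈ Γ → y = y'
  jd : ∀ D D', (D, D') ∈ F → JDom D
  disj : ∀ D D' E E', (D, D') ∈ F → (E, E') ∈ F → (D, D') ≠ (E, E') → Disjoint D E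
  cov : ∀ x, ∃ D D', (D, D') ∈ F ∧ x ∈ closure D
  tot : ∀ D D', (D, D') ∈ F → ∀ x ∈ frontier D, ∃ y ∈ frontier D', (x, y) ∈ Γ
  off : ∀ D D', (D, D') ∈ F → ∀ x y, (x, y) ∈ Γ → x ∉ D

structure St {X Y : Type} [MetricSpace X] [MetricSpace Y] (Γ : Set (X × Y))
    (F : Set (Set X × Set Y)) : Prop where
  fin : F.Finite
  cpt : IsCompact Γ
  h1 : Half Γ F
  h2 : Half (Prod.swap ⁻¹' Γ) (Prod.swap ⁻¹' F)

section st
variable {X Y : Type} [MetricSpace X] [MetricSpace Y]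

lemma St.swap {Γ : Set (X × Y)} {F : Set (Set X × Set Y)} (h : St Γ F) :
    St (Prod.swap ⁻¹' Γ) (Prod.swap ⁻¹' F) :=
  ⟨h.fin.preimage Prod.swap_injective.injOn, by
    rw [← image_swap_eq_preimage_swap]; exact h.cpt.image continuous_swap, h.h2, h.h1⟩

lemma graph_cont {Γ : Set (X × Y)} (hΓ : IsCompact Γ)
    (hfun : ∀ x y y', (x, y) ∈ Γ → (x, y') ∈ Γ → y = y') {s : Set X} {φ : X → Y}
    (hφ : ∀ x ∈ s, (x, φ x) ∈ Γ) : ContinuousOn φ s := by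
  rw [continuousOn_iff_isClosed]
  intro t ht
  refine ⟨Prod.fst '' (Γ ∩ Prod.snd ⁻¹' t),
    ((hΓ.inter_right (ht.preimage continuous_snd)).image continuous_fst).isClosed, ?_⟩
  ext x
  constructor
  · rintro ⟨h1, h2⟩
    exact ⟨⟨(x, φ x), ⟨hφ x h2, h1⟩, rfl⟩, h2⟩
  · rintro ⟨⟨⟨x', y⟩, ⟨h1, h2⟩, rfl⟩, h3⟩
    refine ⟨?_, h3⟩
    have := hfun _ _ _ h1 (hφ _ h3)
    change φ x' ∈ t
    rw [← this]; exact h2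

def arcG (γ : ℝ → X) (γ' : ℝ → Y) : Set (X × Y) := (fun t => (γ t, γ' t)) '' Icc (0:ℝ) 1

lemma Half.split {Γ : Set (X × Y)} {F : Set (Set X × Set Y)} (h : Half Γ F)
    {D E1 E2 A1 A2 : Set X} {D' E1' E2' A1' A2' : Set Y} (hD : (D, D') ∈ F)
    {γ : ℝ → X} {γ' : ℝ → Y} (hi : InjOn γ (Icc 0 1))
    (hP : γ '' Icc 0 1 ⊆ D ∪ {γ 0, γ 1}) (j1 : JDom E1) (j2 : JDom E2) (hE : Disjoint E1 E2)
    (hEE : E1 ∪ E2 = D \ (γ '' Icc 0 1)) (f1 : frontier E1 = γ '' Icc 0 1 ∪ A1)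
    (f2 : frontier E2 = γ '' Icc 0 1 ∪ A2)
    (f1' : frontier E1' = γ' '' Icc 0 1 ∪ A1') (f2' : frontier E2' = γ' '' Icc 0 1 ∪ A2')
    (t1 : ∀ x ∈ A1, ∃ y ∈ A1', (x, y) ∈ Γ) (t2 : ∀ x ∈ A2, ∃ y ∈ A2', (x, y) ∈ Γ)
    (g0 : (γ 0, γ' 0) ∈ Γ) (g1 : (γ 1, γ' 1) ∈ Γ) :
    Half (Γ ∪ arcG γ γ') ((F \ {(D, D')}) ∪ {(E1, E1'), (E2, E2')}) := by
  have m0 : (0:ℝ) ∈ Icc (0:ℝ) 1 := by simp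
  have m1 : (1:ℝ) ∈ Icc (0:ℝ) 1 := by simp
  have s1 : ∀ x ∈ E1, x ∈ D ∧ x ∉ γ '' Icc 0 1 := fun x hx => (hEE ▸ Or.inl hx : x ∈ D \ _)
  have s2 : ∀ x ∈ E2, x ∈ D ∧ x ∉ γ '' Icc 0 1 := fun x hx => (hEE ▸ Or.inr hx : x ∈ D \ _)
  have old : ∀ t ∈ Icc (0:ℝ) 1, ∀ y, (γ t, y) ∈ Γ → y = γ' t := by
    intro t ht y hy
    rcases hP ⟨t, ht, rfl⟩ with h' | h' | h'
    · exact absurd h' (h.off _ _ hD _ _ hy)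
    · rw [h'] at hy; rw [hi ht m0 h']; exact h.func _ _ _ hy g0
    · rw [h'] at hy; rw [hi ht m1 h']; exact h.func _ _ _ hy g1
  have dj : ∀ E E', (E, E') ∈ F \ {(D, D')} → Disjoint E D := fun E E' hE =>
    h.disj _ _ _ _ hE.1 hD hE.2
  refine ⟨?_, ?_, ?_, ?_, ?_, ?_⟩
  · rintro x y y' (h1 | ⟨t, ht, h1⟩) (h2 | ⟨s, hs, h2⟩)
    · exact h.func _ _ _ h1 h2
    · obtain ⟨rfl, rfl⟩ := Prod.mk.inj h2
      exact old s hs _ h1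
    · obtain ⟨rfl, rfl⟩ := Prod.mk.inj h1
      exact (old t ht _ h2).symm
    · obtain ⟨rfl, rfl⟩ := Prod.mk.inj h1
      obtain ⟨h3, rfl⟩ := Prod.mk.inj h2
      rw [hi hs ht h3]
  · rintro E E' (hE | hE | hE)
    · exact h.jd _ _ hE.1
    · obtain ⟨rfl, rfl⟩ := Prod.mk.inj hE; exact j1
    · obtain ⟨rfl, rfl⟩ := Prod.mk.inj hE; exact j2
  · rintro G G' K K' (hG | hG | hG) (hK | hK | hK) hne
    · exact h.disj _ _ _ _ hG.1 hK.1 hne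
    · obtain ⟨rfl, rfl⟩ := Prod.mk.inj hK
      exact (dj _ _ hG).mono_right fun x hx => (s1 x hx).1
    · obtain ⟨rfl, rfl⟩ := Prod.mk.inj hK
      exact (dj _ _ hG).mono_right fun x hx => (s2 x hx).1
    · obtain ⟨rfl, rfl⟩ := Prod.mk.inj hG
      exact ((dj _ _ hK).mono_right fun x hx => (s1 x hx).1).symm
    · exact absurd (hG.trans hK.symm) hne
    · obtain ⟨rfl, rfl⟩ := Prod.mk.inj hG
      obtain ⟨rfl, rfl⟩ := Prod.mk.inj hK
      exact hE
    · obtain ⟨rfl, rfl⟩ := Prod.mk.inj hG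
      exact ((dj _ _ hK).mono_right fun x hx => (s2 x hx).1).symm
    · obtain ⟨rfl, rfl⟩ := Prod.mk.inj hG
      obtain ⟨rfl, rfl⟩ := Prod.mk.inj hK
      exact hE.symm
    · exact absurd (hG.trans hK.symm) hne
  · intro x
    obtain ⟨K, K', hK, hx⟩ := h.cov x
    by_cases he : (K, K') = (D, D')
    · obtain ⟨rfl, rfl⟩ := Prod.mk.inj he
      have : K ⊆ closure E1 ∪ closure E2 := by
        intro z hz
        by_cases hzP : z ∈ γ '' Icc 0 1
        · exact Or.inl (frontier_subset_closure (f1 ▸ Or.inl hzP))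
        · rcases (hEE ▸ ⟨hz, hzP⟩ : z ∈ E1 ∪ E2) with h' | h'
          · exact Or.inl (subset_closure h')
          · exact Or.inr (subset_closure h')
      rcases closure_minimal this (isClosed_closure.union isClosed_closure) hx with h' | h'
      · exact ⟨E1, E1', by simp, h'⟩
      · exact ⟨E2, E2', by simp, h'⟩
    · exact ⟨K, K', Or.inl ⟨hK, he⟩, hx⟩
  · rintro E E' (hE | hE | hE) x hx
    · obtain ⟨y, h1, h2⟩ := h.tot _ _ hE.1 x hx
      exact ⟨y, h1, Or.inl h2⟩
    · obtain ⟨rfl, rfl⟩ := Prod.mk.inj hE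
      rw [f1] at hx; rw [f1']
      rcases hx with ⟨t, ht, rfl⟩ | hx
      · exact ⟨γ' t, Or.inl ⟨t, ht, rfl⟩, Or.inr ⟨t, ht, rfl⟩⟩
      · obtain ⟨y, h1, h2⟩ := t1 x hx
        exact ⟨y, Or.inr h1, Or.inl h2⟩
    · obtain ⟨rfl, rfl⟩ := Prod.mk.inj hE
      rw [f2] at hx; rw [f2']
      rcases hx with ⟨t, ht, rfl⟩ | hx
      · exact ⟨γ' t, Or.inl ⟨t, ht, rfl⟩, Or.inr ⟨t, ht, rfl⟩⟩
      · obtain ⟨y, h1, h2⟩ := t2 x hx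
        exact ⟨y, Or.inr h1, Or.inl h2⟩
  · rintro E E' (hE | hE | hE) x y (hx | ⟨t, ht, hx⟩) hxE
    · exact h.off _ _ hE.1 _ _ hx hxE
    · obtain ⟨rfl, rfl⟩ := Prod.mk.inj hx
      rcases hP ⟨t, ht, rfl⟩ with h' | h' | h'
      · exact disjoint_left.1 (dj _ _ hE) hxE h'
      · rw [h'] at hxE; exact h.off _ _ hE.1 _ _ g0 hxE
      · rw [h'] at hxE; exact h.off _ _ hE.1 _ _ g1 hxE
    · obtain ⟨rfl, rfl⟩ := Prod.mk.inj hE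
      exact h.off _ _ hD _ _ hx (s1 x hxE).1
    · obtain ⟨rfl, rfl⟩ := Prod.mk.inj hE
      obtain ⟨rfl, rfl⟩ := Prod.mk.inj hx
      exact (s1 _ hxE).2 ⟨t, ht, rfl⟩
    · obtain ⟨rfl, rfl⟩ := Prod.mk.inj hE
      exact h.off _ _ hD _ _ hx (s2 x hxE).1
    · obtain ⟨rfl, rfl⟩ := Prod.mk.inj hE
      obtain ⟨rfl, rfl⟩ := Prod.mk.inj hx
      exact (s2 _ hxE).2 ⟨t, ht, rfl⟩

lemma arcG_compact {γ : ℝ → X} {γ' : ℝ → Y} (h : ContinuousOn γ (Icc 0 1))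
    (h' : ContinuousOn γ' (Icc 0 1)) : IsCompact (arcG γ γ') :=
  isCompact_Icc.image_of_continuousOn (h.prodMk h')

lemma arcG_swap (γ : ℝ → X) (γ' : ℝ → Y) : Prod.swap ⁻¹' (arcG γ γ') = arcG γ' γ := by
  rw [← image_swap_eq_preimage_swap, arcG, arcG, image_image]; rfl

lemma St.split [MS Y] {Γ : Set (X × Y)} {F : Set (Set X × Set Y)} (h : St Γ F)
    {D E1 E2 A1 A2 P : Set X} {D' : Set Y} {a b : X} (hD : (D, D') ∈ F)
    (hs : JSplit (frontier D) a b A1 A2) (hPa : IsArc P a b)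
    (hP : P ⊆ D ∪ {a, b}) (j1 : JDom E1) (j2 : JDom E2) (hE : Disjoint E1 E2)
    (hEE : E1 ∪ E2 = D \ P) (f1 : frontier E1 = P ∪ A1) (f2 : frontier E2 = P ∪ A2) :
    ∃ Γ' E1' E2', E1' ⊆ D' ∧ E2' ⊆ D' ∧
      St Γ' ((F \ {(D, D')}) ∪ {(E1, E1'), (E2, E2')}) := by
  obtain ⟨φ, hφ⟩ : ∃ φ : X → Y, ∀ x ∈ frontier D, φ x ∈ frontier D' ∧ (x, φ x) ∈ Γ := by
    have := h.h1.tot _ _ hD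
    choose! φ h1 h2 using this
    exact ⟨φ, fun x hx => ⟨h1 x hx, h2 x hx⟩⟩
  have hc : ContinuousOn φ (frontier D) := graph_cont h.cpt h.h1.func fun x hx => (hφ x hx).2
  have hi : InjOn φ (frontier D) := by
    intro x hx z hz hxz
    have h1 := (hφ x hx).2
    rw [hxz] at h1
    exact h.h2.func _ _ _ h1 (hφ z hz).2
  obtain ⟨B1, B2, B3, B4⟩ := hs
  have k1 : A1 ⊆ frontier D := B4 ▸ subset_union_left
  have k2 : A2 ⊆ frontier D := B4 ▸ subset_union_right
  have ha : a ∈ frontier D := k1 B1.left_mem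
  have hb : b ∈ frontier D := k1 B1.right_mem
  have him : φ '' frontier D = frontier D' := by
    apply Subset.antisymm
    · rintro _ ⟨x, hx, rfl⟩; exact (hφ x hx).1
    · intro y hy
      obtain ⟨x, hx, hxy⟩ := h.h2.tot D' D hD y hy
      exact ⟨x, hx, (h.h1.func _ _ _ hxy (hφ x hx).2).symm⟩
  have hs' : JSplit (frontier D') (φ a) (φ b) (φ '' A1) (φ '' A2) := by
    refine ⟨B1.image (hc.mono k1) (hi.mono k1), B2.image (hc.mono k2) (hi.mono k2), ?_, ?_⟩
    · rw [← hi.image_inter k1 k2, ← image_pair]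
      exact image_mono B3
    · rw [← image_union, B4, him]
  have jD' : JDom D' := h.h2.jd D' D hD
  obtain ⟨P', hP'a, hP'⟩ := jD'.crosscut (hφ a ha).1 (hφ b hb).1 (fun e => hPa.ne (hi ha hb e))
  obtain ⟨E1', E2', j1', j2', hE', hEE', f1', f2'⟩ := jD'.theta hs' hP'a hP'
  have d1 : E1' ⊆ D' := fun x hx => (hEE' ▸ Or.inl hx : x ∈ D' \ P').1
  have d2 : E2' ⊆ D' := fun x hx => (hEE' ▸ Or.inr hx : x ∈ D' \ P').1
  obtain ⟨γ, c1, c2, rfl, rfl, rfl⟩ := hPa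
  obtain ⟨γ', c1', c2', e0, e1, rfl⟩ := hP'a
  rw [← e0, ← e1] at hP'
  have g0 : (γ 0, γ' 0) ∈ Γ := by rw [e0]; exact (hφ _ ha).2
  have g1 : (γ 1, γ' 1) ∈ Γ := by rw [e1]; exact (hφ _ hb).2
  refine ⟨Γ ∪ arcG γ γ', E1', E2', d1, d2, ?_, h.cpt.union (arcG_compact c1 c1'), ?_, ?_⟩
  · exact (h.fin.sdiff).union (by simp)
  · exact h.h1.split hD c2 hP j1 j2 hE hEE f1 f2 f1' f2'
      (fun x hx => ⟨φ x, ⟨x, hx, rfl⟩, (hφ x (k1 hx)).2⟩)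
      (fun x hx => ⟨φ x, ⟨x, hx, rfl⟩, (hφ x (k2 hx)).2⟩) g0 g1
  · have := h.h2.split (D := D') (D' := D) hD c2' hP' j1' j2' hE' hEE' f1' f2' f1 f2
      (by rintro _ ⟨x, hx, rfl⟩; exact ⟨x, hx, (hφ x (k1 hx)).2⟩)
      (by rintro _ ⟨x, hx, rfl⟩; exact ⟨x, hx, (hφ x (k2 hx)).2⟩) g0 g1
    convert this using 1
    · rw [preimage_union, arcG_swap]
    · ext ⟨u, v⟩
      simp [and_comm]

lemma Cut.refine [MS Y] {Good : Set X → Prop} {D : Set X} (hc : Cut Good D) :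
    ∀ (Γ : Set (X × Y)) (F : Set (Set X × Set Y)) (D' : Set Y), St Γ F → (D, D') ∈ F →
    ∃ Γ' F', St Γ' F' ∧ (∀ p ∈ F', (p ∈ F ∧ p ≠ (D, D')) ∨ (Good p.1 ∧ p.1 ⊆ D ∧ p.2 ⊆ D')) ∧
      (∀ p ∈ F, p ≠ (D, D') → p ∈ F') := by
  induction hc with
  | leaf D h1 h2 =>
    intro Γ F D' hS hD
    refine ⟨Γ, F, hS, ?_, fun p hp _ => hp⟩
    intro p hp
    by_cases he : p = (D, D')
    · subst he; exact Or.inr ⟨h2, Subset.rfl, Subset.rfl⟩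
    · exact Or.inl ⟨hp, he⟩
  | split D a b A1 A2 P E1 E2 h1 h2 h3 h4 h5 h6 h7 h8 h9 h10 _ _ ih1 ih2 =>
    intro Γ F D' hS hD
    obtain ⟨Γ1, E1', E2', d1, d2, hS1⟩ := hS.split hD h2 h3 h4 h5 h6 h7 h8 h9 h10
    have s1 : E1 ⊆ D := fun x hx => (h8 ▸ Or.inl hx : x ∈ D \ P).1
    have s2 : E2 ⊆ D := fun x hx => (h8 ▸ Or.inr hx : x ∈ D \ P).1
    have hne : (E2, E2') ≠ (E1, E1') := by
      intro he
      obtain ⟨e, -⟩ := Prod.mk.inj he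
      subst e
      obtain ⟨x, hx⟩ := h6.2.1.nonempty
      exact disjoint_left.1 h7 hx hx
    have hneD : ∀ E E', (E, E') ∈ F → (E, E') ≠ (D, D') → E ≠ E1 ∧ E ≠ E2 := by
      intro E E' hE hne
      have hdj := hS.h1.disj _ _ _ _ hE hD hne
      constructor
      · rintro rfl
        obtain ⟨x, hx⟩ := h5.2.1.nonempty
        exact disjoint_left.1 hdj hx (s1 hx)
      · rintro rfl
        obtain ⟨x, hx⟩ := h6.2.1.nonempty
        exact disjoint_left.1 hdj hx (s2 hx)
    obtain ⟨Γ2, F2, hS2, q1, q2⟩ := ih1 Γ1 _ E1' hS1 (by simp)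
    obtain ⟨Γ3, F3, hS3, r1, r2⟩ := ih2 Γ2 F2 E2' hS2 (q2 _ (by simp) hne)
    refine ⟨Γ3, F3, hS3, ?_, ?_⟩
    · intro p hp
      rcases r1 p hp with ⟨hp2, hn2⟩ | ⟨u1, u2, u3⟩
      · rcases q1 p hp2 with ⟨hp1, hn1⟩ | ⟨u1, u2, u3⟩
        · rcases hp1 with hp1 | hp1 | hp1
          · exact Or.inl hp1
          · exact absurd hp1 hn1
          · exact absurd hp1 hn2
        · exact Or.inr ⟨u1, u2.trans s1, u3.trans d1⟩
      · exact Or.inr ⟨u1, u2.trans s2, u3.trans d2⟩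
    · rintro ⟨p, p'⟩ hp hpn
      have := hneD p p' hp hpn
      exact r2 _ (q2 _ (Or.inl ⟨hp, hpn⟩) fun e => this.1 (Prod.mk.inj e).1)
        fun e => this.2 (Prod.mk.inj e).1

lemma St.refine_fin [MS X] [MS Y] {Γ : Set (X × Y)} {F : Set (Set X × Set Y)} (h : St Γ F)
    {ε : ℝ} (hε : 0 < ε) (S : Finset (Set X × Set Y)) : (S : Set (Set X × Set Y)) ⊆ F →
    ∃ Γ' F', St Γ' F' ∧ (∀ p ∈ F', (p ∈ F ∧ p ∉ S) ∨
      ((∃ x, p.1 ⊆ ball x ε) ∧ ∃ q ∈ F, p.1 ⊆ q.1 ∧ p.2 ⊆ q.2)) ∧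
      (∀ p ∈ F, p ∉ S → p ∈ F') := by
  classical
  induction S using Finset.induction_on with
  | empty => intro _; exact ⟨Γ, F, h, fun p hp => Or.inl ⟨hp, by simp⟩, fun p hp _ => hp⟩
  | insert d S hd ih =>
    intro hsub
    obtain ⟨Γ1, F1, hS1, q1, q2⟩ := ih (fun x hx => hsub (by simp at hx ⊢; exact Or.inr hx))
    obtain ⟨D, D'⟩ := d
    have hdF : (D, D') ∈ F := hsub (by simp)
    have hd1 := q2 _ hdF hd
    obtain ⟨Γ2, F2, hS2, r1, r2⟩ := (cut_small (h.h1.jd _ _ hdF) hε).refine Γ1 F1 D' hS1 hd1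
    refine ⟨Γ2, F2, hS2, ?_, ?_⟩
    · intro p hp
      rcases r1 p hp with ⟨u1, u2⟩ | ⟨u1, u2, u3⟩
      · rcases q1 p u1 with ⟨v1, v2⟩ | v
        · exact Or.inl ⟨v1, by simp [u2, v2]⟩
        · exact Or.inr v
      · exact Or.inr ⟨u1, _, hdF, u2, u3⟩
    · intro p hp hpn
      simp at hpn
      exact r2 p (q2 p hp hpn.2) hpn.1

lemma St.refine1 [MS X] [MS Y] {Γ : Set (X × Y)} {F : Set (Set X × Set Y)} (h : St Γ F)
    {ε : ℝ} (hε : 0 < ε) :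
    ∃ Γ' F', St Γ' F' ∧ ∀ p ∈ F',
      ((∃ x, p.1 ⊆ ball x ε) ∧ ∃ q ∈ F, p.1 ⊆ q.1 ∧ p.2 ⊆ q.2) := by
  obtain ⟨Γ', F', h1, h2, -⟩ := h.refine_fin hε h.fin.toFinset (by simp)
  refine ⟨Γ', F', h1, fun p hp => ?_⟩
  rcases h2 p hp with ⟨u, v⟩ | u
  · simp [u] at v
  · exact u

lemma St.refine2 [MS X] [MS Y] {Γ : Set (X × Y)} {F : Set (Set X × Set Y)} (h : St Γ F)
    {ε : ℝ} (hε : 0 < ε) :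
    ∃ Γ' F', St Γ' F' ∧ ∀ p ∈ F', (∃ x, p.1 ⊆ ball x ε) ∧ (∃ x, p.2 ⊆ ball x ε) ∧
      ∃ q ∈ F, p.1 ⊆ q.1 ∧ p.2 ⊆ q.2 := by
  obtain ⟨Γ1, F1, h1, q1⟩ := h.refine1 hε
  obtain ⟨Γ2, F2, h2, q2⟩ := h1.swap.refine1 hε
  refine ⟨_, _, h2.swap, ?_⟩
  rintro ⟨p, p'⟩ hp
  obtain ⟨r1, ⟨w', w⟩, hw, r2, r3⟩ := q2 (p', p) hp
  obtain ⟨⟨x, hx⟩, q, hq, r4, r5⟩ := q1 (w, w') hw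
  exact ⟨⟨x, r3.trans hx⟩, r1, q, hq, r3.trans r4, r2.trans r5⟩

end st


section fin
variable {X Y : Type} [MetricSpace X] [MetricSpace Y]

lemma half_init {a b : X} {a' b' : Y} {C D E : Set X} {C' D' E' : Set Y}
    {γ δ : ℝ → X} {γ' δ' : ℝ → Y} (h1 : InjOn γ (Icc 0 1)) (h2 : InjOn δ (Icc 0 1))
    (h3 : γ '' Icc 0 1 ∩ δ '' Icc 0 1 ⊆ {a, b}) (h4 : γ '' Icc 0 1 ∪ δ '' Icc 0 1 = C)
    (g0 : γ 0 = a) (g1 : γ 1 = b) (d0 : δ 0 = a) (d1 : δ 1 = b)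
    (h4' : γ' '' Icc 0 1 ∪ δ' '' Icc 0 1 = C')
    (g0' : γ' 0 = a') (g1' : γ' 1 = b') (d0' : δ' 0 = a') (d1' : δ' 1 = b')
    (jD : JDom D) (jE : JDom E) (hDE : Disjoint D E) (fD : frontier D = C) (fE : frontier E = C)
    (hU : D ∪ E = Cᶜ) (fD' : frontier D' = C') (fE' : frontier E' = C') :
    Half (arcG γ γ' ∪ arcG δ δ') {(D, D'), (E, E')} := by
  have m0 : (0:ℝ) ∈ Icc (0:ℝ) 1 := by simp
  have m1 : (1:ℝ) ∈ Icc (0:ℝ) 1 := by simp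
  have cross : ∀ t ∈ Icc (0:ℝ) 1, ∀ s ∈ Icc (0:ℝ) 1, γ t = δ s → γ' t = δ' s := by
    intro t ht s hs e
    rcases h3 ⟨⟨t, ht, rfl⟩, ⟨s, hs, e.symm⟩⟩ with h | h
    · rw [h1 ht m0 (h.trans g0.symm), h2 hs m0 ((e.symm.trans h).trans d0.symm), g0', d0']
    · rw [h1 ht m1 (h.trans g1.symm), h2 hs m1 ((e.symm.trans h).trans d1.symm), g1', d1']
  have tot : ∀ x ∈ C, ∃ y ∈ C', (x, y) ∈ arcG γ γ' ∪ arcG δ δ' := by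
    rw [← h4, ← h4']
    rintro x (⟨t, ht, rfl⟩ | ⟨t, ht, rfl⟩)
    · exact ⟨γ' t, Or.inl ⟨t, ht, rfl⟩, Or.inl ⟨t, ht, rfl⟩⟩
    · exact ⟨δ' t, Or.inr ⟨t, ht, rfl⟩, Or.inr ⟨t, ht, rfl⟩⟩
  have dom : ∀ x y, (x, y) ∈ arcG γ γ' ∪ arcG δ δ' → x ∈ C := by
    rw [← h4]
    rintro x y (⟨t, ht, h⟩ | ⟨t, ht, h⟩)
    · exact Or.inl ⟨t, ht, (Prod.mk.inj h).1⟩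
    · exact Or.inr ⟨t, ht, (Prod.mk.inj h).1⟩
  refine ⟨?_, ?_, ?_, ?_, ?_, ?_⟩
  · rintro x y y' (⟨t, ht, u⟩ | ⟨t, ht, u⟩) (⟨s, hs, v⟩ | ⟨s, hs, v⟩)
    · obtain ⟨rfl, rfl⟩ := Prod.mk.inj u
      obtain ⟨e, rfl⟩ := Prod.mk.inj v
      rw [h1 hs ht e]
    · obtain ⟨rfl, rfl⟩ := Prod.mk.inj u
      obtain ⟨e, rfl⟩ := Prod.mk.inj v
      exact cross t ht s hs e.symm
    · obtain ⟨rfl, rfl⟩ := Prod.mk.inj u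
      obtain ⟨e, rfl⟩ := Prod.mk.inj v
      exact (cross s hs t ht e).symm
    · obtain ⟨rfl, rfl⟩ := Prod.mk.inj u
      obtain ⟨e, rfl⟩ := Prod.mk.inj v
      rw [h2 hs ht e]
  · rintro G G' (h | h)
    · obtain ⟨rfl, rfl⟩ := Prod.mk.inj h; exact jD
    · obtain ⟨rfl, rfl⟩ := Prod.mk.inj h; exact jE
  · rintro G G' K K' (h | h) (k | k) hne
    · exact absurd (h.trans k.symm) hne
    · obtain ⟨rfl, rfl⟩ := Prod.mk.inj h
      obtain ⟨rfl, rfl⟩ := Prod.mk.inj k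
      exact hDE
    · obtain ⟨rfl, rfl⟩ := Prod.mk.inj h
      obtain ⟨rfl, rfl⟩ := Prod.mk.inj k
      exact hDE.symm
    · exact absurd (h.trans k.symm) hne
  · intro x
    by_cases hx : x ∈ C
    · exact ⟨D, D', by simp, frontier_subset_closure (fD ▸ hx)⟩
    · rcases (hU ▸ hx : x ∈ D ∪ E) with h | h
      · exact ⟨D, D', by simp, subset_closure h⟩
      · exact ⟨E, E', by simp, subset_closure h⟩
  · rintro G G' (h | h)
    · obtain ⟨rfl, rfl⟩ := Prod.mk.inj h; rw [fD, fD']; exact tot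
    · obtain ⟨rfl, rfl⟩ := Prod.mk.inj h; rw [fE, fE']; exact tot
  · rintro G G' (h | h) x y hxy hx
    · obtain ⟨rfl, rfl⟩ := Prod.mk.inj h
      exact (hU ▸ Or.inl hx : x ∈ Cᶜ) (dom _ _ hxy)
    · obtain ⟨rfl, rfl⟩ := Prod.mk.inj h
      exact (hU ▸ Or.inr hx : x ∈ Cᶜ) (dom _ _ hxy)

lemma st_init [MS X] [MS Y] : ∃ (Γ : Set (X × Y)) (F : Set (Set X × Set Y)), St Γ F := by
  obtain ⟨C, D, E, a, b, A1, A2, ⟨⟨γ, c1, i1, g0, g1, rfl⟩, ⟨δ, c2, i2, d0, d1, rfl⟩, h3, h4⟩,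
    jD, jE, hDE, fD, fE, hU⟩ := exists_faces (X := X)
  obtain ⟨C', D', E', a', b', A1', A2', ⟨⟨γ', c1', i1', g0', g1', rfl⟩,
    ⟨δ', c2', i2', d0', d1', rfl⟩, h3', h4'⟩,
    jD', jE', hDE', fD', fE', hU'⟩ := exists_faces (X := Y)
  refine ⟨arcG γ γ' ∪ arcG δ δ', {(D, D'), (E, E')}, by simp,
    (arcG_compact c1 c1').union (arcG_compact c2 c2'),
    half_init i1 i2 h3 h4 g0 g1 d0 d1 h4' g0' g1' d0' d1' jD jE hDE fD fE hU fD' fE', ?_⟩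
  have := half_init i1' i2' h3' h4' g0' g1' d0' d1' h4 g0 g1 d0 d1 jD' jE' hDE' fD' fE' hU' fD fE
  convert this using 1
  · rw [preimage_union, arcG_swap, arcG_swap]
  · ext ⟨u, v⟩
    simp [and_comm]

def FRel (F : Set (Set X × Set Y)) : Set (X × Y) := ⋃ p ∈ F, closure p.1 ×ˢ closure p.2

lemma mem_FRel {F : Set (Set X × Set Y)} {x : X} {y : Y} :
    (x, y) ∈ FRel F ↔ ∃ D D', (D, D') ∈ F ∧ x ∈ closure D ∧ y ∈ closure D' := by
  simp only [FRel, mem_iUnion, mem_prod, exists_prop, Prod.exists]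

lemma FRel_swap {F : Set (Set X × Set Y)} : Prod.swap ⁻¹' (FRel F) = FRel (Prod.swap ⁻¹' F) := by
  ext ⟨y, x⟩
  change (x, y) ∈ FRel F ↔ _
  rw [mem_FRel, mem_FRel]
  constructor
  · rintro ⟨D, D', h, h1, h2⟩; exact ⟨D', D, h, h2, h1⟩
  · rintro ⟨D, D', h, h1, h2⟩; exact ⟨D', D, h, h2, h1⟩

lemma FRel_closed {F : Set (Set X × Set Y)} (h : F.Finite) : IsClosed (FRel F) :=
  h.isClosed_biUnion fun _ _ => isClosed_closure.prod isClosed_closure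

lemma St.func_close {Γ : Set (X × Y)} {F : Set (Set X × Set Y)} (h : St Γ F) {ε : ℝ}
    (hm : ∀ p ∈ F, ∃ z, p.2 ⊆ ball z ε) {x : X} {y y' : Y} (h1 : (x, y) ∈ FRel F)
    (h2 : (x, y') ∈ FRel F) : dist y y' ≤ 4 * ε := by
  rw [mem_FRel] at h1 h2
  obtain ⟨D, D', hD, xD, yD⟩ := h1
  obtain ⟨E, E', hE, xE, yE⟩ := h2
  have close : ∀ K K', (K, K') ∈ F → ∀ u ∈ closure K', ∀ v ∈ closure K', dist u v ≤ 2 * ε := by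
    intro K K' hK u hu v hv
    obtain ⟨z, hz⟩ := hm _ hK
    have hz' : closure K' ⊆ closedBall z ε := (closure_mono hz).trans closure_ball_subset_closedBall
    have h1 := mem_closedBall.1 (hz' hu)
    have h2 := mem_closedBall'.1 (hz' hv)
    have := dist_triangle u z v
    linarith
  by_cases he : (D, D') = (E, E')
  · obtain ⟨rfl, rfl⟩ := Prod.mk.inj he
    have h1 := close _ _ hD y yD y' yE
    have := dist_nonneg (x := y) (y := y')
    linarith
  · have hd := h.h1.disj _ _ _ _ hD hE he
    have oD := (h.h1.jd _ _ hD).1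
    have oE := (h.h1.jd _ _ hE).1
    have n1 : x ∉ D := fun hx => disjoint_left.1 (hd.closure_right oD) hx xE
    have n2 : x ∉ E := fun hx => disjoint_left.1 (hd.closure_left oE) xD hx
    have fD : x ∈ frontier D := by rw [oD.frontier_eq]; exact ⟨xD, n1⟩
    have fE : x ∈ frontier E := by rw [oE.frontier_eq]; exact ⟨xE, n2⟩
    obtain ⟨u, hu, hxu⟩ := h.h1.tot _ _ hD x fD
    obtain ⟨v, hv, hxv⟩ := h.h1.tot _ _ hE x fE
    obtain rfl := h.h1.func _ _ _ hxu hxv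
    have h1 := close _ _ hD y yD u (frontier_subset_closure hu)
    have h2 := close _ _ hE u (frontier_subset_closure hv) y' yE
    have := dist_triangle y u y'
    linarith

lemma St.total {Γ : Set (X × Y)} {F : Set (Set X × Set Y)} (h : St Γ F) (x : X) :
    ∃ y, (x, y) ∈ FRel F := by
  obtain ⟨D, D', hD, hx⟩ := h.h1.cov x
  obtain ⟨y, hy⟩ := (h.h2.jd D' D hD).2.1.nonempty
  exact ⟨y, mem_FRel.2 ⟨D, D', hD, hx, subset_closure hy⟩⟩

lemma lim_rel [CompactSpace Y] {Γ : ℕ → Set (X × Y)} {F : ℕ → Set (Set X × Set Y)}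
    (h : ∀ n, St (Γ n) (F n)) (hn : ∀ n, FRel (F (n + 1)) ⊆ FRel (F n)) (x : X) :
    ∃ y, ∀ n, (x, y) ∈ FRel (F n) := by
  have hcl : ∀ n, IsClosed {y | (x, y) ∈ FRel (F n)} := fun n =>
    (FRel_closed (h n).fin).preimage (Continuous.prodMk_right x)
  obtain ⟨y, hy⟩ := IsCompact.nonempty_iInter_of_sequence_nonempty_isCompact_isClosed
    (fun n => {y | (x, y) ∈ FRel (F n)}) (fun n y hy => hn n hy) (fun n => (h n).total x)
    (hcl 0).isCompact hcl
  exact ⟨y, fun n => mem_iInter.1 hy n⟩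

lemma lim_func {Γ : ℕ → Set (X × Y)} {F : ℕ → Set (Set X × Set Y)}
    (h : ∀ n, St (Γ n) (F n)) (hm : ∀ n, ∀ p ∈ F (n + 1), ∃ z, p.2 ⊆ ball z (1 / ((n : ℝ) + 1)))
    {x : X} {y y' : Y} (h1 : ∀ n, (x, y) ∈ FRel (F n)) (h2 : ∀ n, (x, y') ∈ FRel (F n)) :
    y = y' := by
  have h3 : ∀ n : ℕ, dist y y' ≤ 4 * (1 / ((n : ℝ) + 1)) := fun n =>
    (h (n + 1)).func_close (hm n) (h1 _) (h2 _)
  have h4 : Tendsto (fun n : ℕ => 4 * (1 / ((n : ℝ) + 1))) atTop (𝓝 (4 * 0)) :=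
    tendsto_one_div_add_atTop_nhds_zero_nat.const_mul 4
  have := ge_of_tendsto' h4 h3
  rw [mul_zero] at this
  exact dist_le_zero.1 this

theorem ms_homeo (X Y : Type) [MetricSpace X] [MetricSpace Y] [MS X] [MS Y] :
    Nonempty (X ≃ₜ Y) := by
  obtain ⟨Γ0, F0, h0⟩ := st_init (X := X) (Y := Y)
  have step : ∀ (n : ℕ) (s : {s : Set (X × Y) × Set (Set X × Set Y) // St s.1 s.2}),
      ∃ s' : {s : Set (X × Y) × Set (Set X × Set Y) // St s.1 s.2}, ∀ p ∈ s'.1.2,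
        (∃ x, p.1 ⊆ ball x (1 / ((n : ℝ) + 1))) ∧ (∃ x, p.2 ⊆ ball x (1 / ((n : ℝ) + 1))) ∧
      ∃ q ∈ s.1.2, p.1 ⊆ q.1 ∧ p.2 ⊆ q.2 := by
    rintro n ⟨⟨Γ, F⟩, h⟩
    obtain ⟨Γ', F', h', hh⟩ := St.refine2 h (Nat.one_div_pos_of_nat (α := ℝ) (n := n))
    exact ⟨⟨(Γ', F'), h'⟩, hh⟩
  choose nx hnx using step
  let sq : ℕ → {s : Set (X × Y) × Set (Set X × Set Y) // St s.1 s.2} := fun n =>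
    Nat.rec ⟨(Γ0, F0), h0⟩ (fun k s => nx k s) n
  have hsq : ∀ n, sq (n + 1) = nx n (sq n) := fun n => rfl
  have hS : ∀ n, St (sq n).1.1 (sq n).1.2 := fun n => (sq n).2
  have hR : ∀ n, ∀ p ∈ (sq (n + 1)).1.2,
        (∃ x, p.1 ⊆ ball x (1 / ((n : ℝ) + 1))) ∧ (∃ x, p.2 ⊆ ball x (1 / ((n : ℝ) + 1))) ∧
      ∃ q ∈ (sq n).1.2, p.1 ⊆ q.1 ∧ p.2 ⊆ q.2 := fun n => hnx n (sq n)
  clear_value sq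
  have hmono : ∀ n, FRel (sq (n + 1)).1.2 ⊆ FRel (sq n).1.2 := by
    rintro n ⟨x, y⟩ hxy
    obtain ⟨D, D', hD, h1, h2⟩ := mem_FRel.1 hxy
    obtain ⟨-, -, ⟨E, E'⟩, hE, h3, h4⟩ := hR n _ hD
    exact mem_FRel.2 ⟨E, E', hE, closure_mono h3 h1, closure_mono h4 h2⟩
  have t1 := lim_rel hS hmono
  have t2 := lim_rel (fun n => (hS n).swap) (fun n => by
    rw [← FRel_swap, ← FRel_swap]; exact preimage_mono (hmono n))
  have f1 : ∀ x y y', (∀ n, (x, y) ∈ FRel (sq n).1.2) → (∀ n, (x, y') ∈ FRel (sq n).1.2) → y = y' :=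
    fun x y y' => lim_func hS (fun n p hp => (hR n p hp).2.1)
  have f2 : ∀ y x x', (∀ n, (x, y) ∈ FRel (sq n).1.2) → (∀ n, (x', y) ∈ FRel (sq n).1.2) →
      x = x' := by
    intro y x x' h1 h2
    refine lim_func (fun n => (hS n).swap) (fun n p hp => (hR n p.swap hp).1) (x := y) ?_ ?_
    · intro n; rw [← FRel_swap]; exact h1 n
    · intro n; rw [← FRel_swap]; exact h2 n
  choose φ hφ using t1
  choose ψ hψ using t2
  have hψ' : ∀ y n, (ψ y, y) ∈ FRel (sq n).1.2 := by
    intro y n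
    have := hψ y n
    rw [← FRel_swap] at this
    exact this
  let e : X ≃ Y := ⟨φ, ψ, fun x => f2 (φ x) _ _ (hψ' _) (hφ x),
    fun y => f1 (ψ y) _ _ (hφ _) (hψ' y)⟩
  have hc : Continuous φ := by
    rw [← continuousOn_univ]
    refine graph_cont (Γ := ⋂ n, FRel (sq n).1.2)
      (isClosed_iInter fun n => FRel_closed (hS n).fin).isCompact ?_ ?_
    · intro x y y' h1 h2
      exact f1 x y y' (mem_iInter.1 h1) (mem_iInter.1 h2)
    · intro x _
      exact mem_iInter.2 (hφ x)
  exact ⟨Continuous.homeoOfEquivCompactToT2 (f := e) hc⟩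

end fin

theorem stmt_12 (X : Type) [TopologicalSpace X] [CompactSpace X] [T2Space X]
    (f : ↥(sphere (0 : EuclideanSpace ℝ (Fin 3)) 1) → X) (hf : Continuous f)
    (hfib : ∀ x : X, IsConnected (f ⁻¹' {x}) ∧ IsConnected ((f ⁻¹' {x})ᶜ)) :
    Nonempty (↥(sphere (0 : EuclideanSpace ℝ (Fin 3)) 1) ≃ₜ X) := by
  have hm := metrizable_of_image hf (fun x => (hfib x).1.nonempty)
  letI := TopologicalSpace.metrizableSpaceMetric X
  haveI := sph_lpc
  haveI := sph_conn
  haveI := sph_ms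
  haveI : MS X := ms_of_map sph_j1 hf hfib
  exact ms_homeo Sph X
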